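/- Let N ≥ 3, m > 1, and let ρ satisfy the weight condition. Let Ω ⊂ ℝ^N be a bounded smooth domain, 0 ≤ τ₁ < τ₂, u₀ ∈ L^∞(Ω) and g ∈ L^∞(∂Ω×(τ₁,τ₂), dσ⊗dt). Let u ∈ L^∞(Ω×(τ₁,τ₂)) be a very weak subsolution and v ∈ L^∞(Ω×(τ₁,τ₂)) a very weak supersolution of the Cauchy–Dirichlet problem ρ u_t = Δ(u^m) in Ω×(τ₁,τ₂), u^m = g on ∂Ω×(τ₁,τ₂), u = u₀ on Ω×{τ₁}. Then u ≤ v almost everywhere in Ω×(τ₁,τ₂). -/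

import Mathlib

open MeasureTheory Set Metric Filter
open scoped ENNReal Topology

noncomputable section

abbrev Eu (N : ℕ) := EuclideanSpace ℝ (Fin N)

/-- Signed power `a^q = |a|^{q-1} a`. -/
def spow (a q : ℝ) : ℝ := |a| ^ (q - 1) * a

/-- The weight condition \eqref{weight-cond}: `ρ` is measurable and
`C̲ (1+|x|)^{-γ} ≤ ρ(x) ≤ C̄ |x|^{-γ}` for a.e. `x`, with `γ ∈ [0,2)` and `0 < C̲ < C̄`. -/
def WeightCond (N : ℕ) (γ Cl Cu : ℝ) (ρ : Eu N → ℝ) : Prop :=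
  Measurable ρ ∧ 0 ≤ γ ∧ γ < 2 ∧ 0 < Cl ∧ Cl < Cu ∧
    ∀ᵐ x ∂(volume : Measure (Eu N)), Cl * (1 + ‖x‖) ^ (-γ) ≤ ρ x ∧ ρ x ≤ Cu * ‖x‖ ^ (-γ)

/-- Time derivative `ψ_t` of a space-time test function. -/
def ptder {N : ℕ} (ψ : Eu N × ℝ → ℝ) (p : Eu N × ℝ) : ℝ := fderiv ℝ ψ p (0, 1)

/-- Spatial Laplacian `Δψ` of a space-time test function. -/
def lapX {N : ℕ} (ψ : Eu N × ℝ → ℝ) (p : Eu N × ℝ) : ℝ :=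
  ∑ i : Fin N, fderiv ℝ (fun q => fderiv ℝ ψ q (EuclideanSpace.single i 1, 0)) p
    (EuclideanSpace.single i 1, 0)

/-- Very weak solution of `ρ u_t = Δ(u^m)` in `Ω × (τ₁, τ₂)` (Definitions 2.6 / 2.8). -/
structure VWS {N : ℕ} (ρ : Eu N → ℝ) (m : ℝ) (Ω : Set (Eu N)) (τ₁ τ₂ : ℝ)
    (u : Eu N → ℝ → ℝ) : Prop where
  aemeas : AEMeasurable (fun p : Eu N × ℝ => u p.1 p.2)
    (volume.restrict (Ω ×ˢ Ioo τ₁ τ₂))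
  locint : ∀ K : Set (Eu N × ℝ), IsCompact K → K ⊆ Ω ×ˢ Ioo τ₁ τ₂ →
    IntegrableOn (fun p : Eu N × ℝ => |u p.1 p.2| * ρ p.1) K ∧
      IntegrableOn (fun p : Eu N × ℝ => |u p.1 p.2| ^ m) K
  weak : ∀ ψ : Eu N × ℝ → ℝ, ContDiff ℝ (⊤ : ℕ∞) ψ → HasCompactSupport ψ →
    tsupport ψ ⊆ Ω ×ˢ Ioo τ₁ τ₂ →
    ∫ p in Ω ×ˢ Ioo τ₁ τ₂,
      (u p.1 p.2 * ptder ψ p * ρ p.1 + spow (u p.1 p.2) m * lapX ψ p) = 0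

/-- `u ∈ L^∞_loc(Ω × (τ₁,τ₂))`. -/
def LinftyLoc {N : ℕ} (Ω : Set (Eu N)) (τ₁ τ₂ : ℝ) (u : Eu N → ℝ → ℝ) : Prop :=
  ∀ K : Set (Eu N × ℝ), IsCompact K → K ⊆ Ω ×ˢ Ioo τ₁ τ₂ →
    ∃ M : ℝ, ∀ᵐ p ∂(volume.restrict K : Measure (Eu N × ℝ)), |u p.1 p.2| ≤ M

section

/-- The coordinate unit vector. -/
abbrev unitVec {N : ℕ} (i : Fin N) : Eu N := EuclideanSpace.single i (1 : ℝ)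

/-- The Laplacian. -/
def lap {N : ℕ} (f : Eu N → ℝ) (x : Eu N) : ℝ :=
  ∑ i : Fin N, fderiv ℝ (fun y => fderiv ℝ f y (unitVec i)) x (unitVec i)

/-- The divergence of a vector field. -/
def divg {N : ℕ} (X : Eu N → Eu N) (x : Eu N) : ℝ :=
  ∑ i : Fin N, (fderiv ℝ X x (unitVec i)) i

variable {N : ℕ}

lemma inner_unitVec (v : Eu N) (i : Fin N) : inner ℝ v (unitVec i) = v i := by
  simp [unitVec, EuclideanSpace.inner_single_right]

lemma gradient_apply (f : Eu N → ℝ) (x : Eu N) (i : Fin N) :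
    gradient f x i = fderiv ℝ f x (unitVec i) := by
  rw [← inner_unitVec, inner_gradient_left]

lemma inner_eq_sum (v w : Eu N) : inner ℝ v w = ∑ i, v i * w i := by
  simp [PiLp.inner_apply, mul_comm]

lemma contDiff_gradient {f : Eu N → ℝ} {n k : WithTop ℕ∞} (hf : ContDiff ℝ n f) (hk : k + 1 ≤ n) :
    ContDiff ℝ k (gradient f) := by
  have h : ContDiff ℝ k (fderiv ℝ f) := hf.fderiv_right hk
  exact (InnerProductSpace.toDual ℝ (Eu N)).symm.toContinuousLinearEquiv.contDiff.comp h

lemma continuous_gradient {f : Eu N → ℝ} (hf : ContDiff ℝ 1 f) : Continuous (gradient f) :=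
  (contDiff_gradient (k := 0) hf (by norm_num)).continuous

lemma continuous_divg {X : Eu N → Eu N} (hX : ContDiff ℝ 1 X) : Continuous (divg X) := by
  unfold divg
  have h := hX.continuous_fderiv (by norm_num)
  fun_prop

lemma divg_gradient {f : Eu N → ℝ} (hf : ContDiff ℝ 2 f) (x : Eu N) :
    divg (gradient f) x = lap f x := by
  unfold divg lap
  refine Finset.sum_congr rfl fun i _ => ?_
  have h1 : DifferentiableAt ℝ (gradient f) x :=
    ((contDiff_gradient (k := 1) hf (by norm_num)).differentiable (by norm_num)) x
  have : (fun y => fderiv ℝ f y (unitVec i)) = (fun y => (EuclideanSpace.proj i : Eu N →L[ℝ] ℝ) (gradient f y)) := by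
    ext y; simp [gradient_apply]
  rw [this]
  have h2 := ((EuclideanSpace.proj i : Eu N →L[ℝ] ℝ).hasFDerivAt.comp x h1.hasFDerivAt).fderiv
  have h3 : fderiv ℝ (fun y => (EuclideanSpace.proj i : Eu N →L[ℝ] ℝ) (gradient f y)) x = _ := h2
  rw [h3]; simp

lemma continuous_lap {f : Eu N → ℝ} (hf : ContDiff ℝ 2 f) : Continuous (lap f) := by
  have : lap f = divg (gradient f) := by ext x; rw [divg_gradient hf]
  rw [this]
  exact continuous_divg (contDiff_gradient hf (by norm_num))

lemma gradient_mul {f g : Eu N → ℝ} {x : Eu N} (hf : DifferentiableAt ℝ f x)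
    (hg : DifferentiableAt ℝ g x) :
    gradient (fun y => f y * g y) x = f x • gradient g x + g x • gradient f x := by
  ext i
  simp only [gradient_apply, PiLp.add_apply, PiLp.smul_apply, smul_eq_mul]
  rw [fderiv_fun_mul hf hg]; simp

lemma gradient_comp {h : ℝ → ℝ} {h' : ℝ} {q : Eu N → ℝ} {x : Eu N} (hh : HasDerivAt h h' (q x))
    (hq : DifferentiableAt ℝ q x) :
    gradient (fun y => h (q y)) x = h' • gradient q x := by
  ext i
  simp only [gradient_apply, PiLp.smul_apply, smul_eq_mul]
  have h1 : HasFDerivAt (fun y => h (q y)) _ x := hh.comp_hasFDerivAt x hq.hasFDerivAt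
  rw [h1.fderiv]; simp

lemma divg_smul {f : Eu N → ℝ} {X : Eu N → Eu N} {x : Eu N} (hf : DifferentiableAt ℝ f x)
    (hX : DifferentiableAt ℝ X x) :
    divg (fun y => f y • X y) x = inner ℝ (gradient f x) (X x) + f x * divg X x := by
  unfold divg
  rw [fderiv_fun_smul hf hX, inner_eq_sum, Finset.mul_sum, ← Finset.sum_add_distrib]
  refine Finset.sum_congr rfl fun i _ => ?_
  simp [gradient_apply]; ring

lemma divg_sub {X Y : Eu N → Eu N} {x : Eu N} (hX : DifferentiableAt ℝ X x)
    (hY : DifferentiableAt ℝ Y x) :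
    divg (fun y => X y - Y y) x = divg X x - divg Y x := by
  unfold divg
  rw [fderiv_fun_sub hX hY, ← Finset.sum_sub_distrib]
  simp

lemma lap_comp {h h' h'' : ℝ → ℝ} {q : Eu N → ℝ} (hq : ContDiff ℝ 2 q)
    (hh : ∀ y, HasDerivAt h (h' (q y)) (q y)) (hh' : ∀ y, HasDerivAt h' (h'' (q y)) (q y))
    (x : Eu N) :
    lap (fun y => h (q y)) x = h'' (q x) * ‖gradient q x‖ ^ 2 + h' (q x) * lap q x := by
  have hqd : Differentiable ℝ q := hq.differentiable (by norm_num)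
  unfold lap
  rw [← real_inner_self_eq_norm_sq, inner_eq_sum, Finset.mul_sum, Finset.mul_sum,
    ← Finset.sum_add_distrib]
  refine Finset.sum_congr rfl fun i _ => ?_
  have e1 : (fun y => fderiv ℝ (fun y => h (q y)) y (unitVec i)) =
      fun y => h' (q y) * fderiv ℝ q y (unitVec i) := by
    ext y
    rw [← gradient_apply, gradient_comp (hh _) (hqd y)]; simp [gradient_apply]
  have h2 : DifferentiableAt ℝ (fun y => fderiv ℝ q y (unitVec i)) x := by
    have : ContDiff ℝ 1 (fderiv ℝ q) := hq.fderiv_right (by norm_num)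
    exact ((this.clm_apply contDiff_const).differentiable (by norm_num)) x
  have h3 : HasFDerivAt (fun y => h' (q y)) _ x := (hh' x).comp_hasFDerivAt x (hqd x).hasFDerivAt
  rw [e1, fderiv_fun_mul h3.differentiableAt h2, h3.fderiv]
  simp [gradient_apply]; ring

lemma lap_mul {f g : Eu N → ℝ} (hf : ContDiff ℝ 2 f) (hg : ContDiff ℝ 2 g) (x : Eu N) :
    lap (fun y => f y * g y) x =
      f x * lap g x + 2 * inner ℝ (gradient f x) (gradient g x) + g x * lap f x := by
  have hfd : Differentiable ℝ f := hf.differentiable (by norm_num)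
  have hgd : Differentiable ℝ g := hg.differentiable (by norm_num)
  have hf1 := contDiff_gradient (k := 1) hf (by norm_num)
  have hg1 := contDiff_gradient (k := 1) hg (by norm_num)
  have hf1d : Differentiable ℝ (gradient f) := hf1.differentiable (by norm_num)
  have hg1d : Differentiable ℝ (gradient g) := hg1.differentiable (by norm_num)
  rw [← divg_gradient (hf.mul hg)]
  have e : gradient (fun y => f y * g y) =
      fun y => f y • gradient g y - (-g y) • gradient f y := by
    ext1 y; rw [gradient_mul (hfd y) (hgd y)]; simp
  have hneg : gradient (fun y => -g y) x = - gradient g x := by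
    ext i; simp [gradient_apply, fderiv_fun_neg]
  rw [e, divg_sub ((hfd x).fun_smul (hg1d x)) ((hgd x).fun_neg.fun_smul (hf1d x)), divg_smul (hfd x) (hg1d x),
    divg_smul (hgd x).fun_neg (hf1d x), divg_gradient hf, divg_gradient hg, hneg, inner_neg_left,
    real_inner_comm (gradient f x)]
  ring

end

section
variable {N : ℕ}

/-- The divergence theorem for compactly supported fields. -/
lemma integral_divg_eq_zero {X : Eu N → Eu N} (hX : ContDiff ℝ 1 X) (hc : HasCompactSupport X) :
    ∫ x, divg X x = 0 := by
  have hd : Differentiable ℝ X := hX.differentiable (by norm_num)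
  have hcd : Continuous (fderiv ℝ X) := hX.continuous_fderiv (by norm_num)
  have hi : ∀ i : Fin N, Integrable (fun x => (fderiv ℝ X x (unitVec i)) i) := fun i => by
    refine Continuous.integrable_of_hasCompactSupport (by fun_prop) ?_
    exact (hc.fderiv ℝ).comp_left (g := fun L : Eu N →L[ℝ] Eu N => L (unitVec i) i) (by simp)
  unfold divg
  rw [integral_finsetSum _ fun i _ => hi i]
  refine Finset.sum_eq_zero fun i _ => ?_
  have e : ∀ x, fderiv ℝ (fun y => X y i) x (unitVec i) = (fderiv ℝ X x (unitVec i)) i := by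
    intro x
    have h : HasFDerivAt (fun y => X y i) _ x :=
      (EuclideanSpace.proj i : Eu N →L[ℝ] ℝ).hasFDerivAt.comp x (hd x).hasFDerivAt
    rw [h.fderiv]; simp
  have hXi : Integrable (fun x => X x i) := by
    refine Continuous.integrable_of_hasCompactSupport (by fun_prop) ?_
    exact hc.comp_left (g := fun v : Eu N => v i) (by simp)
  have := integral_mul_fderiv_eq_neg_fderiv_mul_of_integrable (μ := (volume : Measure (Eu N)))
    (f := fun _ => (1 : ℝ)) (g := fun x => X x i) (v := unitVec i) (by simp)
    (by simpa [e] using hi i) (by simpa using hXi) (by intros; fun_prop)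
    (fun x _ => by fun_prop)
  simpa [e] using this

/-- A bounded smooth domain `Ω = {D > 0}` with a nondegenerate defining function. -/
structure SmoothDom (D : Eu N → ℝ) (Ω : Set (Eu N)) : Prop where
  smooth : ContDiff ℝ (⊤ : ℕ∞) D
  eq : Ω = {x | 0 < D x}
  bdd : Bornology.IsBounded Ω
  frontier_eq : frontier Ω = {x | D x = 0}
  grad_ne : ∀ x, D x = 0 → gradient D x ≠ 0

namespace SmoothDom
variable {D : Eu N → ℝ} {Ω : Set (Eu N)}

lemma mem (h : SmoothDom D Ω) {x : Eu N} : x ∈ Ω ↔ 0 < D x := by rw [h.eq]; rfl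

lemma cont (h : SmoothDom D Ω) : Continuous D := h.smooth.continuous

lemma contDiff (h : SmoothDom D Ω) (n : ℕ) : ContDiff ℝ n D :=
  h.smooth.of_le (by exact_mod_cast le_top)

lemma isOpen (h : SmoothDom D Ω) : IsOpen Ω := by
  rw [h.eq]; exact isOpen_lt continuous_const h.cont

lemma meas (h : SmoothDom D Ω) : MeasurableSet Ω := h.isOpen.measurableSet

lemma mem_closure (h : SmoothDom D Ω) {x : Eu N} : x ∈ closure Ω ↔ 0 ≤ D x := by
  rw [closure_eq_self_union_frontier, h.frontier_eq, h.eq]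
  simp only [mem_union, mem_ofPred_eq, le_iff_lt_or_eq, eq_comm]

lemma isCompact_closure (h : SmoothDom D Ω) : IsCompact (closure Ω) := h.bdd.isCompact_closure

lemma volume_lt_top (h : SmoothDom D Ω) : volume Ω < ⊤ := h.bdd.measure_lt_top

lemma integrableOn_of_continuous (h : SmoothDom D Ω) {E : Type*} [NormedAddCommGroup E]
    {f : Eu N → E} (hf : Continuous f) : IntegrableOn f Ω :=
  (hf.continuousOn.integrableOn_compact h.isCompact_closure).mono_set subset_closure

lemma exists_bound (h : SmoothDom D Ω) {E : Type*} [NormedAddCommGroup E]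
    {f : Eu N → E} (hf : Continuous f) : ∃ C, 0 ≤ C ∧ ∀ x ∈ Ω, ‖f x‖ ≤ C := by
  obtain ⟨C, hC⟩ := h.isCompact_closure.exists_bound_of_continuousOn hf.continuousOn
  exact ⟨max C 0, le_max_right _ _, fun x hx => (hC x (subset_closure hx)).trans (le_max_left _ _)⟩

lemma isCompact_superlevel (h : SmoothDom D Ω) {τ : ℝ} (hτ : 0 < τ) : IsCompact {x | τ ≤ D x} :=
  Metric.isCompact_of_isClosed_isBounded (isClosed_le continuous_const h.cont)
    (h.bdd.subset fun _ hx => h.mem.2 (hτ.trans_le hx))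

end SmoothDom

/-- A smooth cutoff: `0` where `D ≤ τ`, `1` where `D ≥ 2τ`. -/
def cutoff (D : Eu N → ℝ) (τ : ℝ) (x : Eu N) : ℝ := Real.smoothTransition ((D x - τ) / τ)

/-- `D |∇ cutoff| / |∇ D|`. -/
def cutoffErr (D : Eu N → ℝ) (τ : ℝ) (x : Eu N) : ℝ :=
  deriv Real.smoothTransition ((D x - τ) / τ) * (D x / τ)

lemma deriv_smoothTransition_of_nonpos {t : ℝ} (ht : t ≤ 0) : deriv Real.smoothTransition t = 0 := by
  refine IsLocalMin.deriv_eq_zero (Filter.Eventually.of_forall fun s => ?_)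
  rw [Real.smoothTransition.zero_of_nonpos ht]; exact Real.smoothTransition.nonneg _

lemma deriv_smoothTransition_of_one_le {t : ℝ} (ht : 1 ≤ t) : deriv Real.smoothTransition t = 0 := by
  refine IsLocalMax.deriv_eq_zero (Filter.Eventually.of_forall fun s => ?_)
  rw [Real.smoothTransition.one_of_one_le ht]; exact Real.smoothTransition.le_one _

lemma deriv_smoothTransition_nonneg (t : ℝ) : 0 ≤ deriv Real.smoothTransition t :=
  Real.smoothTransition.monotone.deriv_nonneg

lemma continuous_deriv_smoothTransition : Continuous (deriv Real.smoothTransition) :=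
  (Real.smoothTransition.contDiff (n := 1)).continuous_deriv (by norm_num)

lemma exists_deriv_smoothTransition_le : ∃ S : ℝ, 0 ≤ S ∧ ∀ t, deriv Real.smoothTransition t ≤ S := by
  obtain ⟨S, hS⟩ := (isCompact_Icc (a := (0 : ℝ)) (b := 1)).exists_bound_of_continuousOn
    continuous_deriv_smoothTransition.continuousOn
  refine ⟨max S 0, le_max_right _ _, fun t => ?_⟩
  by_cases ht : t ∈ Icc (0 : ℝ) 1
  · exact (le_abs_self _).trans ((hS t ht).trans (le_max_left _ _))
  · rcases not_and_or.1 ht with h | h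
    · rw [deriv_smoothTransition_of_nonpos (le_of_not_ge h)]; exact le_max_right _ _
    · rw [deriv_smoothTransition_of_one_le (le_of_not_ge h)]; exact le_max_right _ _

lemma differentiable_smoothTransition : Differentiable ℝ Real.smoothTransition :=
  (Real.smoothTransition.contDiff (n := 1)).differentiable (by norm_num)

section cutoff
variable {D : Eu N → ℝ} {Ω : Set (Eu N)}

lemma contDiff_cutoff {n : ℕ} (hD : ContDiff ℝ n D) (τ : ℝ) : ContDiff ℝ n (cutoff D τ) :=
  Real.smoothTransition.contDiff.comp ((hD.sub contDiff_const).div_const τ)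

lemma cutoff_nonneg (τ : ℝ) (x : Eu N) : 0 ≤ cutoff D τ x := Real.smoothTransition.nonneg _

lemma cutoff_le_one (τ : ℝ) (x : Eu N) : cutoff D τ x ≤ 1 := Real.smoothTransition.le_one _

lemma tsupport_cutoff_subset (h : SmoothDom D Ω) {τ : ℝ} (hτ : 0 < τ) :
    tsupport (cutoff D τ) ⊆ {x | τ ≤ D x} := by
  refine closure_minimal (fun x hx => ?_) (isClosed_le continuous_const h.cont)
  by_contra hlt
  simp only [mem_ofPred_eq, not_le] at hlt
  exact hx (Real.smoothTransition.zero_of_nonpos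
    (div_nonpos_of_nonpos_of_nonneg (by linarith) hτ.le))

lemma superlevel_subset (h : SmoothDom D Ω) {τ : ℝ} (hτ : 0 < τ) : {x | τ ≤ D x} ⊆ Ω :=
  fun _ hx => h.mem.2 (hτ.trans_le hx)

lemma hasCompactSupport_cutoff (h : SmoothDom D Ω) {τ : ℝ} (hτ : 0 < τ) :
    HasCompactSupport (cutoff D τ) :=
  (h.isCompact_superlevel hτ).of_isClosed_subset (isClosed_tsupport _) (tsupport_cutoff_subset h hτ)

lemma gradient_cutoff (h : SmoothDom D Ω) (τ : ℝ) (x : Eu N) :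
    gradient (cutoff D τ) x =
      (deriv Real.smoothTransition ((D x - τ) / τ) / τ) • gradient D x := by
  have hD : DifferentiableAt ℝ D x := ((h.contDiff 1).differentiable (by norm_num)) x
  have h1 : HasDerivAt (fun t : ℝ => Real.smoothTransition ((t - τ) / τ))
      (deriv Real.smoothTransition ((D x - τ) / τ) * (1 / τ)) (D x) :=
    (differentiable_smoothTransition _).hasDerivAt.comp (D x)
      (((hasDerivAt_id (D x)).sub_const τ).div_const τ)
  have := gradient_comp h1 hD
  rw [mul_one_div] at this
  exact this

lemma continuous_cutoffErr (h : SmoothDom D Ω) (τ : ℝ) : Continuous (cutoffErr D τ) := by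
  have := h.cont
  have := continuous_deriv_smoothTransition
  unfold cutoffErr; fun_prop

lemma cutoffErr_bounds {S : ℝ} (hS0 : 0 ≤ S) (hS : ∀ t, deriv Real.smoothTransition t ≤ S) {τ : ℝ}
    (hτ : 0 < τ) {x : Eu N} (hx : 0 < D x) :
    0 ≤ cutoffErr D τ x ∧ cutoffErr D τ x ≤ 2 * S := by
  unfold cutoffErr
  refine ⟨mul_nonneg (deriv_smoothTransition_nonneg _) (by positivity), ?_⟩
  by_cases h : 2 * τ ≤ D x
  · rw [deriv_smoothTransition_of_one_le ((one_le_div hτ).2 (by linarith))]; linarith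
  · have : D x / τ ≤ 2 := by rw [div_le_iff₀ hτ]; linarith
    calc _ ≤ S * 2 := mul_le_mul (hS _) this (by positivity) hS0
      _ = 2 * S := by ring

lemma eventually_two_mul_le {d : ℝ} (hd : 0 < d) : ∀ᶠ n : ℕ in atTop, 2 * (1 / ((n : ℝ) + 1)) ≤ d := by
  have h := (tendsto_one_div_add_atTop_nhds_zero_nat (𝕜 := ℝ)).const_mul 2
  rw [mul_zero] at h
  exact (h.eventually (gt_mem_nhds hd)).mono fun n hn => hn.le

lemma eventually_cutoff {x : Eu N} (hx : 0 < D x) : ∀ᶠ n : ℕ in atTop,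
    cutoff D (1 / ((n : ℝ) + 1)) x = 1 ∧ cutoffErr D (1 / ((n : ℝ) + 1)) x = 0 := by
  filter_upwards [eventually_two_mul_le hx] with n hn
  have hτ : (0 : ℝ) < 1 / ((n : ℝ) + 1) := by positivity
  have : 1 ≤ (D x - 1 / ((n : ℝ) + 1)) / (1 / ((n : ℝ) + 1)) := (one_le_div hτ).2 (by linarith)
  exact ⟨Real.smoothTransition.one_of_one_le this, by
    rw [cutoffErr, deriv_smoothTransition_of_one_le this, zero_mul]⟩

/-- A field pointing inwards along the boundary has nonpositive total divergence. -/
lemma integral_divg_nonpos (h : SmoothDom D Ω) {X : Eu N → Eu N} (hX : ContDiff ℝ 1 X) {C : ℝ}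
    (hC : ∀ x ∈ Ω, -(C * D x) ≤ inner ℝ (X x) (gradient D x)) : ∫ x in Ω, divg X x ≤ 0 := by
  obtain ⟨S, hS0, hS⟩ := exists_deriv_smoothTransition_le
  set t : ℕ → ℝ := fun n => 1 / ((n : ℝ) + 1) with ht
  have htp : ∀ n, 0 < t n := fun n => by positivity
  have hdc := continuous_divg hX
  have hXd : Differentiable ℝ X := hX.differentiable (by norm_num)
  have hle : ∀ n, ∫ x in Ω, cutoff D (t n) x * divg X x ≤ ∫ x in Ω, C * cutoffErr D (t n) x := by
    intro n
    have hχ := contDiff_cutoff (h.contDiff 1) (t n)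
    have hχd : Differentiable ℝ (cutoff D (t n)) := hχ.differentiable (by norm_num)
    have h0 := integral_divg_eq_zero (hχ.smul hX)
      ((hasCompactSupport_cutoff h (htp n)).smul_right)
    have e : ∀ x, divg (fun y => cutoff D (t n) y • X y) x =
        inner ℝ (gradient (cutoff D (t n)) x) (X x) + cutoff D (t n) x * divg X x :=
      fun x => divg_smul (hχd x) (hXd x)
    have hz : ∀ x, x ∉ Ω → divg (fun y => cutoff D (t n) y • X y) x = 0 := by
      intro x hx
      have hx' : x ∉ tsupport (cutoff D (t n)) := fun hm =>
        hx (superlevel_subset h (htp n) (tsupport_cutoff_subset h (htp n) hm))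
      have hD : D x ≤ 0 := by by_contra hc; exact hx (h.mem.2 (not_le.1 hc))
      rw [e, image_eq_zero_of_notMem_tsupport hx', gradient_cutoff h,
        deriv_smoothTransition_of_nonpos
          (div_nonpos_of_nonpos_of_nonneg (by linarith [htp n]) (htp n).le)]
      simp
    have h1 : ∫ x in Ω, divg (fun y => cutoff D (t n) y • X y) x = 0 := by
      rw [setIntegral_eq_integral_of_forall_compl_eq_zero hz]; exact h0
    have hcg := continuous_gradient hχ
    have hcχ := hχ.continuous
    have i1 : IntegrableOn (fun x => inner ℝ (gradient (cutoff D (t n)) x) (X x)) Ω :=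
      h.integrableOn_of_continuous (hcg.inner hX.continuous)
    have i2 : IntegrableOn (fun x => cutoff D (t n) x * divg X x) Ω :=
      h.integrableOn_of_continuous (hcχ.mul hdc)
    simp_rw [e] at h1
    rw [integral_add i1 i2] at h1
    have h2 : ∫ x in Ω, -(C * cutoffErr D (t n) x) ≤
        ∫ x in Ω, inner ℝ (gradient (cutoff D (t n)) x) (X x) := by
      refine setIntegral_mono_on ?_ i1 h.meas fun x hx => ?_
      · exact h.integrableOn_of_continuous ((continuous_cutoffErr h _).const_mul C).neg
      rw [gradient_cutoff h, real_inner_smul_left, real_inner_comm, cutoffErr]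
      have := mul_le_mul_of_nonneg_left (hC x hx)
        (div_nonneg (deriv_smoothTransition_nonneg ((D x - t n) / t n)) (htp n).le)
      refine le_trans (le_of_eq ?_) this
      ring
    rw [integral_neg] at h2
    linarith
  have l1 : Tendsto (fun n => ∫ x in Ω, cutoff D (t n) x * divg X x) atTop
      (𝓝 (∫ x in Ω, divg X x)) := by
    refine tendsto_integral_of_dominated_convergence (fun x => ‖divg X x‖) (fun n => ?_) ?_
      (fun n => ?_) ?_
    · exact (((contDiff_cutoff (h.contDiff 1) (t n)).continuous.mul hdc)).aestronglyMeasurable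
    · exact (h.integrableOn_of_continuous hdc).norm
    · refine ae_of_all _ fun x => ?_
      rw [norm_mul, Real.norm_of_nonneg (cutoff_nonneg _ _)]
      exact mul_le_of_le_one_left (norm_nonneg _) (cutoff_le_one _ _)
    · refine (ae_restrict_iff' h.meas).2 (ae_of_all _ fun x hx => ?_)
      refine tendsto_const_nhds.congr' ?_
      filter_upwards [eventually_cutoff (h.mem.1 hx)] with n hn
      rw [hn.1, one_mul]
  have l2 : Tendsto (fun n => ∫ x in Ω, C * cutoffErr D (t n) x) atTop
      (𝓝 (∫ x in Ω, (0 : ℝ))) := by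
    refine tendsto_integral_of_dominated_convergence (fun _ => |C| * (2 * S)) (fun n => ?_) ?_
      (fun n => ?_) ?_
    · exact ((continuous_cutoffErr h _).const_mul C).aestronglyMeasurable
    · exact integrableOn_const (h.volume_lt_top.ne)
    · refine (ae_restrict_iff' h.meas).2 (ae_of_all _ fun x hx => ?_)
      obtain ⟨a, b⟩ := cutoffErr_bounds hS0 hS (htp n) (h.mem.1 hx)
      rw [norm_mul, Real.norm_of_nonneg a]
      exact mul_le_mul_of_nonneg_left b (abs_nonneg _)
    · refine (ae_restrict_iff' h.meas).2 (ae_of_all _ fun x hx => ?_)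
      refine tendsto_const_nhds.congr' ?_
      filter_upwards [eventually_cutoff (h.mem.1 hx)] with n hn
      rw [hn.2, mul_zero]
  rw [integral_zero] at l2
  exact le_of_tendsto_of_tendsto' l1 l2 hle

end cutoff
end

section
variable {N : ℕ}

/-- The truncated power `t₊ ^ n`. -/
def posPow (n : ℕ) (t : ℝ) : ℝ := max t 0 ^ n

lemma posPow_nonneg (n : ℕ) (t : ℝ) : 0 ≤ posPow n t := pow_nonneg (le_max_right _ _) _

lemma posPow_of_nonneg (n : ℕ) {t : ℝ} (ht : 0 ≤ t) : posPow n t = t ^ n := by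
  rw [posPow, max_eq_left ht]

lemma posPow_of_nonpos {n : ℕ} (hn : n ≠ 0) {t : ℝ} (ht : t ≤ 0) : posPow n t = 0 := by
  rw [posPow, max_eq_right ht, zero_pow hn]

lemma posPow_mono (n : ℕ) : Monotone (posPow n) := fun _ _ h =>
  pow_le_pow_left₀ (le_max_right _ _) (max_le_max_right 0 h) n

lemma continuous_posPow (n : ℕ) : Continuous (posPow n) := by unfold posPow; fun_prop

lemma posPow_succ (n : ℕ) (t : ℝ) : t * posPow (n + 1) t = posPow (n + 2) t := by
  rcases le_total 0 t with h | h
  · simp only [posPow_of_nonneg _ h]; ring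
  · rw [posPow_of_nonpos (by omega) h, posPow_of_nonpos (by omega) h, mul_zero]

lemma hasDerivAt_posPow (n : ℕ) (t : ℝ) :
    HasDerivAt (posPow (n + 2)) ((n + 2) * posPow (n + 1) t) t := by
  rcases lt_trichotomy t 0 with h | h | h
  · rw [posPow_of_nonpos (by omega) h.le, mul_zero]
    refine (hasDerivAt_const t (0 : ℝ)).congr_of_eventuallyEq ?_
    filter_upwards [Iio_mem_nhds h] with s hs
    exact posPow_of_nonpos (by omega) (le_of_lt hs)
  · subst h
    rw [posPow_of_nonpos (by omega) le_rfl, mul_zero, hasDerivAt_iff_isLittleO]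
    simp only [posPow_of_nonpos (show n + 2 ≠ 0 by omega) le_rfl, sub_zero, smul_zero]
    refine Asymptotics.IsBigO.trans_isLittleO (g := fun x : ℝ => x ^ (n + 2)) ?_ ?_
    · refine Asymptotics.IsBigO.of_bound 1 (Eventually.of_forall fun s => ?_)
      rw [one_mul, norm_pow, Real.norm_of_nonneg (posPow_nonneg _ _), posPow]
      exact pow_le_pow_left₀ (le_max_right _ _) (max_le (le_abs_self _) (abs_nonneg _)) _
    · simpa using Asymptotics.isLittleO_pow_pow (𝕜 := ℝ) (show 1 < n + 2 by omega)
  · rw [posPow_of_nonneg _ h.le]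
    have := hasDerivAt_pow (n + 2) t
    push_cast at this
    refine this.congr_of_eventuallyEq ?_
    filter_upwards [Ioi_mem_nhds h] with s hs
    exact posPow_of_nonneg _ (le_of_lt hs)

lemma contDiff_posPow (n : ℕ) : ∀ k, ContDiff ℝ n (posPow (n + 1 + k)) := by
  induction n with
  | zero => intro k; exact contDiff_zero.2 (continuous_posPow _)
  | succ n ih =>
    intro k
    have e : n + 1 + 1 + k = (n + k) + 2 := by ring
    rw [e]
    push_cast
    rw [contDiff_succ_iff_deriv]
    refine ⟨fun t => (hasDerivAt_posPow _ t).differentiableAt, by simp, ?_⟩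
    have : deriv (posPow (n + k + 2)) = fun t => (((n + k : ℕ) : ℝ) + 2) * posPow (n + 1 + k) t := by
      ext t; rw [(hasDerivAt_posPow (n + k) t).deriv]; congr 2; ring
    rw [this]
    exact contDiff_const.mul (ih k)

/-- `R² - |x - c|²`. -/
def quad (R : ℝ) (c x : Eu N) : ℝ := R ^ 2 - ‖x - c‖ ^ 2

lemma contDiff_quad (R : ℝ) (c : Eu N) (n : WithTop ℕ∞) : ContDiff ℝ n (quad R c) :=
  contDiff_const.sub ((contDiff_id.sub contDiff_const).norm_sq ℝ)

lemma fderiv_quad (R : ℝ) (c x v : Eu N) : fderiv ℝ (quad R c) x v = -2 * inner ℝ (x - c) v := by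
  have h : HasFDerivAt (quad R c) _ x :=
    (((hasFDerivAt_id x).sub_const c).norm_sq).const_sub (R ^ 2)
  rw [h.fderiv]; simp [inner_sub_left]

lemma gradient_quad (R : ℝ) (c x : Eu N) : gradient (quad R c) x = (-2 : ℝ) • (x - c) := by
  refine ext_inner_right ℝ fun v => ?_
  rw [inner_gradient_left, fderiv_quad, real_inner_smul_left]

lemma lap_quad (R : ℝ) (c x : Eu N) : lap (quad R c) x = -2 * N := by
  unfold lap
  have e : ∀ i : Fin N, fderiv ℝ (fun y => fderiv ℝ (quad R c) y (unitVec i)) x (unitVec i) = -2 := by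
    intro i
    simp_rw [fderiv_quad]
    have h : HasFDerivAt (fun y : Eu N => -2 * inner ℝ (y - c) (unitVec i)) _ x :=
      (((hasFDerivAt_id x).sub_const c).inner ℝ (hasFDerivAt_const (unitVec i) x)).const_mul (-2)
    rw [h.fderiv]; simp
  simp [e, mul_comm]

/-- The bump `(R² - |x - c|²)₊ ^ p`. -/
def bump (p : ℕ) (R : ℝ) (c x : Eu N) : ℝ := posPow p (quad R c x)

lemma bump_nonneg (p : ℕ) (R : ℝ) (c x : Eu N) : 0 ≤ bump p R c x := posPow_nonneg _ _

lemma contDiff_bump (k : ℕ) (R : ℝ) (c : Eu N) : ContDiff ℝ 2 (bump (k + 3) R c) := by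
  have := (contDiff_posPow 2 k).comp (contDiff_quad R c 2)
  rw [show 2 + 1 + k = k + 3 by ring] at this
  exact this

lemma continuous_quad (R : ℝ) (c : Eu N) : Continuous (quad R c) := (contDiff_quad R c 0).continuous

lemma continuous_bump (p : ℕ) (R : ℝ) (c : Eu N) : Continuous (bump p R c) :=
  (continuous_posPow p).comp (continuous_quad R c)

lemma gradient_bump (k : ℕ) (R : ℝ) (c x : Eu N) :
    gradient (bump (k + 2) R c) x = (-2 * (k + 2) * bump (k + 1) R c x) • (x - c) := by
  have := gradient_comp (hasDerivAt_posPow k (quad R c x))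
    ((contDiff_quad R c 1).differentiable (by norm_num) x)
  rw [gradient_quad, smul_smul] at this
  unfold bump
  rw [this]; congr 1; ring

lemma lap_bump (k : ℕ) (R : ℝ) (c x : Eu N) :
    lap (bump (k + 3) R c) x = (k + 3) * (4 * (k + 2) * bump (k + 1) R c x * ‖x - c‖ ^ 2
      - 2 * N * bump (k + 2) R c x) := by
  have h1 : ∀ t, HasDerivAt (posPow (k + 3)) (((k : ℝ) + 3) * posPow (k + 2) t) t := by
    intro t
    have := hasDerivAt_posPow (k + 1) t
    push_cast at this
    convert this using 1; ring
  have h2 : ∀ t, HasDerivAt (fun t => ((k : ℝ) + 3) * posPow (k + 2) t)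
      (((k : ℝ) + 3) * ((k + 2) * posPow (k + 1) t)) t := fun t =>
    (hasDerivAt_posPow k t).const_mul _
  have := lap_comp (h := posPow (k + 3)) (h' := fun t => ((k : ℝ) + 3) * posPow (k + 2) t)
    (h'' := fun t => ((k : ℝ) + 3) * ((k + 2) * posPow (k + 1) t)) (contDiff_quad R c 2) (fun y => h1 (quad R c y)) (fun y => h2 (quad R c y)) x
  rw [gradient_quad, lap_quad, norm_smul] at this
  unfold bump
  rw [this]
  norm_num
  ring

lemma bump_eq_zero {p : ℕ} (hp : p ≠ 0) {R : ℝ} (hR : 0 ≤ R) {c x : Eu N} (hx : R ≤ ‖x - c‖) :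
    bump p R c x = 0 :=
  posPow_of_nonpos hp (by unfold quad; nlinarith)

lemma bump_of_le (p : ℕ) {R : ℝ} {c x : Eu N} (hx : ‖x - c‖ ≤ R) :
    bump p R c x = (R ^ 2 - ‖x - c‖ ^ 2) ^ p :=
  posPow_of_nonneg p (by unfold quad; nlinarith [norm_nonneg (x - c)])

lemma bump_le (p : ℕ) {R : ℝ} (c x : Eu N) : bump p R c x ≤ (R ^ 2) ^ p := by
  refine pow_le_pow_left₀ (le_max_right _ _) (max_le ?_ (sq_nonneg _)) p
  unfold quad; nlinarith [sq_nonneg ‖x - c‖]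

lemma bump_succ (p : ℕ) (R : ℝ) (c x : Eu N) :
    bump (p + 2) R c x = (R ^ 2 - ‖x - c‖ ^ 2) * bump (p + 1) R c x := (posPow_succ _ _).symm

/-- The regularized Newton-type kernel `(|x|² + e²) ^ (-1/2)`. -/
def kern (e : ℝ) (x : Eu N) : ℝ := (‖x‖ ^ 2 + e ^ 2) ^ (-(1 / 2) : ℝ)

lemma kern_pos {e : ℝ} (he : 0 < e) (x : Eu N) : 0 < kern e x := by unfold kern; positivity

lemma kern_eq (e : ℝ) (x : Eu N) : kern e x = (-quad e (0 : Eu N) x + 2 * e ^ 2) ^ (-(1 / 2) : ℝ) := by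
  unfold kern quad; congr 1; rw [sub_zero]; ring

lemma kern_arg_pos {e : ℝ} (he : 0 < e) (x : Eu N) : 0 < -quad e (0 : Eu N) x + 2 * e ^ 2 := by
  unfold quad; rw [sub_zero]; nlinarith [sq_nonneg ‖x‖, pow_pos he 2]

lemma contDiff_kern {e : ℝ} (he : 0 < e) : ContDiff ℝ 2 (kern e : Eu N → ℝ) := by
  have : (kern e : Eu N → ℝ) = fun x => (-quad e (0 : Eu N) x + 2 * e ^ 2) ^ (-(1 / 2) : ℝ) :=
    funext (kern_eq e)
  rw [this]
  exact ((contDiff_quad e 0 2).neg.add contDiff_const).rpow_const_of_ne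
    fun x => (kern_arg_pos he x).ne'

lemma lap_kern_nonpos (hN : 3 ≤ N) {e : ℝ} (he : 0 < e) (x : Eu N) : lap (kern e) x ≤ 0 := by
  have hf : (kern e : Eu N → ℝ) = fun x => (-quad e (0 : Eu N) x + 2 * e ^ 2) ^ (-(1 / 2) : ℝ) :=
    funext (kern_eq e)
  have h1 : ∀ y : Eu N, HasDerivAt (fun t : ℝ => (-t + 2 * e ^ 2) ^ (-(1 / 2) : ℝ))
      (1 / 2 * (-quad e (0 : Eu N) y + 2 * e ^ 2) ^ (-(3 / 2) : ℝ)) (quad e (0 : Eu N) y) := by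
    intro y
    have := (((hasDerivAt_id (quad e (0 : Eu N) y)).neg.add_const (2 * e ^ 2)).rpow_const
      (p := -(1 / 2)) (Or.inl (kern_arg_pos he y).ne'))
    refine this.congr_deriv ?_
    simp only [Pi.neg_apply, id]
    norm_num
  have h2 : ∀ y : Eu N, HasDerivAt (fun t : ℝ => 1 / 2 * (-t + 2 * e ^ 2) ^ (-(3 / 2) : ℝ))
      (3 / 4 * (-quad e (0 : Eu N) y + 2 * e ^ 2) ^ (-(5 / 2) : ℝ)) (quad e (0 : Eu N) y) := by
    intro y
    have := ((((hasDerivAt_id (quad e (0 : Eu N) y)).neg.add_const (2 * e ^ 2)).rpow_const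
      (p := -(3 / 2)) (Or.inl (kern_arg_pos he y).ne'))).const_mul (1 / 2)
    refine this.congr_deriv ?_
    simp only [Pi.neg_apply, id]
    norm_num
    ring
  have := lap_comp (h := fun t : ℝ => (-t + 2 * e ^ 2) ^ (-(1 / 2) : ℝ))
    (h' := fun t : ℝ => 1 / 2 * (-t + 2 * e ^ 2) ^ (-(3 / 2) : ℝ))
    (h'' := fun t : ℝ => 3 / 4 * (-t + 2 * e ^ 2) ^ (-(5 / 2) : ℝ)) (contDiff_quad e 0 2) h1 h2 x
  rw [hf, this, gradient_quad, lap_quad, norm_smul]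
  set s := -quad e (0 : Eu N) x + 2 * e ^ 2 with hs
  have hsp : 0 < s := kern_arg_pos he x
  have hsx : ‖x‖ ^ 2 ≤ s := by rw [hs]; unfold quad; rw [sub_zero]; nlinarith [sq_nonneg e]
  have hr : s ^ (-(3 / 2) : ℝ) = s ^ (-(5 / 2) : ℝ) * s := by
    rw [← Real.rpow_add_one hsp.ne']; norm_num
  have hp : 0 < s ^ (-(5 / 2) : ℝ) := by positivity
  have hN' : (3 : ℝ) ≤ N := by exact_mod_cast hN
  simp only [sub_zero]
  rw [hr]
  norm_num
  have h3 : 3 * ‖x‖ ^ 2 ≤ N * s := by nlinarith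
  nlinarith [mul_le_mul_of_nonneg_left h3 hp.le]

end

section
variable {N : ℕ}

/-- A nonnegative weight on `Ω`, integrable, bounded below and bounded away from the origin. -/
structure Weight (V : Eu N → ℝ) (Ω : Set (Eu N)) : Prop where
  meas : Measurable V
  lower : ∃ c, 0 < c ∧ ∀ᵐ x ∂(volume.restrict Ω), c ≤ V x
  integrable : IntegrableOn V Ω
  upper : ∀ e, 0 < e → ∃ C, 0 ≤ C ∧ ∀ᵐ x ∂(volume.restrict Ω), e ≤ ‖x‖ → V x ≤ C

/-- Admissible test functions: nonnegative and vanishing linearly on the boundary. -/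
structure Adm (D : Eu N → ℝ) (Ω : Set (Eu N)) (ζ : Eu N → ℝ) : Prop where
  contDiff : ContDiff ℝ 2 ζ
  nonneg : ∀ x ∈ Ω, 0 ≤ ζ x
  bound : ∃ C, ∀ x ∈ Ω, ζ x ≤ C * D x ∧ -(C * D x) ≤ inner ℝ (gradient ζ x) (gradient D x)

section
variable {D : Eu N → ℝ} {Ω : Set (Eu N)}

lemma Adm.integral_lap_nonpos (h : SmoothDom D Ω) {ζ : Eu N → ℝ} (hζ : Adm D Ω ζ) :
    ∫ x in Ω, lap ζ x ≤ 0 := by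
  obtain ⟨C, hC⟩ := hζ.bound
  have := integral_divg_nonpos h (contDiff_gradient (k := 1) hζ.contDiff (by norm_num))
    fun x hx => (hC x hx).2
  simpa [divg_gradient hζ.contDiff] using this

lemma adm_mul (h : SmoothDom D Ω) {G : Eu N → ℝ} (hG : ContDiff ℝ 2 G) (hG0 : ∀ x, 0 ≤ G x) :
    Adm D Ω (fun x => D x * G x) := by
  refine ⟨(h.contDiff 2).mul hG, fun x hx => mul_nonneg (h.mem.1 hx).le (hG0 x), ?_⟩
  obtain ⟨C₁, -, h₁⟩ := h.exists_bound hG.continuous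
  obtain ⟨C₂, -, h₂⟩ := h.exists_bound ((continuous_gradient (hG.of_le (by norm_num))).inner
    (𝕜 := ℝ) (continuous_gradient (h.contDiff 1)))
  refine ⟨max C₁ C₂, fun x hx => ?_⟩
  have hD := h.mem.1 hx
  constructor
  · rw [mul_comm]
    exact mul_le_mul_of_nonneg_right ((le_abs_self _).trans ((h₁ x hx).trans (le_max_left _ _))) hD.le
  · rw [gradient_mul ((h.contDiff 1).differentiable (by norm_num) x)
      (hG.differentiable (by norm_num) x), inner_add_left, real_inner_smul_left,
      real_inner_smul_left, real_inner_self_eq_norm_sq]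
    have h3 := (abs_le.1 ((h₂ x hx).trans (le_max_right C₁ _))).1
    have h4 := mul_nonneg (hG0 x) (sq_nonneg ‖gradient D x‖)
    nlinarith

lemma adm_bump (h : SmoothDom D Ω) (k : ℕ) {s : ℝ} (hs : 0 ≤ s) {c : Eu N}
    (hc : closedBall c s ⊆ Ω) : Adm D Ω (bump (k + 3) s c) := by
  refine ⟨contDiff_bump k s c, fun x _ => bump_nonneg _ _ _ _, ?_⟩
  have hcs : closedBall c s ⊆ closure Ω := hc.trans subset_closure
  obtain ⟨d, hd, hdD⟩ : ∃ d, 0 < d ∧ ∀ x ∈ closedBall c s, d ≤ D x := by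
    obtain ⟨y, hy, hmin⟩ := (isCompact_closedBall c s).exists_isMinOn
      ⟨c, mem_closedBall_self hs⟩ h.cont.continuousOn
    exact ⟨D y, h.mem.1 (hc hy), fun x hx => hmin hx⟩
  obtain ⟨C₁, hC₁, h₁⟩ := h.exists_bound (continuous_bump (k + 3) s c)
  obtain ⟨C₂, hC₂, h₂⟩ := h.exists_bound ((continuous_gradient ((contDiff_bump k s c).of_le
    (by norm_num))).inner (𝕜 := ℝ) (continuous_gradient (h.contDiff 1)))
  refine ⟨(C₁ + C₂) / d, fun x hx => ?_⟩
  have hD := h.mem.1 hx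
  by_cases hxs : x ∈ closedBall c s
  · have h3 : C₁ + C₂ ≤ (C₁ + C₂) / d * D x := by
      rw [div_mul_eq_mul_div, le_div_iff₀ hd]
      exact mul_le_mul_of_nonneg_left (hdD x hxs) (by positivity)
    have h4 := (le_abs_self _).trans (h₁ x hx)
    have h5 := (abs_le.1 (h₂ x hx)).1
    constructor <;> linarith
  · have h6 : s ≤ ‖x - c‖ := by
      rw [mem_closedBall, dist_eq_norm, not_le] at hxs; exact hxs.le
    rw [bump_eq_zero (by omega) hs h6, gradient_bump (k + 1), bump_eq_zero (by omega) hs h6]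
    simp only [mul_zero, zero_smul, inner_zero_left]
    have : 0 ≤ (C₁ + C₂) / d * D x := by positivity
    constructor <;> linarith

lemma lap_bump_three (s : ℝ) (c x : Eu N) : lap (bump 3 s c) x =
    24 * s ^ 2 * bump 1 s c x - (24 + 6 * N) * bump 2 s c x := by
  have h1 := lap_bump 0 s c x
  have h2 := bump_succ 0 s c x
  norm_num at h1 h2
  rw [h1, h2]; ring

lemma bump_three_le (s : ℝ) (c x : Eu N) : bump 3 s c x ≤ s ^ 2 * bump 2 s c x := by
  have h2 := bump_succ 1 s c x
  norm_num at h2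
  rw [h2]
  exact mul_le_mul_of_nonneg_right (by nlinarith [sq_nonneg ‖x - c‖]) (bump_nonneg _ _ _ _)

/-- The volume of the unit ball. -/
def unitVol (N : ℕ) : ℝ := volume.real (closedBall (0 : Eu N) 1)

lemma unitVol_pos : 0 < unitVol N :=
  ENNReal.toReal_pos (measure_closedBall_pos _ _ one_pos).ne' measure_closedBall_lt_top.ne

lemma volume_real_closedBall (x : Eu N) {s : ℝ} (hs : 0 ≤ s) :
    volume.real (closedBall x s) = s ^ N * unitVol N := by
  rw [unitVol, Measure.real, Measure.addHaar_closedBall' _ _ hs, ENNReal.toReal_mul,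
    ENNReal.toReal_ofReal (by positivity), finrank_euclideanSpace_fin, Measure.real]

variable {V p : Eu N → ℝ}

lemma integrable_mul_bounded (hp : AEStronglyMeasurable p (volume.restrict Ω)) {P : ℝ}
    (hP : ∀ᵐ x ∂(volume.restrict Ω), |p x| ≤ P) {f : Eu N → ℝ} (hf : IntegrableOn f Ω) :
    IntegrableOn (fun x => p x * f x) Ω :=
  Integrable.bdd_mul hf hp hP

lemma Weight.integrableOn_mul (hV : Weight V Ω) (h : SmoothDom D Ω) {f : Eu N → ℝ}
    (hf : Continuous f) : IntegrableOn (fun x => V x * f x) Ω := by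
  obtain ⟨C, -, hC⟩ := h.exists_bound hf
  refine Integrable.mul_bdd (c := C) hV.integrable hf.aestronglyMeasurable ?_
  exact (ae_restrict_iff' h.meas).2 (ae_of_all _ hC)

lemma integrable_test (h : SmoothDom D Ω) (hV : Weight V Ω) {ζ : Eu N → ℝ} (hζ : ContDiff ℝ 2 ζ) :
    IntegrableOn (fun x => V x * ζ x - lap ζ x) Ω :=
  (hV.integrableOn_mul h hζ.continuous).sub (h.integrableOn_of_continuous (continuous_lap hζ))

/-- Differentiating `∫ p (s² - |x - c|²)₊²` in `s`. -/
lemma hasDerivAt_integral_bump (h : SmoothDom D Ω) (hp : IntegrableOn p Ω) (c : Eu N) (s : ℝ) :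
    HasDerivAt (fun s => ∫ x in Ω, p x * bump 2 s c x)
      (4 * s * ∫ x in Ω, p x * bump 1 s c x) s := by
  have hd : ∀ x t, HasDerivAt (fun t => p x * bump 2 t c x) (p x * (4 * t * bump 1 t c x)) t := by
    intro x t
    have h1 := (hasDerivAt_posPow 0 (quad t c x)).comp t
      (((hasDerivAt_id t).pow 2).sub_const (‖x - c‖ ^ 2))
    have h2 := h1.const_mul (p x)
    refine h2.congr_deriv ?_
    simp only [bump, Nat.cast_zero, id]
    push_cast
    ring
  have hi : ∀ t, IntegrableOn (fun x => p x * bump 2 t c x) Ω := fun t => by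
    obtain ⟨C, -, hC⟩ := h.exists_bound (continuous_bump 2 t c)
    exact hp.mul_bdd (c := C) (continuous_bump 2 t c).aestronglyMeasurable
      ((ae_restrict_iff' h.meas).2 (ae_of_all _ hC))
  have := (hasDerivAt_integral_of_dominated_loc_of_deriv_le (μ := volume.restrict Ω)
    (F := fun t x => p x * bump 2 t c x) (F' := fun t x => p x * (4 * t * bump 1 t c x))
    (x₀ := s) (s := ball s 1) (bound := fun x => |p x| * (4 * (|s| + 1) * (|s| + 1) ^ 2))
    (ball_mem_nhds s one_pos) (Eventually.of_forall fun t => (hi t).aestronglyMeasurable) (hi s)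
    ?_ (ae_of_all _ fun x t ht => ?_) (hp.norm.mul_const _)
    (ae_of_all _ fun x t _ => hd x t)).2
  · refine this.congr_deriv ?_
    rw [← integral_const_mul]
    congr 1; ext x; ring
  · exact hp.aestronglyMeasurable.mul
      ((continuous_bump 1 s c).const_mul (4 * s)).aestronglyMeasurable
  · have h1 : |t| ≤ |s| + 1 := by
      rw [mem_ball, Real.dist_eq] at ht
      have := abs_sub_abs_le_abs_sub t s
      linarith
    have h2 : |bump 1 t c x| ≤ (|s| + 1) ^ 2 := by
      rw [abs_of_nonneg (bump_nonneg _ _ _ _)]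
      refine (bump_le 1 c x).trans ?_
      rw [pow_one, ← sq_abs]
      exact pow_le_pow_left₀ (abs_nonneg _) h1 2
    rw [norm_mul, Real.norm_eq_abs, Real.norm_eq_abs, abs_mul, abs_mul,
      abs_of_pos (show (0 : ℝ) < 4 by norm_num)]
    gcongr

/-- Local mean value property of supersolutions: at a Lebesgue point the value controls averages. -/
lemma spread (h : SmoothDom D Ω) (hV : Weight V Ω) (hpm : AEStronglyMeasurable p (volume.restrict Ω))
    {P : ℝ} (hP : ∀ᵐ x ∂(volume.restrict Ω), |p x| ≤ P)
    (hp0 : ∀ᵐ x ∂(volume.restrict Ω), 0 ≤ p x)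
    (hsup : ∀ ζ, Adm D Ω ζ → 0 ≤ ∫ x in Ω, p x * (V x * ζ x - lap ζ x))
    {c : Eu N} {S C₁ ℓ : ℝ} (hS : 0 < S) (hSΩ : closedBall c S ⊆ Ω)
    (hC₁ : ∀ᵐ x ∂(volume.restrict Ω), x ∈ closedBall c S → V x ≤ C₁)
    (hℓ : Tendsto (fun s => ⨍ x in closedBall c s, p x) (𝓝[>] 0) (𝓝 ℓ)) :
    ∫ x in Ω, p x * bump 2 S c x ≤ unitVol N * Real.exp (C₁ * S ^ 2 / 12) * S ^ (N + 4) * ℓ := by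
  have : IsFiniteMeasure (volume.restrict Ω) := ⟨by simpa using h.volume_lt_top⟩
  have hpi : IntegrableOn p Ω := Integrable.of_bound hpm P hP
  set I : ℝ → ℝ := fun s => ∫ x in Ω, p x * bump 2 s c x with hI
  set J : ℝ → ℝ := fun s => ∫ x in Ω, p x * bump 1 s c x with hJ
  have hpc : ∀ {f : Eu N → ℝ}, Continuous f → IntegrableOn (fun x => p x * f x) Ω := fun hf =>
    integrable_mul_bounded hpm hP (h.integrableOn_of_continuous hf)
  have hode : ∀ s ∈ Ioo (0 : ℝ) S, s * (4 * s * J s) ≤ (N + 4 + C₁ * s ^ 2 / 6) * I s := by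
    intro s hs
    have hsS : closedBall c s ⊆ closedBall c S := closedBall_subset_closedBall hs.2.le
    have ht := hsup _ (adm_bump h 0 hs.1.le (hsS.trans hSΩ))
    have hle : ∫ x in Ω, p x * (V x * bump 3 s c x - lap (bump 3 s c) x) ≤
        ∫ x in Ω, ((C₁ * s ^ 2 + 24 + 6 * N) * (p x * bump 2 s c x)
          - 24 * s ^ 2 * (p x * bump 1 s c x)) := by
      refine setIntegral_mono_ae_restrict
        (integrable_mul_bounded hpm hP (integrable_test h hV (contDiff_bump 0 s c)))
        (((hpc (continuous_bump 2 s c)).const_mul _).sub ((hpc (continuous_bump 1 s c)).const_mul _))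
        ?_
      filter_upwards [hp0, hC₁, hV.lower.choose_spec.2] with x h0 h1 h2
      have hV0 : 0 ≤ V x := hV.lower.choose_spec.1.le.trans h2
      have key : V x * bump 3 s c x ≤ C₁ * s ^ 2 * bump 2 s c x := by
        by_cases hx : x ∈ closedBall c S
        · calc _ ≤ V x * (s ^ 2 * bump 2 s c x) :=
                mul_le_mul_of_nonneg_left (bump_three_le s c x) hV0
            _ ≤ C₁ * (s ^ 2 * bump 2 s c x) :=
                mul_le_mul_of_nonneg_right (h1 hx) (mul_nonneg (sq_nonneg _) (bump_nonneg _ _ _ _))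
            _ = _ := by ring
        · have : s ≤ ‖x - c‖ := by
            rw [mem_closedBall, dist_eq_norm, not_le] at hx; linarith [hs.2]
          simp [bump_eq_zero _ hs.1.le this]
      rw [lap_bump_three]
      have := mul_le_mul_of_nonneg_left key h0
      nlinarith
    rw [integral_sub ((hpc (continuous_bump 2 s c)).const_mul _)
      ((hpc (continuous_bump 1 s c)).const_mul _), integral_const_mul, integral_const_mul] at hle
    have ht' : (0 : ℝ) ≤ ∫ x in Ω, p x * (V x * bump 3 s c x - lap (bump 3 s c) x) := ht
    simp only [hI, hJ]
    nlinarith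
  have hI' : ∀ s, HasDerivAt I (4 * s * J s) s := fun s => hasDerivAt_integral_bump h hpi c s
  set g : ℝ → ℝ := fun s => (s ^ (N + 4))⁻¹ * Real.exp (-(C₁ * s ^ 2 / 12)) * I s with hg
  have hg' : ∀ s, 0 < s → HasDerivAt g ((s ^ (N + 4))⁻¹ * Real.exp (-(C₁ * s ^ 2 / 12)) * s⁻¹ *
      (s * (4 * s * J s) - (N + 4 + C₁ * s ^ 2 / 6) * I s)) s := by
    intro s hs
    have h1 : HasDerivAt (fun s : ℝ => (s ^ (N + 4))⁻¹) _ s :=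
      (hasDerivAt_pow (N + 4) s).inv (pow_ne_zero _ hs.ne')
    have h2 : HasDerivAt (fun s : ℝ => Real.exp (-(C₁ * s ^ 2 / 12)))
        (Real.exp (-(C₁ * s ^ 2 / 12)) * -(C₁ * (2 * s) / 12)) s := by
      refine ((((hasDerivAt_pow 2 s).const_mul C₁).div_const 12).neg).exp.congr_deriv ?_
      simp
    have h3 : HasDerivAt g ((-((N + 4 : ℕ) * s ^ (N + 4 - 1)) / (s ^ (N + 4)) ^ 2 *
        Real.exp (-(C₁ * s ^ 2 / 12)) + (s ^ (N + 4))⁻¹ *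
        (Real.exp (-(C₁ * s ^ 2 / 12)) * -(C₁ * (2 * s) / 12))) * I s +
        (s ^ (N + 4))⁻¹ * Real.exp (-(C₁ * s ^ 2 / 12)) * (4 * s * J s)) s :=
      (h1.mul h2).mul (hI' s)
    refine h3.congr_deriv ?_
    have : (s : ℝ) ≠ 0 := hs.ne'
    have e : N + 4 - 1 = N + 3 := by omega
    rw [e]
    push_cast
    field_simp
    ring
  have hanti : AntitoneOn g (Ioc 0 S) := by
    refine antitoneOn_of_deriv_nonpos (convex_Ioc 0 S)
      (fun s hs => (hg' s hs.1).continuousAt.continuousWithinAt) ?_ ?_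
    · rw [interior_Ioc]
      exact fun s hs => (hg' s hs.1).differentiableAt.differentiableWithinAt
    · rw [interior_Ioc]
      intro s hs
      rw [(hg' s hs.1).deriv]
      have := hs.1
      exact mul_nonpos_of_nonneg_of_nonpos (by positivity) (by linarith [hode s hs])
  have hup : ∀ s ∈ Ioc (0 : ℝ) S,
      g S ≤ Real.exp (-(C₁ * s ^ 2 / 12)) * unitVol N * ⨍ x in closedBall c s, p x := by
    intro s hs
    have hsΩ : closedBall c s ⊆ Ω := (closedBall_subset_closedBall hs.2).trans hSΩ
    refine (hanti hs ⟨hS, le_rfl⟩ hs.2).trans ?_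
    have h1 : I s ≤ s ^ 4 * ∫ x in closedBall c s, p x := by
      have e1 : I s = ∫ x in closedBall c s, p x * bump 2 s c x := by
        refine (setIntegral_eq_of_subset_of_forall_sdiff_eq_zero h.meas hsΩ fun x hx => ?_)
        rw [bump_eq_zero (by norm_num) hs.1.le, mul_zero]
        have := hx.2
        rw [mem_closedBall, dist_eq_norm, not_le] at this; exact this.le
      rw [e1, ← integral_const_mul]
      refine setIntegral_mono_ae_restrict ((hpc (continuous_bump 2 s c)).mono_set hsΩ)
        ((hpi.mono_set hsΩ).const_mul _) ?_
      filter_upwards [ae_restrict_of_ae_restrict_of_subset hsΩ hp0] with x hx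
      rw [mul_comm]
      refine mul_le_mul_of_nonneg_right ((bump_le 2 c x).trans (le_of_eq ?_)) hx
      ring
    rw [setAverage_eq, volume_real_closedBall c hs.1.le, smul_eq_mul]
    have hs0 := hs.1
    have hu : 0 < unitVol N := unitVol_pos
    calc g s ≤ (s ^ (N + 4))⁻¹ * Real.exp (-(C₁ * s ^ 2 / 12)) *
          (s ^ 4 * ∫ x in closedBall c s, p x) := mul_le_mul_of_nonneg_left h1 (by positivity)
      _ = _ := by field_simp; ring
  have hlim : Tendsto (fun s : ℝ => Real.exp (-(C₁ * s ^ 2 / 12)) * unitVol N *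
      ⨍ x in closedBall c s, p x) (𝓝[>] 0) (𝓝 (1 * unitVol N * ℓ)) := by
    refine Tendsto.mul (Tendsto.mul_const _ ?_) hℓ
    have : ContinuousAt (fun s : ℝ => Real.exp (-(C₁ * s ^ 2 / 12))) 0 := by fun_prop
    have := this.tendsto
    norm_num at this
    exact this.mono_left nhdsWithin_le_nhds
  have hfin : g S ≤ 1 * unitVol N * ℓ := by
    refine ge_of_tendsto hlim ?_
    filter_upwards [Ioc_mem_nhdsGT hS] with s hs using hup s hs
  have : I S = Real.exp (C₁ * S ^ 2 / 12) * S ^ (N + 4) * g S := by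
    simp only [hg]
    rw [Real.exp_neg]
    have := (Real.exp_pos (C₁ * S ^ 2 / 12)).ne'
    field_simp
  show I S ≤ _
  rw [this]
  calc _ ≤ Real.exp (C₁ * S ^ 2 / 12) * S ^ (N + 4) * (1 * unitVol N * ℓ) :=
        mul_le_mul_of_nonneg_left hfin (by positivity)
    _ = _ := by ring

end
end

section
variable {N : ℕ}
section
variable {D : Eu N → ℝ} {Ω : Set (Eu N)} {V p : Eu N → ℝ} {M : ℝ}

/-- A bounded nonnegative function satisfying the very weak form of `-Δp + Vp ≥ MV` in `Ω` with
boundary values at least `M`. -/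
structure SuperSol (D : Eu N → ℝ) (Ω : Set (Eu N)) (V p : Eu N → ℝ) (M : ℝ) : Prop where
  meas : AEStronglyMeasurable p (volume.restrict Ω)
  bdd : ∃ P, ∀ᵐ x ∂(volume.restrict Ω), |p x| ≤ P
  nonneg : ∀ᵐ x ∂(volume.restrict Ω), 0 ≤ p x
  test : ∀ ζ, Adm D Ω ζ →
    M * (∫ x in Ω, (V x * ζ x - lap ζ x)) ≤ ∫ x in Ω, p x * (V x * ζ x - lap ζ x)

lemma Weight.nonneg (hV : Weight V Ω) : ∀ᵐ x ∂(volume.restrict Ω), 0 ≤ V x := by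
  obtain ⟨c, hc, h⟩ := hV.lower
  filter_upwards [h] with x hx using hc.le.trans hx

lemma neg_integral_lap_le (h : SmoothDom D Ω) (hV : Weight V Ω) {ζ : Eu N → ℝ} (hζ : Adm D Ω ζ) :
    -∫ x in Ω, lap ζ x ≤ ∫ x in Ω, (V x * ζ x - lap ζ x) := by
  rw [integral_sub (hV.integrableOn_mul h hζ.contDiff.continuous)
    (h.integrableOn_of_continuous (continuous_lap hζ.contDiff))]
  have : 0 ≤ ∫ x in Ω, V x * ζ x := by
    refine integral_nonneg_of_ae ?_
    filter_upwards [hV.nonneg, ae_restrict_mem h.meas] with x h1 h2 using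
      mul_nonneg h1 (hζ.nonneg x h2)
  linarith

lemma SuperSol.test_nonneg (h : SmoothDom D Ω) (hV : Weight V Ω) (hM : 0 ≤ M)
    (hp : SuperSol D Ω V p M) {ζ : Eu N → ℝ} (hζ : Adm D Ω ζ) :
    0 ≤ ∫ x in Ω, p x * (V x * ζ x - lap ζ x) := by
  refine le_trans (mul_nonneg hM ?_) (hp.test ζ hζ)
  linarith [neg_integral_lap_le h hV hζ, hζ.integral_lap_nonpos h]

lemma SuperSol.spread (h : SmoothDom D Ω) (hV : Weight V Ω) (hM : 0 ≤ M)
    (hp : SuperSol D Ω V p M) {c : Eu N} {S C₁ ℓ : ℝ} (hS : 0 < S) (hSΩ : closedBall c S ⊆ Ω)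
    (hC₁ : ∀ᵐ x ∂(volume.restrict Ω), x ∈ closedBall c S → V x ≤ C₁)
    (hℓ : Tendsto (fun s => ⨍ x in closedBall c s, p x) (𝓝[>] 0) (𝓝 ℓ)) :
    ∫ x in Ω, p x * bump 2 S c x ≤ unitVol N * Real.exp (C₁ * S ^ 2 / 12) * S ^ (N + 4) * ℓ := by
  obtain ⟨P, hP⟩ := hp.bdd
  exact _root_.spread h hV hp.meas hP hp.nonneg (fun ζ hζ => hp.test_nonneg h hV hM hζ) hS hSΩ hC₁ hℓ

lemma SuperSol.integral_le_spread (h : SmoothDom D Ω) (hV : Weight V Ω) (hM : 0 ≤ M)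
    (hp : SuperSol D Ω V p M) {c : Eu N} {S C₁ ℓ T : ℝ} (hS : 0 < S) (hSΩ : closedBall c S ⊆ Ω)
    (hC₁ : ∀ᵐ x ∂(volume.restrict Ω), x ∈ closedBall c S → V x ≤ C₁)
    (hℓ : Tendsto (fun s => ⨍ x in closedBall c s, p x) (𝓝[>] 0) (𝓝 ℓ)) (hT : 0 ≤ T)
    {ζ : Eu N → ℝ} (hζ : Adm D Ω ζ)
    (hle : ∀ᵐ x ∂(volume.restrict Ω), V x * ζ x - lap ζ x ≤ T * bump 2 S c x) :
    M * (-∫ x in Ω, lap ζ x) ≤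
      T * (unitVol N * Real.exp (C₁ * S ^ 2 / 12) * S ^ (N + 4) * ℓ) ∧
    M * (∫ x in Ω, (V x * ζ x - lap ζ x)) ≤
      T * (unitVol N * Real.exp (C₁ * S ^ 2 / 12) * S ^ (N + 4) * ℓ) ∧ 0 ≤ ℓ := by
  obtain ⟨P, hP⟩ := hp.bdd
  have hi2 : IntegrableOn (fun x => p x * bump 2 S c x) Ω :=
    integrable_mul_bounded hp.meas hP (h.integrableOn_of_continuous (continuous_bump 2 S c))
  have h1 : ∫ x in Ω, p x * (V x * ζ x - lap ζ x) ≤ T * ∫ x in Ω, p x * bump 2 S c x := by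
    rw [← integral_const_mul]
    refine setIntegral_mono_ae_restrict
      (integrable_mul_bounded hp.meas hP (integrable_test h hV hζ.contDiff)) (hi2.const_mul _) ?_
    filter_upwards [hle, hp.nonneg] with x hx h0
    have := mul_le_mul_of_nonneg_left hx h0
    linarith
  have h2 := hp.spread h hV hM hS hSΩ hC₁ hℓ
  have h3 := mul_le_mul_of_nonneg_left h2 hT
  have h4 := hp.test ζ hζ
  have h5 := mul_le_mul_of_nonneg_left (neg_integral_lap_le h hV hζ) hM
  refine ⟨by linarith, by linarith, ?_⟩
  have h6 : 0 ≤ ∫ x in Ω, p x * bump 2 S c x := by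
    refine integral_nonneg_of_ae ?_
    filter_upwards [hp.nonneg] with x h0 using mul_nonneg h0 (bump_nonneg _ _ _ _)
  have h7 : 0 < unitVol N * Real.exp (C₁ * S ^ 2 / 12) * S ^ (N + 4) :=
    mul_pos (mul_pos unitVol_pos (Real.exp_pos _)) (pow_pos hS _)
  exact nonneg_of_mul_nonneg_right (h6.trans h2) h7

lemma bump_integral_ge (h : SmoothDom D Ω) (q : ℕ) {c y : Eu N} {s r m : ℝ} (hr : 0 ≤ r)
    (hsub : closedBall y r ⊆ Ω) (hle : ∀ x ∈ closedBall y r, m ≤ bump q s c x) :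
    m * (r ^ N * unitVol N) ≤ ∫ x in Ω, bump q s c x := by
  have hi := h.integrableOn_of_continuous (continuous_bump q s c)
  calc m * (r ^ N * unitVol N) = ∫ x in closedBall y r, m := by
        rw [setIntegral_const, volume_real_closedBall y hr, smul_eq_mul, mul_comm]
    _ ≤ ∫ x in closedBall y r, bump q s c x :=
        setIntegral_mono_on (integrableOn_const measure_closedBall_lt_top.ne) (hi.mono_set hsub)
          measurableSet_closedBall hle
    _ ≤ _ := setIntegral_mono_set hi (ae_of_all _ fun x => bump_nonneg _ _ _ _)
        hsub.eventuallyLE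

/-- Pointwise gain in the interior. -/
lemma interior_gain (h : SmoothDom D Ω) (hV : Weight V Ω) {d₁ e : ℝ} (hd₁ : 0 < d₁) (he : 0 < e) :
    ∃ δ, 0 < δ ∧ ∀ (M : ℝ) (p : Eu N → ℝ), 0 ≤ M → SuperSol D Ω V p M → ∀ x₀, d₁ ≤ D x₀ → e ≤ ‖x₀‖ →
      ∀ ℓ, Tendsto (fun s => ⨍ x in closedBall x₀ s, p x) (𝓝[>] 0) (𝓝 ℓ) → δ * M ≤ ℓ := by
  obtain ⟨s₁, hs₁, hsub₁⟩ := (h.isCompact_superlevel hd₁).exists_cthickening_subset_open h.isOpen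
    (superlevel_subset h hd₁)
  obtain ⟨C₁, hC₁0, hC₁⟩ := hV.upper (e / 2) (by positivity)
  obtain ⟨v₀, hv₀, hvle⟩ := hV.lower
  set s := min s₁ (e / 2) with hs
  have hsp : 0 < s := lt_min hs₁ (by positivity)
  have hu : 0 < unitVol N := unitVol_pos
  set A := C₁ * s ^ 2 + 24 + 6 * N with hA
  have hAp : 0 < A := by positivity
  set Z := (3 / 4 * s ^ 2) ^ 3 * ((s / 2) ^ N * unitVol N) with hZ
  set W := A * (unitVol N * Real.exp (C₁ * s ^ 2 / 12) * s ^ (N + 4)) with hW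
  have hWp : 0 < W := by positivity
  refine ⟨v₀ * Z / W, by positivity, fun M p hM hp x₀ hx₀ hx₀e ℓ hℓ => ?_⟩
  have hball : closedBall x₀ s ⊆ Ω :=
    ((closedBall_subset_closedBall (min_le_left _ _)).trans
      (closedBall_subset_cthickening (E := {x | d₁ ≤ D x}) hx₀ s₁)).trans hsub₁
  have hVb : ∀ᵐ x ∂(volume.restrict Ω), x ∈ closedBall x₀ s → V x ≤ C₁ := by
    filter_upwards [hC₁] with x hx hxs
    refine hx ?_
    rw [mem_closedBall, dist_eq_norm] at hxs
    have h1 := norm_sub_norm_le x₀ x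
    rw [norm_sub_rev] at h1
    linarith [min_le_right s₁ (e / 2)]
  have hadm := adm_bump h 0 hsp.le hball
  have hle : ∀ᵐ x ∂(volume.restrict Ω),
      V x * bump 3 s x₀ x - lap (bump 3 s x₀) x ≤ A * bump 2 s x₀ x := by
    filter_upwards [hVb, hV.nonneg] with x h1 h0
    have key : V x * bump 3 s x₀ x ≤ C₁ * s ^ 2 * bump 2 s x₀ x := by
      by_cases hx : x ∈ closedBall x₀ s
      · calc _ ≤ V x * (s ^ 2 * bump 2 s x₀ x) :=
              mul_le_mul_of_nonneg_left (bump_three_le s x₀ x) h0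
          _ ≤ C₁ * (s ^ 2 * bump 2 s x₀ x) :=
              mul_le_mul_of_nonneg_right (h1 hx) (mul_nonneg (sq_nonneg _) (bump_nonneg _ _ _ _))
          _ = _ := by ring
      · have : s ≤ ‖x - x₀‖ := by
          rw [mem_closedBall, dist_eq_norm, not_le] at hx; exact hx.le
        simp [bump_eq_zero _ hsp.le this]
    rw [lap_bump_three]
    have : 0 ≤ 24 * s ^ 2 * bump 1 s x₀ x := mul_nonneg (by positivity) (bump_nonneg _ _ _ _)
    rw [hA]; linarith
  obtain ⟨-, h2, -⟩ := hp.integral_le_spread h hV hM hsp hball hVb hℓ hAp.le hadm hle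
  have h3 : Z ≤ ∫ x in Ω, bump 3 s x₀ x := by
    refine bump_integral_ge h 3 (by positivity)
      ((closedBall_subset_closedBall (by linarith)).trans hball) fun x hx => ?_
    rw [mem_closedBall, dist_eq_norm] at hx
    rw [bump_of_le 3 (by linarith)]
    refine pow_le_pow_left₀ (by positivity) ?_ 3
    nlinarith [norm_nonneg (x - x₀)]
  have h4 : v₀ * Z ≤ ∫ x in Ω, (V x * bump 3 s x₀ x - lap (bump 3 s x₀) x) := by
    rw [integral_sub (hV.integrableOn_mul h hadm.contDiff.continuous)
      (h.integrableOn_of_continuous (continuous_lap hadm.contDiff))]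
    have h5 : v₀ * ∫ x in Ω, bump 3 s x₀ x ≤ ∫ x in Ω, V x * bump 3 s x₀ x := by
      rw [← integral_const_mul]
      refine setIntegral_mono_ae_restrict
        ((h.integrableOn_of_continuous (continuous_bump 3 s x₀)).const_mul _)
        (hV.integrableOn_mul h hadm.contDiff.continuous) ?_
      filter_upwards [hvle] with x hx
      exact mul_le_mul_of_nonneg_right hx (bump_nonneg _ _ _ _)
    have h6 := hadm.integral_lap_nonpos h
    have h7 := mul_le_mul_of_nonneg_left h3 hv₀.le
    simp only [zero_add] at h6
    linarith
  have h8 := mul_le_mul_of_nonneg_left h4 hM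
  rw [div_mul_eq_mul_div, div_le_iff₀ hWp, hW]
  simp only [zero_add] at h2
  linarith

set_option maxHeartbeats 1000000 in
/-- Pointwise bound for the boundary test function. -/
lemma boundary_core (k : ℕ) (hD : ContDiff ℝ 2 D) {x x₀ : Eu N} {v C₁ C₂ L₂ R r₀ D₀ : ℝ}
    (hx : 0 < D x) (hD₀ : 0 < D₀) (hr₀ : 0 < r₀) (hR : 0 < R) (hC₁0 : 0 ≤ C₁)
    (hC₂ : 0 ≤ C₂)
    (hvC : ‖x - x₀‖ ≤ R → v ≤ C₁)
    (htay : ‖x - x₀‖ ≤ R → inner ℝ (gradient D x) (x - x₀) ≤ D x - D₀ + C₂ * ‖x - x₀‖ ^ 2)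
    (hL₂ : |lap D x| ≤ L₂) (h1 : C₁ * R ^ 2 ≤ 1) (h2 : (C₂ + L₂) * R ^ 2 ≤ D₀)
    (h3 : (2 * N + 5) * R ^ 2 ≤ 4 * (k + 2) * r₀ ^ 2) (h4 : ‖x - x₀‖ ≤ r₀ → D x ≤ 2 * D₀) :
    v * (D x * bump (k + 3) R x₀ x) - lap (fun y => D y * bump (k + 3) R x₀ y) x ≤
      ((k + 3) * (2 * N + 5) * (2 * D₀) * (R ^ 2) ^ (k + 2) / (3 * r₀ ^ 2) ^ 2) *
        bump 2 (2 * r₀) x₀ x := by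
  have hT : 0 ≤ (k + 3) * (2 * N + 5) * (2 * D₀) * (R ^ 2) ^ (k + 2) / (3 * r₀ ^ 2) ^ 2 := by
    positivity
  rw [lap_mul hD (contDiff_bump k R x₀), lap_bump, gradient_bump (k + 1), inner_smul_right,
    bump_succ (k + 1), bump_succ k]
  rcases le_or_gt R ‖x - x₀‖ with hRx | hRx
  · rw [bump_eq_zero (by omega) hR.le hRx]
    simpa using mul_nonneg hT (bump_nonneg _ _ _ _)
  have hv1 := hvC hRx.le
  have ht := htay hRx.le
  set b := bump (k + 1) R x₀ x with hb
  have hb0 : 0 ≤ b := bump_nonneg _ _ _ _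
  have hbR : b ≤ (R ^ 2) ^ (k + 1) := bump_le _ _ _
  set r := ‖x - x₀‖ with hr
  have hr0 : 0 ≤ r := norm_nonneg _
  set q := inner ℝ (gradient D x) (x - x₀) with hq
  set d := D x with hd
  set Λ := lap D x with hΛ
  set E := R ^ 2 - r ^ 2 with hE
  have hE0 : 0 ≤ E := by rw [hE]; nlinarith
  have hER : E ≤ R ^ 2 := by rw [hE]; nlinarith
  have hmain : v * (d * E ^ 2) - d * ((k + 3) * (4 * (k + 2) * r ^ 2 - 2 * N * E))
      + 4 * (k + 3) * E * q - E ^ 2 * Λ ≤ (k + 3) * (d * ((2 * N + 5) * E - 4 * (k + 2) * r ^ 2)) := by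
    have hk : (0 : ℝ) ≤ k := Nat.cast_nonneg k
    have a1 : v * (d * E ^ 2) ≤ (k + 3) * (d * E) := by
      have : v * E ≤ 1 := (mul_le_mul hv1 hER hE0 hC₁0).trans h1
      have h5 : v * E * (d * E) ≤ 1 * (d * E) := mul_le_mul_of_nonneg_right this (by positivity)
      have h6 : 0 ≤ d * E := by positivity
      nlinarith
    have a2 : E * q ≤ E * (d - D₀ + C₂ * R ^ 2) := by
      refine mul_le_mul_of_nonneg_left (ht.trans ?_) hE0
      nlinarith
    have a3 : -(E ^ 2 * Λ) ≤ (k + 3) * (E * (R ^ 2 * L₂)) := by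
      have h7 : -Λ ≤ L₂ := by linarith [neg_abs_le Λ]
      have hL0 : 0 ≤ L₂ := (abs_nonneg _).trans hL₂
      have h8 : E * E * (-Λ) ≤ E * R ^ 2 * L₂ := by
        calc E * E * (-Λ) ≤ E * E * L₂ := mul_le_mul_of_nonneg_left h7 (by positivity)
          _ ≤ E * R ^ 2 * L₂ := by gcongr
      have h9 : 0 ≤ E * R ^ 2 * L₂ := by positivity
      nlinarith
    have a4 : 0 ≤ (k + 3) * (E * (D₀ - (C₂ + L₂) * R ^ 2)) := by
      have : 0 ≤ D₀ - (C₂ + L₂) * R ^ 2 := by linarith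
      positivity
    have a5 : 0 ≤ (k + 3) * (E * (R ^ 2 * L₂)) := by
      have hL0 : 0 ≤ L₂ := (abs_nonneg _).trans hL₂
      positivity
    have a6 := mul_le_mul_of_nonneg_left a2 (show (0 : ℝ) ≤ 4 * (k + 3) by positivity)
    have a7 : (k + 3) * (d * ((2 * N + 5) * E - 4 * (k + 2) * r ^ 2)) =
        (k + 3) * (d * E) - d * ((k + 3) * (4 * (k + 2) * r ^ 2 - 2 * N * E)) +
        4 * (k + 3) * (E * (d - D₀ + C₂ * R ^ 2)) + (k + 3) * (E * (R ^ 2 * L₂)) +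
        (4 * ((k + 3) * (E * (D₀ - (C₂ + L₂) * R ^ 2))) + 3 * ((k + 3) * (E * (R ^ 2 * L₂)))) := by
      ring
    rw [a7]
    have a8 : 4 * (k + 3) * E * q = 4 * (k + 3) * (E * q) := by ring
    rw [a8]
    linarith only [a1, a3, a4, a5, a6]
  have hlhs : v * (d * (E * (E * b))) - (d * ((k + 3) * (4 * (k + 2) * b * r ^ 2 - 2 * N * (E * b)))
      + 2 * (-2 * (((k + 1 : ℕ) : ℝ) + 2) * (E * b) * q) + E * (E * b) * Λ) =
      b * (v * (d * E ^ 2) - d * ((k + 3) * (4 * (k + 2) * r ^ 2 - 2 * N * E))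
      + 4 * (k + 3) * E * q - E ^ 2 * Λ) := by push_cast; ring
  rw [hlhs]
  refine (mul_le_mul_of_nonneg_left hmain hb0).trans ?_
  rcases le_or_gt r₀ r with hc | hc
  · refine le_trans ?_ (mul_nonneg hT (bump_nonneg _ _ _ _))
    refine mul_nonpos_of_nonneg_of_nonpos hb0 (mul_nonpos_of_nonneg_of_nonpos (by positivity)
      (mul_nonpos_of_nonneg_of_nonpos hx.le ?_))
    have h5 : (2 * (N : ℝ) + 5) * E ≤ (2 * N + 5) * R ^ 2 := mul_le_mul_of_nonneg_left hER (by positivity)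
    have h6 : 4 * ((k : ℝ) + 2) * r₀ ^ 2 ≤ 4 * (k + 2) * r ^ 2 := by gcongr
    linarith
  · have h5 : (3 * r₀ ^ 2) ^ 2 ≤ bump 2 (2 * r₀) x₀ x := by
      rw [bump_of_le 2 (by linarith)]
      refine pow_le_pow_left₀ (by positivity) ?_ 2
      nlinarith
    have h6 : d * ((2 * N + 5) * E - 4 * (k + 2) * r ^ 2) ≤ 2 * D₀ * ((2 * N + 5) * R ^ 2) := by
      have h7 := h4 hc.le
      have h8 : (2 * (N : ℝ) + 5) * E - 4 * (k + 2) * r ^ 2 ≤ (2 * N + 5) * R ^ 2 := by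
        have := mul_le_mul_of_nonneg_left hER (show (0 : ℝ) ≤ 2 * N + 5 by positivity)
        have h9 : 0 ≤ 4 * ((k : ℝ) + 2) * r ^ 2 := by positivity
        linarith
      calc _ ≤ d * ((2 * N + 5) * R ^ 2) := mul_le_mul_of_nonneg_left h8 hx.le
        _ ≤ _ := mul_le_mul_of_nonneg_right h7 (by positivity)
    calc b * ((k + 3) * (d * ((2 * N + 5) * E - 4 * (k + 2) * r ^ 2)))
        ≤ (R ^ 2) ^ (k + 1) * ((k + 3) * (2 * D₀ * ((2 * N + 5) * R ^ 2))) := by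
          refine (mul_le_mul_of_nonneg_left
            (mul_le_mul_of_nonneg_left h6 (by positivity)) hb0).trans ?_
          exact mul_le_mul_of_nonneg_right hbR (by positivity)
      _ = ((k + 3) * (2 * N + 5) * (2 * D₀) * (R ^ 2) ^ (k + 2) / (3 * r₀ ^ 2) ^ 2) *
          (3 * r₀ ^ 2) ^ 2 := by
          field_simp
          ring
      _ ≤ _ := mul_le_mul_of_nonneg_left h5 hT

end
end

section
variable {N : ℕ}
section
variable {D : Eu N → ℝ} {Ω : Set (Eu N)}

/-- Lower bound for the boundary flux of `D (R² - |x - x₀|²)₊ᵏ⁺³`. -/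
lemma boundary_flux (h : SmoothDom D Ω) (k : ℕ) {x₀ n : Eu N} {C₂ c' R σ a : ℝ} (hx₀ : 0 < D x₀)
    (hC₂ : 0 ≤ C₂) (hc' : 0 < c') (ha : 0 < a) (hn : ‖n‖ = 1) (hgrad : gradient D x₀ = a • n)
    (hσa : a * σ = 2 * D x₀)
    (htay : ∀ x, ‖x - x₀‖ ≤ 2 * σ →
      |D x - D x₀ - inner ℝ (gradient D x₀) (x - x₀)| ≤ C₂ * ‖x - x₀‖ ^ 2)
    (hσ : 4 * C₂ * σ ^ 2 ≤ D x₀ / 2) (hg : ∀ x, ‖x - x₀‖ ≤ 2 * σ → c' ≤ ‖gradient D x‖)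
    (hR : 5 * σ ^ 2 ≤ R ^ 2) :
    2 * (k + 3) * c' * (σ / 4) * ((15 / 64 * σ ^ 2) ^ (k + 2) * ((σ / 8) ^ N * unitVol N)) ≤
      -∫ x in Ω, lap (fun y => D y * bump (k + 3) R x₀ y) x := by
  have hσ0 : 0 < σ := by
    by_contra hneg
    nlinarith [mul_nonneg ha.le (neg_nonneg.2 (not_lt.1 hneg))]
  set c₂ := x₀ - σ • n with hc₂
  set G := bump (k + 3) R x₀ with hG
  set G₂ := bump (k + 3) σ c₂ with hG₂
  have hGc : ContDiff ℝ 2 G := contDiff_bump k R x₀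
  have hGc₂ : ContDiff ℝ 2 G₂ := contDiff_bump k σ c₂
  have hζ : ContDiff ℝ 2 (fun y => D y * G y) := (h.contDiff 2).mul hGc
  have hns : ‖σ • n‖ = σ := by rw [norm_smul, hn, Real.norm_of_nonneg hσ0.le, mul_one]
  have hdist : ∀ x, ‖x - c₂‖ ≤ σ → ‖x - x₀‖ ≤ 2 * σ := fun x hx => by
    have : x - x₀ = (x - c₂) - σ • n := by rw [hc₂]; abel
    rw [this]
    refine (norm_sub_le _ _).trans ?_
    rw [hns]; linarith
  have hinner : ∀ x, inner ℝ (x - c₂) n = inner ℝ n (x - x₀) + σ := fun x => by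
    have : x - c₂ = (x - x₀) + σ • n := by rw [hc₂]; abel
    rw [this, inner_add_left, real_inner_smul_left, real_inner_self_eq_norm_sq, hn,
      real_inner_comm]; ring
  set X : Eu N → Eu N := fun x => gradient (fun y => D y * G y) x - (c' * G₂ x) • n with hX
  have hX1 : ContDiff ℝ 1 (gradient fun y => D y * G y) :=
    contDiff_gradient (k := 1) hζ (by norm_num)
  have hf2 : ContDiff ℝ 1 (fun x => c' * G₂ x) := contDiff_const.mul (hGc₂.of_le (by norm_num))
  have hX2 : ContDiff ℝ 1 (fun x => (c' * G₂ x) • n) := hf2.smul contDiff_const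
  obtain ⟨C, -, hC⟩ := h.exists_bound ((continuous_gradient (hGc.of_le (by norm_num))).inner
    (𝕜 := ℝ) (continuous_gradient (h.contDiff 1)))
  have key := integral_divg_nonpos h (hX1.sub hX2) (C := C) fun x hx => by
    have hDx := h.mem.1 hx
    rw [gradient_mul ((h.contDiff 1).differentiable (by norm_num) x)
      (hGc.differentiable (by norm_num) x), inner_sub_left, inner_add_left, real_inner_smul_left,
      real_inner_smul_left, real_inner_smul_left, real_inner_self_eq_norm_sq]
    have h1 := mul_le_mul_of_nonneg_left (abs_le.1 (hC x hx)).1 hDx.le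
    have h2 : c' * G₂ x * inner ℝ n (gradient D x) ≤ G x * ‖gradient D x‖ ^ 2 := by
      have hG0 : 0 ≤ G x := bump_nonneg _ _ _ _
      rcases le_or_gt σ ‖x - c₂‖ with hb | hb
      · have : G₂ x = 0 := bump_eq_zero (by omega) hσ0.le hb
        rw [this]; simp; positivity
      · have h3 : G₂ x ≤ G x := by
          refine posPow_mono _ ?_
          have h4 := hdist x hb.le
          have h5 : ‖x - x₀‖ ^ 2 ≤ (2 * σ) ^ 2 := pow_le_pow_left₀ (norm_nonneg _) h4 2
          unfold quad
          nlinarith [sq_nonneg ‖x - c₂‖]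
        have h4 := hg x (hdist x hb.le)
        have h5 : inner ℝ n (gradient D x) ≤ ‖gradient D x‖ := by
          have := real_inner_le_norm n (gradient D x)
          rwa [hn, one_mul] at this
        have h6 : 0 ≤ G₂ x := bump_nonneg _ _ _ _
        calc c' * G₂ x * inner ℝ n (gradient D x) ≤ c' * G₂ x * ‖gradient D x‖ :=
              mul_le_mul_of_nonneg_left h5 (by positivity)
          _ ≤ ‖gradient D x‖ * G x * ‖gradient D x‖ := by gcongr
          _ = _ := by ring
    linarith
  have hdiv : ∀ x, divg (fun x => gradient (fun y => D y * G y) x - (c' * G₂ x) • n) x =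
      lap (fun y => D y * G y) x + 2 * (k + 3) * c' * (bump (k + 2) σ c₂ x * inner ℝ (x - c₂) n) := by
    intro x
    rw [divg_sub (hX1.differentiable (by norm_num) x) (hX2.differentiable (by norm_num) x),
      divg_gradient hζ, divg_smul (hf2.differentiable (by norm_num) x) (differentiableAt_const _)]
    have e1 : divg (fun _ : Eu N => n) x = 0 := by simp [divg]
    have e2 : gradient (fun x => c' * G₂ x) x = c' • gradient G₂ x := by
      ext i
      simp only [gradient_apply, PiLp.smul_apply, smul_eq_mul]
      rw [fderiv_const_mul (hGc₂.differentiable (by norm_num) x)]; simp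
    rw [e1, e2, hG₂, gradient_bump (k + 1), real_inner_smul_left, real_inner_smul_left]
    push_cast
    rw [show k + 1 + 1 = k + 2 by ring]
    ring
  have hbc : Continuous fun x => bump (k + 2) σ c₂ x * inner ℝ (x - c₂) n :=
    (continuous_bump (k + 2) σ c₂).mul ((continuous_id.sub continuous_const).inner continuous_const)
  change ∫ x in Ω, divg (fun x => gradient (fun y => D y * G y) x - (c' * G₂ x) • n) x ≤ 0 at key
  simp_rw [hdiv] at key
  rw [integral_add (h.integrableOn_of_continuous (continuous_lap hζ))
    ((h.integrableOn_of_continuous hbc).const_mul _), integral_const_mul] at key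
  have hlow : ∫ x in Ω, σ / 4 * bump (k + 2) σ c₂ x ≤
      ∫ x in Ω, bump (k + 2) σ c₂ x * inner ℝ (x - c₂) n := by
    refine setIntegral_mono_on
      ((h.integrableOn_of_continuous (continuous_bump _ _ _)).const_mul _)
      (h.integrableOn_of_continuous hbc) h.meas fun x hx => ?_
    rcases le_or_gt σ ‖x - c₂‖ with hb | hb
    · rw [bump_eq_zero (by omega) hσ0.le hb]; simp
    · rw [mul_comm]
      refine mul_le_mul_of_nonneg_left ?_ (bump_nonneg _ _ _ _)
      have h1 := (abs_le.1 (htay x (hdist x hb.le))).2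
      have h2 : ‖x - x₀‖ ^ 2 ≤ (2 * σ) ^ 2 := pow_le_pow_left₀ (norm_nonneg _) (hdist x hb.le) 2
      have h3 := mul_le_mul_of_nonneg_left h2 hC₂
      have h4 := h.mem.1 hx
      rw [hgrad, real_inner_smul_left] at h1
      rw [hinner]
      have h5 : 0 < a * (inner ℝ n (x - x₀) + σ - σ / 4) := by nlinarith
      have h6 := (mul_pos_iff_of_pos_left ha).1 h5
      linarith
  rw [integral_const_mul] at hlow
  set x₁ := x₀ - (σ / 4) • n with hx₁
  have hball : ∀ x ∈ closedBall x₁ (σ / 8), ‖x - x₁‖ ≤ σ / 8 := fun x hx => by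
    rwa [mem_closedBall, dist_eq_norm] at hx
  have hmass : (15 / 64 * σ ^ 2) ^ (k + 2) * ((σ / 8) ^ N * unitVol N) ≤
      ∫ x in Ω, bump (k + 2) σ c₂ x := by
    refine bump_integral_ge h (k + 2) (y := x₁) (by positivity) (fun x hx => ?_) fun x hx => ?_
    · have h1 := hball x hx
      have h2 : x - x₀ = (x - x₁) - (σ / 4) • n := by rw [hx₁]; abel
      have h3 : ‖x - x₀‖ ≤ 3 * σ / 8 := by
        rw [h2]
        refine (norm_sub_le _ _).trans ?_
        rw [norm_smul, hn, Real.norm_of_nonneg (by positivity)]; linarith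
      have h4 := (abs_le.1 (htay x (by linarith))).1
      have h5 : ‖x - x₀‖ ^ 2 ≤ (3 * σ / 8) ^ 2 := pow_le_pow_left₀ (norm_nonneg _) h3 2
      have h6 := mul_le_mul_of_nonneg_left h5 hC₂
      have h7 := neg_le_of_abs_le (abs_real_inner_le_norm n (x - x₀))
      rw [hn, one_mul] at h7
      rw [hgrad, real_inner_smul_left] at h4
      have h8 : a * (-(3 * σ / 8)) ≤ a * inner ℝ n (x - x₀) :=
        mul_le_mul_of_nonneg_left (by linarith) ha.le
      refine h.mem.2 ?_
      nlinarith
    · have h1 := hball x hx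
      have h2 : x - c₂ = (x - x₁) + (3 * σ / 4) • n := by rw [hx₁, hc₂]; module
      have h3 : ‖x - c₂‖ ≤ 7 * σ / 8 := by
        rw [h2]
        refine (norm_add_le _ _).trans ?_
        rw [norm_smul, hn, Real.norm_of_nonneg (by positivity)]; linarith
      rw [bump_of_le _ (by linarith)]
      refine pow_le_pow_left₀ (by positivity) ?_ _
      have h5 : ‖x - c₂‖ ^ 2 ≤ (7 * σ / 8) ^ 2 := pow_le_pow_left₀ (norm_nonneg _) h3 2
      linarith
  have h9 := mul_le_mul_of_nonneg_left ((mul_le_mul_of_nonneg_left hmass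
    (show 0 ≤ σ / 4 by positivity)).trans hlow) (show 0 ≤ 2 * ((k : ℝ) + 3) * c' by positivity)
  linarith

end
end

section
variable {N : ℕ}
section
variable {D : Eu N → ℝ} {Ω : Set (Eu N)} {V : Eu N → ℝ}

lemma norm_gradient_sub (f : Eu N → ℝ) (x y : Eu N) :
    ‖gradient f x - gradient f y‖ = ‖fderiv ℝ f x - fderiv ℝ f y‖ := by
  rw [gradient, gradient, ← map_sub, LinearIsometryEquiv.norm_map]

lemma SmoothDom.exists_taylor (h : SmoothDom D Ω) : ∃ C₂ L L₂ : ℝ, 0 ≤ C₂ ∧ 1 ≤ L ∧ 0 ≤ L₂ ∧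
    (∀ x ∈ Ω, ‖gradient D x‖ ≤ L) ∧ (∀ x ∈ Ω, |lap D x| ≤ L₂) ∧
    ∀ x ∈ Ω, ∀ y, ‖y - x‖ ≤ 1 → ‖gradient D y - gradient D x‖ ≤ C₂ * ‖y - x‖ ∧
      |D y - D x - inner ℝ (gradient D x) (y - x)| ≤ C₂ * ‖y - x‖ ^ 2 := by
  obtain ⟨L, hL0, hL⟩ := h.exists_bound (continuous_gradient (h.contDiff 1)).norm
  obtain ⟨L₂, hL₂0, hL₂⟩ := h.exists_bound (continuous_lap (h.contDiff 2))
  obtain ⟨B, hB⟩ := h.bdd.subset_closedBall 0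
  have hfd : ContDiff ℝ 1 (fderiv ℝ D) := (h.contDiff 2).fderiv_right (by norm_num)
  obtain ⟨C₂, hC₂⟩ := (isCompact_closedBall (0 : Eu N) (B + 1)).exists_bound_of_continuousOn
    (hfd.continuous_fderiv (by norm_num)).continuousOn
  have hmem : ∀ x ∈ Ω, ∀ y, ‖y - x‖ ≤ 1 → y ∈ closedBall (0 : Eu N) (B + 1) := fun x hx y hy => by
    have h1 := hB hx
    rw [mem_closedBall_zero_iff] at h1 ⊢
    have : y = (y - x) + x := by abel
    rw [this]
    exact (norm_add_le _ _).trans (by linarith)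
  have hlip : ∀ x ∈ Ω, ∀ y, ‖y - x‖ ≤ 1 → ‖fderiv ℝ D y - fderiv ℝ D x‖ ≤ max C₂ 0 * ‖y - x‖ :=
    fun x hx y hy => (convex_closedBall (0 : Eu N) (B + 1)).norm_image_sub_le_of_norm_fderiv_le
      (𝕜 := ℝ) (fun z _ => hfd.differentiable (by norm_num) z)
      (fun z hz => (hC₂ z hz).trans (le_max_left _ _))
      (hmem x hx x (by simp)) (hmem x hx y hy)
  refine ⟨max C₂ 0, max L 1, L₂, le_max_right _ _, le_max_right _ _, hL₂0,
    fun x hx => (le_abs_self _).trans ((hL x hx).trans (le_max_left _ _)), hL₂,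
    fun x hx y hy => ⟨?_, ?_⟩⟩
  · rw [norm_gradient_sub]; exact hlip x hx y hy
  · have h1 := (convex_segment (𝕜 := ℝ) x y).norm_image_sub_le_of_norm_fderiv_le' (f := D)
      (φ := fderiv ℝ D x) (C := max C₂ 0 * ‖y - x‖)
      (fun z _ => (h.contDiff 1).differentiable (by norm_num) z) (fun z hz => by
        have h2 : ‖z - x‖ ≤ ‖y - x‖ := by
          obtain ⟨t, ht, rfl⟩ := (segment_eq_image' ℝ x y) ▸ hz
          rw [add_sub_cancel_left, norm_smul, Real.norm_of_nonneg ht.1]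
          exact mul_le_of_le_one_left (norm_nonneg _) ht.2
        exact (hlip x hx z (h2.trans hy)).trans
          (mul_le_mul_of_nonneg_left h2 (le_max_right _ _)))
      (left_mem_segment ℝ x y) (right_mem_segment ℝ x y)
    rw [inner_gradient_left, ← Real.norm_eq_abs]
    calc _ ≤ _ := h1
      _ = _ := by ring

lemma SmoothDom.exists_gradient_ge (h : SmoothDom D Ω) :
    ∃ c, 0 < c ∧ ∀ x ∈ Ω, D x < c → c ≤ ‖gradient D x‖ := by
  have hcont : Continuous fun x => ‖gradient D x‖ + D x :=
    (continuous_gradient (h.contDiff 1)).norm.add h.cont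
  obtain ⟨b, hb, hle⟩ := h.isCompact_closure.exists_forall_le' (f := fun x => ‖gradient D x‖ + D x)
    hcont.continuousOn (a := 0) fun x hx => by
      have h1 := h.mem_closure.1 hx
      rcases h1.eq_or_lt with h2 | h2
      · exact add_pos_of_pos_of_nonneg (norm_pos_iff.2 (h.grad_ne x h2.symm)) h1
      · exact add_pos_of_nonneg_of_pos (norm_nonneg _) h2
  refine ⟨b / 2, by positivity, fun x hx hlt => ?_⟩
  have := hle x (subset_closure hx)
  linarith

set_option maxHeartbeats 2000000 in
/-- Pointwise gain near the boundary. -/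
lemma boundary_gain (h : SmoothDom D Ω) (hV : Weight V Ω) {e : ℝ} (he : 0 < e) :
    ∃ d₁ δ, 0 < d₁ ∧ 0 < δ ∧ ∀ (M : ℝ) (p : Eu N → ℝ), 0 ≤ M → SuperSol D Ω V p M →
      ∀ x₀ ∈ Ω, D x₀ < d₁ → e ≤ ‖x₀‖ →
      ∀ ℓ, Tendsto (fun s => ⨍ x in closedBall x₀ s, p x) (𝓝[>] 0) (𝓝 ℓ) → δ * M ≤ ℓ := by
  obtain ⟨C₂, L, L₂, hC₂, hL1, hL₂0, hL, hL₂, htay⟩ := h.exists_taylor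
  obtain ⟨c, hc, hgr⟩ := h.exists_gradient_ge
  obtain ⟨C₁, hC₁0, hC₁⟩ := hV.upper (e / 2) (by positivity)
  have hL0 : 0 < L := by linarith
  have hu : 0 < unitVol N := unitVol_pos
  obtain ⟨κ, hκ⟩ : ∃ κ, κ = 1 / (4 * L) := ⟨_, rfl⟩
  have hκ0 : 0 < κ := by rw [hκ]; positivity
  have hκL : 4 * (L * κ) = 1 := by rw [hκ]; field_simp
  have hκ4 : κ ≤ 1 / 4 := by nlinarith
  obtain ⟨K, hK⟩ : ∃ K, K = 5 / c := ⟨_, rfl⟩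
  have hK0 : 0 < K := by rw [hK]; positivity
  have hKc : K * c = 5 := by rw [hK]; field_simp
  obtain ⟨k, hk⟩ := exists_nat_ge ((2 * N + 5) * K ^ 2 / (4 * κ ^ 2))
  have hk' : (2 * N + 5) * K ^ 2 ≤ 4 * (k + 2) * κ ^ 2 := by
    rw [div_le_iff₀ (by positivity)] at hk
    nlinarith [sq_nonneg κ]
  obtain ⟨T₁, hT₁⟩ : ∃ T₁, T₁ = (k + 3) * (2 * N + 5) * 2 * (K ^ 2) ^ (k + 2) / (3 * κ ^ 2) ^ 2 *
    (unitVol N * Real.exp 1 * (2 * κ) ^ (N + 4)) := ⟨_, rfl⟩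
  have hT₁0 : 0 < T₁ := by rw [hT₁]; positivity
  obtain ⟨F₁, hF₁⟩ : ∃ F₁, F₁ = 2 * (k + 3) * (c / 2) * ((2 / L) / 4) *
    ((15 / 64 * (2 / L) ^ 2) ^ (k + 2) * (((2 / L) / 8) ^ N * unitVol N)) := ⟨_, rfl⟩
  have hF₁0 : 0 < F₁ := by rw [hF₁]; positivity
  have small : ∀ A : ℝ, 0 ≤ A → ∀ B : ℝ, 0 < B → ∀ᶠ d in 𝓝[>] (0 : ℝ), ∀ t ≤ d, A * t ≤ B := by
    intro A hA B hB
    have : Tendsto (fun d : ℝ => A * d) (𝓝[>] 0) (𝓝 (A * 0)) :=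
      (tendsto_nhdsWithin_of_tendsto_nhds tendsto_id).const_mul A
    rw [mul_zero] at this
    filter_upwards [this.eventually_lt_const hB] with d hd t ht
    exact (mul_le_mul_of_nonneg_left ht hA).trans hd.le
  obtain ⟨d₁, hd₁, hd₁0⟩ := ((((((small 1 zero_le_one c hc).and
    (small K hK0.le (min 1 (e / 2)) (by positivity))).and
    (small (C₁ * K ^ 2) (by positivity) 1 one_pos)).and
    (small ((C₂ + L₂) * K ^ 2) (by positivity) 1 one_pos)).and
    (small (32 * C₂) (by positivity) (min 1 (c ^ 2)) (by positivity))).and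
    (small 1 zero_le_one 1 one_pos)).and self_mem_nhdsWithin |>.exists
  obtain ⟨⟨⟨⟨⟨s1, s2⟩, s3⟩, s4⟩, s5⟩, s6⟩ := hd₁
  refine ⟨d₁, F₁ / T₁, hd₁0, by positivity, fun M p hM hp x₀ hx₀ hDx₀ hex₀ ℓ hℓ => ?_⟩
  have hD₀ := h.mem.1 hx₀
  obtain ⟨D₀, hDD⟩ : ∃ D₀, D₀ = D x₀ := ⟨_, rfl⟩
  rw [← hDD] at hD₀ hDx₀
  replace s1 := s1 D₀ hDx₀.le
  replace s2 := s2 D₀ hDx₀.le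
  replace s3 := s3 D₀ hDx₀.le
  replace s4 := s4 D₀ hDx₀.le
  replace s5 := s5 D₀ hDx₀.le
  replace s6 := s6 D₀ hDx₀.le
  have s2a := s2.trans (min_le_left _ _)
  have s2b := s2.trans (min_le_right _ _)
  have s5a := s5.trans (min_le_left _ _)
  have s5b := s5.trans (min_le_right _ _)
  rw [one_mul] at s6
  have hcle : c ≤ ‖gradient D x₀‖ := by
    rcases eq_or_lt_of_le s1 with h1 | h1
    · have : D₀ * K = 5 := by rw [← hKc]; linear_combination K * h1
      linarith
    · exact hgr x₀ hx₀ (by rw [← hDD]; linarith)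
  obtain ⟨a, ha⟩ : ∃ a, a = ‖gradient D x₀‖ := ⟨_, rfl⟩
  have haL : a ≤ L := ha ▸ hL x₀ hx₀
  rw [← ha] at hcle
  have ha0 : 0 < a := hc.trans_le hcle
  obtain ⟨σ, hσ⟩ : ∃ σ, σ = 2 * D₀ / a := ⟨_, rfl⟩
  have hσa : a * σ = 2 * D₀ := by rw [hσ]; field_simp
  have hσ0 : 0 < σ := by rw [hσ]; positivity
  have hcσ : c * σ ≤ 2 * D₀ := hσa ▸ mul_le_mul_of_nonneg_right hcle hσ0.le
  have hLσ : 2 / L * D₀ ≤ σ := by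
    rw [hσ, div_mul_eq_mul_div]
    exact div_le_div_of_nonneg_left (by positivity) ha0 haL
  have hσR : 5 * σ ≤ 2 * (K * D₀) := by
    have := mul_le_mul_of_nonneg_left hcσ hK0.le
    rw [← mul_assoc, hKc] at this
    linarith
  have hR2 : 5 * σ ^ 2 ≤ (K * D₀) ^ 2 := by
    have := pow_le_pow_left₀ (by positivity) hσR 2
    linarith [sq_nonneg σ]
  have hCσ : 4 * C₂ * σ ^ 2 ≤ D₀ / 2 := by
    have h1 : c ^ 2 * σ ^ 2 ≤ 4 * D₀ ^ 2 := by
      have := pow_le_pow_left₀ (by positivity) hcσ 2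
      linarith
    have h2 : c ^ 2 * (4 * C₂ * σ ^ 2) ≤ c ^ 2 * (D₀ / 2) := by
      have h3 := mul_le_mul_of_nonneg_left h1 (show 0 ≤ 4 * C₂ by positivity)
      have h4 := mul_le_mul_of_nonneg_right s5b (show 0 ≤ D₀ / 2 by positivity)
      linarith
    exact le_of_mul_le_mul_left h2 (by positivity)
  have hκR : 2 * (κ * D₀) ≤ K * D₀ := by
    have h1 : c * (4 * κ) ≤ 1 := by
      have := mul_le_mul_of_nonneg_right (hcle.trans haL) hκ0.le
      linarith
    have h2 : 2 * κ ≤ K := by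
      refine le_of_mul_le_mul_left (a := c) ?_ hc
      linarith [mul_comm K c]
    linarith [mul_le_mul_of_nonneg_right h2 hD₀.le]
  have hnear : ∀ x, ‖x - x₀‖ ≤ 2 * (κ * D₀) → 0 < D x ∧ (‖x - x₀‖ ≤ κ * D₀ → D x ≤ 2 * D₀) := by
    intro x hx
    have h1 := (htay x₀ hx₀ x (by linarith)).2
    rw [← hDD, abs_le] at h1
    have h2 := abs_le.1 (abs_real_inner_le_norm (gradient D x₀) (x - x₀))
    rw [← ha] at h2
    have h4 : ‖x - x₀‖ ^ 2 ≤ (2 * (κ * D₀)) ^ 2 := pow_le_pow_left₀ (norm_nonneg _) hx 2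
    have h5 : (2 * (κ * D₀)) ^ 2 ≤ D₀ ^ 2 / 4 := by
      have h6 : κ * D₀ ≤ 1 / 4 * D₀ := mul_le_mul_of_nonneg_right hκ4 hD₀.le
      have := pow_le_pow_left₀ (by positivity) h6 2
      linarith
    have h7 : C₂ * ‖x - x₀‖ ^ 2 ≤ D₀ / 8 := by
      have := mul_le_mul_of_nonneg_left (h4.trans h5) hC₂
      linarith [mul_le_mul_of_nonneg_right s5a hD₀.le]
    have h8 : a * ‖x - x₀‖ ≤ L * ‖x - x₀‖ := mul_le_mul_of_nonneg_right haL (norm_nonneg _)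
    constructor
    · have h9 := mul_le_mul_of_nonneg_left hx hL0.le
      have : L * (2 * (κ * D₀)) = D₀ / 2 := by linear_combination D₀ / 2 * hκL
      linarith
    · intro hx'
      have h9 := mul_le_mul_of_nonneg_left hx' hL0.le
      have : L * (κ * D₀) = D₀ / 4 := by linear_combination D₀ / 4 * hκL
      linarith
  have hball : closedBall x₀ (2 * (κ * D₀)) ⊆ Ω := fun x hx => by
    rw [mem_closedBall, dist_eq_norm] at hx
    exact h.mem.2 (hnear x hx).1
  have hVb : ∀ᵐ x ∂(volume.restrict Ω), ‖x - x₀‖ ≤ K * D₀ → V x ≤ C₁ := by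
    filter_upwards [hC₁] with x hx hxs
    refine hx ?_
    have h1 := norm_sub_norm_le x₀ x
    rw [norm_sub_rev] at h1
    linarith
  have hC₁R : C₁ * (K * D₀) ^ 2 ≤ 1 := by
    have : C₁ * (K * D₀) ^ 2 = C₁ * K ^ 2 * D₀ * D₀ := by ring
    rw [this]
    exact mul_le_one₀ s3 hD₀.le s6
  have hadm := adm_mul h (contDiff_bump k (K * D₀) x₀) (bump_nonneg _ _ _)
  obtain ⟨T, hT⟩ : ∃ T, T = (k + 3) * (2 * N + 5) * (2 * D₀) * ((K * D₀) ^ 2) ^ (k + 2) /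
    (3 * (κ * D₀) ^ 2) ^ 2 := ⟨_, rfl⟩
  have hT0 : 0 ≤ T := by rw [hT]; positivity
  have hspread := hp.integral_le_spread h hV hM (c := x₀) (S := 2 * (κ * D₀)) (C₁ := C₁) (T := T)
    (by positivity) hball
    (by
      filter_upwards [hVb] with x hx hxs
      rw [mem_closedBall, dist_eq_norm] at hxs
      exact hx (hxs.trans hκR)) hℓ hT0 hadm (by
      filter_upwards [hVb, ae_restrict_mem h.meas] with x hx hxΩ
      rw [hT]
      refine boundary_core k (h.contDiff 2) (h.mem.1 hxΩ) hD₀ (by positivity) (by positivity) hC₁0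
        hC₂ hx (fun hxR => ?_) (hL₂ x hxΩ) hC₁R ?_ ?_
        fun hxr => (hnear x (by linarith [mul_pos hκ0 hD₀])).2 hxr
      · have h1 := (abs_le.1 (htay x hxΩ x₀ (by rw [norm_sub_rev]; linarith)).2).2
        rw [← neg_sub x x₀, inner_neg_right, norm_neg, ← hDD] at h1
        linarith
      · have := mul_le_mul_of_nonneg_right s4 hD₀.le
        linarith
      · have := mul_le_mul_of_nonneg_right hk' (sq_nonneg D₀)
        linarith)
  obtain ⟨hsp, -, hℓ0⟩ := hspread
  have hflux := boundary_flux h k (x₀ := x₀) (n := a⁻¹ • gradient D x₀) (C₂ := C₂) (c' := c / 2)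
    (R := K * D₀) (σ := σ) (a := a) (hDD ▸ hD₀) hC₂ (by positivity) ha0
    (by rw [norm_smul, ← ha, Real.norm_of_nonneg (by positivity)]; field_simp)
    (by rw [smul_smul, mul_inv_cancel₀ ha0.ne', one_smul]) (hDD ▸ hσa)
    (fun x hx => (htay x₀ hx₀ x (by linarith)).2) (hDD ▸ hCσ) (fun x hx => by
      have h1 := (htay x₀ hx₀ x (by linarith)).1
      have h2 := norm_sub_norm_le (gradient D x₀) (gradient D x)
      rw [norm_sub_rev, ← ha] at h2
      have h3 : C₂ * ‖x - x₀‖ ≤ c / 2 := by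
        refine (mul_le_mul_of_nonneg_left hx hC₂).trans ?_
        refine le_of_mul_le_mul_left (a := c) ?_ hc
        have := mul_le_mul_of_nonneg_left hcσ hC₂
        have := sq_nonneg c
        linarith
      linarith) hR2
  obtain ⟨X, hX⟩ : ∃ X, X = D₀ * (D₀ ^ 2) ^ (k + 2) * D₀ ^ N := ⟨_, rfl⟩
  have hX0 : 0 < X := by rw [hX]; positivity
  have hF : F₁ * X ≤ -∫ x in Ω, lap (fun y => D y * bump (k + 3) (K * D₀) x₀ y) x := by
    refine le_trans ?_ hflux
    have : F₁ * X = 2 * (k + 3) * (c / 2) * ((2 / L * D₀) / 4) *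
        ((15 / 64 * (2 / L * D₀) ^ 2) ^ (k + 2) * (((2 / L * D₀) / 8) ^ N * unitVol N)) := by
      rw [hF₁, hX, mul_pow (2 / L) D₀ 2, ← mul_assoc (15 / 64 : ℝ), mul_pow _ (D₀ ^ 2),
        mul_div_right_comm (2 / L) D₀ 8, mul_pow _ D₀ N]
      ring
    rw [this]
    gcongr
  have hTX : T * (unitVol N * Real.exp (C₁ * (2 * (κ * D₀)) ^ 2 / 12) * (2 * (κ * D₀)) ^ (N + 4) * ℓ)
      ≤ T₁ * X * ℓ := by
    have h1 : Real.exp (C₁ * (2 * (κ * D₀)) ^ 2 / 12) ≤ Real.exp 1 := by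
      refine Real.exp_le_exp.2 ?_
      have h2 := pow_le_pow_left₀ (by positivity) hκR 2
      have := mul_le_mul_of_nonneg_left h2 hC₁0
      linarith
    have h2 : T₁ * X = T * (unitVol N * Real.exp 1 * (2 * (κ * D₀)) ^ (N + 4)) := by
      rw [hT₁, hX, hT, mul_pow K D₀ 2, mul_pow (K ^ 2) (D₀ ^ 2), ← mul_assoc 2 κ D₀,
        mul_pow (2 * κ) D₀, pow_add D₀ N 4]
      field_simp
    rw [h2]
    have h3 : T * (unitVol N * Real.exp 1 * (2 * (κ * D₀)) ^ (N + 4)) * ℓ =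
      T * (unitVol N * Real.exp 1 * (2 * (κ * D₀)) ^ (N + 4) * ℓ) := by ring
    rw [h3]
    gcongr
  have hfin : M * (F₁ * X) ≤ T₁ * X * ℓ := (mul_le_mul_of_nonneg_left hF hM).trans (hsp.trans hTX)
  rw [div_mul_eq_mul_div, div_le_iff₀ hT₁0]
  refine le_of_mul_le_mul_right (a := X) ?_ hX0
  linarith

end
end

section
variable {N : ℕ}
section
variable {D : Eu N → ℝ} {Ω : Set (Eu N)} {V : Eu N → ℝ}

lemma SmoothDom.isFiniteMeasure (h : SmoothDom D Ω) : IsFiniteMeasure (volume.restrict Ω) :=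
  isFiniteMeasure_restrict.2 h.volume_lt_top.ne

/-- A supersolution with boundary values `M` gains a fixed fraction of `M` away from the origin. -/
lemma exists_gain (h : SmoothDom D Ω) (hV : Weight V Ω) {e : ℝ} (he : 0 < e) :
    ∃ δ, 0 < δ ∧ δ ≤ 1 ∧ ∀ (M : ℝ) (p : Eu N → ℝ), 0 ≤ M → SuperSol D Ω V p M →
      ∀ᵐ x ∂(volume.restrict Ω), e ≤ ‖x‖ → δ * M ≤ p x := by
  obtain ⟨d₁, δ₁, hd₁, hδ₁, h₁⟩ := boundary_gain h hV he
  obtain ⟨δ₂, hδ₂, h₂⟩ := interior_gain h hV hd₁ he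
  refine ⟨min (min δ₁ δ₂) 1, by positivity, min_le_right _ _, fun M p hM hp => ?_⟩
  have := h.isFiniteMeasure
  obtain ⟨P, hP⟩ := hp.bdd
  have hint : Integrable (Ω.indicator p) :=
    (integrable_indicator_iff h.meas).2 (Integrable.of_bound hp.meas P hP)
  rw [ae_restrict_iff' h.meas]
  filter_upwards [IsUnifLocDoublingMeasure.ae_tendsto_average volume hint.locallyIntegrable 1]
    with x hx hxΩ hxe
  have ht := hx (l := 𝓝[>] (0 : ℝ)) (fun _ => x) (fun s => s) tendsto_id
    (by
      filter_upwards [self_mem_nhdsWithin] with s hs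
      exact mem_closedBall_self (by rw [one_mul]; exact le_of_lt hs))
  rw [indicator_of_mem hxΩ] at ht
  obtain ⟨s₀, hs₀, hball⟩ := nhds_basis_closedBall.mem_iff.1 (h.isOpen.mem_nhds hxΩ)
  have ht' : Tendsto (fun s => ⨍ y in closedBall x s, p y) (𝓝[>] 0) (𝓝 (p x)) := by
    refine ht.congr' ?_
    filter_upwards [Ioc_mem_nhdsGT hs₀] with s hs
    refine setAverage_congr_fun measurableSet_closedBall (ae_of_all _ fun y hy => ?_)
    exact indicator_of_mem (hball (closedBall_subset_closedBall hs.2 hy)) p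
  rcases lt_or_ge (D x) d₁ with hlt | hge
  · refine le_trans ?_ (h₁ M p hM hp x hxΩ hlt hxe _ ht')
    exact mul_le_mul_of_nonneg_right ((min_le_left _ _).trans (min_le_left _ _)) hM
  · refine le_trans ?_ (h₂ M p hM hp x hge hxe _ ht')
    exact mul_le_mul_of_nonneg_right ((min_le_left _ _).trans (min_le_right _ _)) hM

lemma integral_kern_test_nonneg (hN : 3 ≤ N) (h : SmoothDom D Ω) (hV : Weight V Ω) {e : ℝ}
    (he : 0 < e) {ζ : Eu N → ℝ} (hζ : Adm D Ω ζ) :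
    0 ≤ ∫ x in Ω, kern e x * (V x * ζ x - lap ζ x) := by
  have hk : ContDiff ℝ 2 (kern e : Eu N → ℝ) := contDiff_kern he
  have hk1 := contDiff_gradient (k := 1) hk (by norm_num)
  have hζ1 := contDiff_gradient (k := 1) hζ.contDiff (by norm_num)
  have hkd : Differentiable ℝ (kern e : Eu N → ℝ) := hk.differentiable (by norm_num)
  have hζd : Differentiable ℝ ζ := hζ.contDiff.differentiable (by norm_num)
  have hX1 : ContDiff ℝ 1 fun x => kern e x • gradient ζ x := (hk.of_le (by norm_num)).smul hζ1
  have hX2 : ContDiff ℝ 1 fun x => ζ x • gradient (kern e) x :=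
    (hζ.contDiff.of_le (by norm_num)).smul hk1
  have hdiv : ∀ x, divg (fun x => kern e x • gradient ζ x - ζ x • gradient (kern e) x) x =
      kern e x * lap ζ x - ζ x * lap (kern e) x := fun x => by
    rw [divg_sub (hX1.differentiable (by norm_num) x) (hX2.differentiable (by norm_num) x),
      divg_smul (hkd x) (hζ1.differentiable (by norm_num) x),
      divg_smul (hζd x) (hk1.differentiable (by norm_num) x), divg_gradient hk,
      divg_gradient hζ.contDiff, real_inner_comm]
    ring
  obtain ⟨C₁, hC₁, h₁⟩ := h.exists_bound hk.continuous
  obtain ⟨C₂, hC₂, h₂⟩ := h.exists_bound ((continuous_gradient (hk.of_le (by norm_num))).inner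
    (𝕜 := ℝ) (continuous_gradient (h.contDiff 1)))
  obtain ⟨C, hC⟩ := hζ.bound
  have key := integral_divg_nonpos h (hX1.sub hX2) (C := C₁ * |C| + |C| * C₂) fun x hx => by
    have hD := h.mem.1 hx
    obtain ⟨h3, h4⟩ := hC x hx
    have h5 : C * D x ≤ |C| * D x := mul_le_mul_of_nonneg_right (le_abs_self C) hD.le
    rw [inner_sub_left, real_inner_smul_left, real_inner_smul_left]
    have h6 : -(C₁ * (|C| * D x)) ≤ kern e x * inner ℝ (gradient ζ x) (gradient D x) := by
      have h7 := mul_le_mul_of_nonneg_left ((neg_le_neg h5).trans h4) (kern_pos he x).le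
      have h8 := mul_le_mul_of_nonneg_right ((le_abs_self _).trans (h₁ x hx))
        (show 0 ≤ |C| * D x by positivity)
      linarith
    have h7 : ζ x * inner ℝ (gradient (kern e) x) (gradient D x) ≤ |C| * D x * C₂ :=
      calc _ ≤ ζ x * C₂ :=
            mul_le_mul_of_nonneg_left ((le_abs_self _).trans (h₂ x hx)) (hζ.nonneg x hx)
        _ ≤ _ := mul_le_mul_of_nonneg_right (h3.trans h5) hC₂
    linarith
  have hi1 : IntegrableOn (fun x => kern e x * lap ζ x) Ω :=
    h.integrableOn_of_continuous (hk.continuous.mul (continuous_lap hζ.contDiff))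
  have hi2 : IntegrableOn (fun x => ζ x * lap (kern e) x) Ω :=
    h.integrableOn_of_continuous (hζ.contDiff.continuous.mul (continuous_lap hk))
  simp_rw [hdiv] at key
  rw [integral_sub hi1 hi2] at key
  have h8 : ∫ x in Ω, ζ x * lap (kern e) x ≤ 0 := by
    refine integral_nonpos_of_ae ?_
    filter_upwards [ae_restrict_mem h.meas] with x hx
    exact mul_nonpos_of_nonneg_of_nonpos (hζ.nonneg x hx) (lap_kern_nonpos hN he x)
  have hi3 : IntegrableOn (fun x => V x * (kern e x * ζ x)) Ω :=
    hV.integrableOn_mul h (hk.continuous.mul hζ.contDiff.continuous)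
  have h9 : 0 ≤ ∫ x in Ω, V x * (kern e x * ζ x) := by
    refine integral_nonneg_of_ae ?_
    filter_upwards [hV.nonneg, ae_restrict_mem h.meas] with x h0 hx
    exact mul_nonneg h0 (mul_nonneg (kern_pos he x).le (hζ.nonneg x hx))
  have h10 : ∀ x, kern e x * (V x * ζ x - lap ζ x) =
      V x * (kern e x * ζ x) - kern e x * lap ζ x := fun x => by ring
  simp_rw [h10]
  rw [integral_sub hi3 hi1]
  linarith

lemma kern_le {e : ℝ} {x : Eu N} (hx : x ≠ 0) : kern e x ≤ ‖x‖⁻¹ := by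
  have hx' := norm_pos_iff.2 hx
  have h1 : ‖x‖⁻¹ = (‖x‖ ^ 2) ^ (-(1 / 2) : ℝ) := by
    rw [Real.rpow_neg (sq_nonneg _), ← Real.sqrt_eq_rpow, Real.sqrt_sq hx'.le]
  rw [h1, kern]
  exact Real.rpow_le_rpow_of_nonpos (by positivity) (by linarith [sq_nonneg e]) (by norm_num)

lemma le_kern {e : ℝ} (he : 0 < e) {x : Eu N} (hx : ‖x‖ ≤ e) : (2 * e)⁻¹ ≤ kern e x := by
  have h1 : (2 * e)⁻¹ = ((2 * e) ^ 2) ^ (-(1 / 2) : ℝ) := by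
    rw [Real.rpow_neg (sq_nonneg _), ← Real.sqrt_eq_rpow, Real.sqrt_sq (by positivity)]
  rw [h1, kern]
  have := pow_le_pow_left₀ (norm_nonneg x) hx 2
  exact Real.rpow_le_rpow_of_nonpos (by positivity) (by linarith [sq_nonneg e]) (by norm_num)

/-- Maximum principle for bounded very weak supersolutions of `-Δr + V r = 0`. -/
theorem max_principle (hN : 3 ≤ N) (h : SmoothDom D Ω) (hV : Weight V Ω) {r : Eu N → ℝ}
    (hr : AEStronglyMeasurable r (volume.restrict Ω)) {B : ℝ}
    (hB : ∀ᵐ x ∂(volume.restrict Ω), |r x| ≤ B)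
    (ht : ∀ ζ, Adm D Ω ζ → 0 ≤ ∫ x in Ω, r x * (V x * ζ x - lap ζ x)) :
    ∀ᵐ x ∂(volume.restrict Ω), 0 ≤ r x := by
  have := h.isFiniteMeasure
  wlog hB0 : 0 < B generalizing B
  · exact this (B := max B 1) (hB.mono fun x hx => hx.trans (le_max_left _ _)) (by positivity)
  have main : ∀ ε : ℝ, 0 < ε → ∀ᵐ x ∂(volume.restrict Ω), x ≠ 0 → -(ε * ‖x‖⁻¹) ≤ r x := by
    intro ε hε
    obtain ⟨e, he⟩ : ∃ e, e = ε / (2 * B) := ⟨_, rfl⟩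
    have he0 : 0 < e := by rw [he]; positivity
    have heB : ε * (2 * e)⁻¹ = B := by rw [he]; field_simp
    have hkc : Continuous (kern e : Eu N → ℝ) := (contDiff_kern he0).continuous
    obtain ⟨C₁, hC₁, h₁⟩ := h.exists_bound hkc
    obtain ⟨δ, hδ0, hδ1, hgain⟩ := exists_gain h hV he0
    set q : Eu N → ℝ := fun x => r x + ε * kern e x with hq
    have hqm : AEStronglyMeasurable q (volume.restrict Ω) :=
      hr.add (hkc.const_mul ε).aestronglyMeasurable
    have hqb : ∀ᵐ x ∂(volume.restrict Ω), |q x| ≤ B + ε * C₁ := by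
      filter_upwards [hB, ae_restrict_mem h.meas] with x h2 hx
      refine (abs_add_le _ _).trans (add_le_add h2 ?_)
      rw [abs_mul, abs_of_pos hε]
      exact mul_le_mul_of_nonneg_left (h₁ x hx) hε.le
    have hqt : ∀ ζ, Adm D Ω ζ → 0 ≤ ∫ x in Ω, q x * (V x * ζ x - lap ζ x) := fun ζ hζ => by
      have hi := integrable_test h hV hζ.contDiff
      have hi1 := integrable_mul_bounded hr hB hi
      have hi2 := integrable_mul_bounded hkc.aestronglyMeasurable
        ((ae_restrict_iff' h.meas).2 (ae_of_all _ h₁)) hi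
      have e1 : ∀ x, q x * (V x * ζ x - lap ζ x) =
          r x * (V x * ζ x - lap ζ x) + ε * (kern e x * (V x * ζ x - lap ζ x)) := fun x => by
        rw [hq]; ring
      simp_rw [e1]
      rw [integral_add hi1 (hi2.const_mul ε), integral_const_mul]
      exact add_nonneg (ht ζ hζ) (mul_nonneg hε.le (integral_kern_test_nonneg hN h hV he0 hζ))
    have hnear : ∀ᵐ x ∂(volume.restrict Ω), ‖x‖ ≤ e → 0 ≤ q x := by
      filter_upwards [hB] with x hx hxe
      have h2 := mul_le_mul_of_nonneg_left (le_kern he0 hxe) hε.le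
      have h3 := (abs_le.1 hx).1
      rw [heB] at h2
      simp only [hq]; linarith
    have iter : ∀ n : ℕ, ∀ᵐ x ∂(volume.restrict Ω), -((1 - δ) ^ n * B) ≤ q x := by
      intro n
      induction n with
      | zero =>
        filter_upwards [hB] with x hx
        have h2 := mul_pos hε (kern_pos he0 x)
        simp only [hq, pow_zero, one_mul]
        linarith [(abs_le.1 hx).1]
      | succ n ih =>
        obtain ⟨M, hM⟩ : ∃ M, M = (1 - δ) ^ n * B := ⟨_, rfl⟩
        have h1δ : 0 ≤ 1 - δ := by linarith
        have hM0 : 0 ≤ M := by rw [hM]; positivity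
        have hsup : SuperSol D Ω V (fun x => q x + M) M := by
          refine ⟨hqm.add aestronglyMeasurable_const, ⟨B + ε * C₁ + M, ?_⟩, ?_, fun ζ hζ => ?_⟩
          · filter_upwards [hqb] with x hx
            refine (abs_add_le _ _).trans (add_le_add hx (abs_of_nonneg hM0).le)
          · filter_upwards [ih] with x hx
            rw [← hM] at hx; linarith
          · have hi := integrable_test h hV hζ.contDiff
            simp_rw [add_mul]
            rw [integral_add (integrable_mul_bounded hqm hqb hi) (hi.const_mul M),
              integral_const_mul]
            linarith [hqt ζ hζ]
        filter_upwards [hgain M _ hM0 hsup, hnear] with x h2 h3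
        rw [pow_succ, show (1 - δ) ^ n * (1 - δ) * B = (1 - δ) * M by rw [hM]; ring]
        rcases le_total e ‖x‖ with h4 | h4
        · linarith [h2 h4]
        · linarith [h3 h4, mul_nonneg h1δ hM0]
    have hlim : Tendsto (fun n : ℕ => -((1 - δ) ^ n * B)) atTop (𝓝 0) := by
      have := ((tendsto_pow_atTop_nhds_zero_of_lt_one (show 0 ≤ 1 - δ by linarith)
        (by linarith)).mul_const B).neg
      simpa using this
    filter_upwards [ae_all_iff.2 iter] with x hx hx0
    have h2 : 0 ≤ q x := le_of_tendsto' hlim hx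
    have h3 := mul_le_mul_of_nonneg_left (kern_le (e := e) hx0) hε.le
    simp only [hq] at h2; linarith
  have : Nonempty (Fin N) := ⟨⟨0, by omega⟩⟩
  have hne : ∀ᵐ x ∂(volume.restrict Ω), x ≠ (0 : Eu N) :=
    ae_restrict_of_ae (Measure.ae_ne volume 0)
  filter_upwards [hne, ae_all_iff.2 fun n : ℕ => main (1 / ((n : ℝ) + 1)) (by positivity)]
    with x hx hle
  have hlim : Tendsto (fun n : ℕ => -(1 / ((n : ℝ) + 1) * ‖x‖⁻¹)) atTop (𝓝 0) := by
    have := (tendsto_one_div_add_atTop_nhds_zero_nat.mul_const ‖x‖⁻¹).neg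
    simpa using this
  exact le_of_tendsto' hlim fun n => hle n hx

end
end

section
variable {N : ℕ}
section
variable {D : Eu N → ℝ} {Ω : Set (Eu N)} {ν μ : Measure (Eu N)}

/-- Compactly supported `C¹` functions on `Ω`. -/
structure TestFn (Ω : Set (Eu N)) (φ : Eu N → ℝ) : Prop where
  contDiff : ContDiff ℝ 1 φ
  compact : HasCompactSupport φ
  subset : tsupport φ ⊆ Ω

namespace TestFn
variable {φ χ : Eu N → ℝ}

lemma continuous (h : TestFn Ω φ) : Continuous φ := h.contDiff.continuous

lemma differentiableAt (h : TestFn Ω φ) (x : Eu N) : DifferentiableAt ℝ φ x :=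
  (h.contDiff.differentiable (by norm_num)) x

lemma continuous_grad (h : TestFn Ω φ) : Continuous (gradient φ) := continuous_gradient h.contDiff

lemma memLp [IsFiniteMeasure ν] (h : TestFn Ω φ) (p : ℝ≥0∞) : MemLp φ p ν :=
  h.continuous.memLp_of_hasCompactSupport h.compact

lemma compact_grad (h : TestFn Ω φ) : HasCompactSupport (gradient φ) := by
  refine h.compact.mono' fun x hx => ?_
  by_contra hn
  refine hx ?_
  rw [gradient, fderiv_of_notMem_tsupport ℝ hn, map_zero]

lemma memLp_grad [IsFiniteMeasure μ] (h : TestFn Ω φ) (p : ℝ≥0∞) : MemLp (gradient φ) p μ :=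
  h.continuous_grad.memLp_of_hasCompactSupport h.compact_grad

lemma zero : TestFn Ω (0 : Eu N → ℝ) := by
  refine ⟨contDiff_const, HasCompactSupport.zero, ?_⟩
  rw [tsupport_eq_empty_iff.2 rfl]; exact empty_subset _

lemma comp (h : TestFn Ω φ) {β : ℝ → ℝ} (hβ : ContDiff ℝ 1 β) (h0 : β 0 = 0) :
    TestFn Ω (β ∘ φ) :=
  ⟨hβ.comp h.contDiff, h.compact.comp_left h0, (closure_mono (Function.support_comp_subset h0 φ)).trans h.subset⟩

lemma add (h : TestFn Ω φ) (h' : TestFn Ω χ) : TestFn Ω (φ + χ) :=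
  ⟨h.contDiff.add h'.contDiff, h.compact.add h'.compact,
    (tsupport_add φ χ).trans (union_subset h.subset h'.subset)⟩

lemma smul (h : TestFn Ω φ) (c : ℝ) : TestFn Ω (c • φ) :=
  ⟨contDiff_const.smul h.contDiff, h.compact.smul_left (f := fun _ => c),
    (closure_mono (Function.support_const_smul_subset c φ)).trans h.subset⟩

lemma grad_add (h : TestFn Ω φ) (h' : TestFn Ω χ) (x) : gradient (φ + χ) x = gradient φ x + gradient χ x := by
  rw [gradient, fderiv_add (h.differentiableAt x) (h'.differentiableAt x), map_add]; rfl

lemma grad_smul (h : TestFn Ω φ) (c : ℝ) (x) : gradient (c • φ) x = c • gradient φ x := by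
  rw [gradient, fderiv_const_smul (h.differentiableAt x), map_smul]; rfl

lemma of_contDiff_mul {f : Eu N → ℝ} (h : TestFn Ω φ) (hf : ContDiff ℝ 1 f) : TestFn Ω (φ * f) :=
  ⟨h.contDiff.mul hf, h.compact.mul_right, (closure_mono (Function.support_mul_subset_left φ f)).trans h.subset⟩

end TestFn

/-- The Hilbert space of pairs (function, vector field). -/
abbrev EnergySpace (ν μ : Measure (Eu N)) := WithLp 2 (Lp ℝ 2 ν × Lp (Eu N) 2 μ)

/-- The element of the energy space with the given representatives. -/
def emb {f : Eu N → ℝ} {g : Eu N → Eu N} (hf : MemLp f 2 ν) (hg : MemLp g 2 μ) : EnergySpace ν μ :=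
  WithLp.toLp 2 (hf.toLp f, hg.toLp g)

lemma inner_emb {f f' : Eu N → ℝ} {g g' : Eu N → Eu N} (hf : MemLp f 2 ν) (hg : MemLp g 2 μ)
    (hf' : MemLp f' 2 ν) (hg' : MemLp g' 2 μ) :
    inner ℝ (emb hf hg) (emb hf' hg') = ∫ x, f x * f' x ∂ν + ∫ x, inner ℝ (g x) (g' x) ∂μ := by
  rw [WithLp.prod_inner_apply, L2.inner_def, L2.inner_def]
  congr 1
  · refine integral_congr_ae ?_
    filter_upwards [hf.coeFn_toLp, hf'.coeFn_toLp] with x h1 h2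
    change inner ℝ (hf.toLp f x) (hf'.toLp f' x) = _
    rw [h1, h2, real_inner_eq_re_inner, RCLike.inner_apply]; simp [mul_comm]
  · refine integral_congr_ae ?_
    filter_upwards [hg.coeFn_toLp, hg'.coeFn_toLp] with x h1 h2
    change inner ℝ (hg.toLp g x) (hg'.toLp g' x) = _
    rw [h1, h2]

lemma emb_self (P : EnergySpace ν μ) : emb (Lp.memLp P.fst) (Lp.memLp P.snd) = P := by
  rw [emb, Lp.toLp_coeFn, Lp.toLp_coeFn]; rfl

lemma emb_sub {f f' : Eu N → ℝ} {g g' : Eu N → Eu N} (hf : MemLp f 2 ν) (hg : MemLp g 2 μ)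
    (hf' : MemLp f' 2 ν) (hg' : MemLp g' 2 μ) :
    emb hf hg - emb hf' hg' = emb (hf.sub hf') (hg.sub hg') := by
  rw [emb, emb, emb, MemLp.toLp_sub hf hf', MemLp.toLp_sub hg hg']; rfl

lemma norm_emb_sq {f : Eu N → ℝ} {g : Eu N → Eu N} (hf : MemLp f 2 ν) (hg : MemLp g 2 μ) :
    ‖emb hf hg‖ ^ 2 = ∫ x, f x ^ 2 ∂ν + ∫ x, ‖g x‖ ^ 2 ∂μ := by
  rw [← real_inner_self_eq_norm_sq, inner_emb]
  simp only [real_inner_self_eq_norm_sq, sq]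

/-- `tendsto` in the energy space in terms of representatives. -/
lemma tendsto_emb_iff {f : ℕ → Eu N → ℝ} {g : ℕ → Eu N → Eu N} (hf : ∀ j, MemLp (f j) 2 ν)
    (hg : ∀ j, MemLp (g j) 2 μ) {f' : Eu N → ℝ} {g' : Eu N → Eu N} (hf' : MemLp f' 2 ν)
    (hg' : MemLp g' 2 μ) :
    Tendsto (fun j => emb (hf j) (hg j)) atTop (𝓝 (emb hf' hg')) ↔
      Tendsto (fun j => eLpNorm (f j - f') 2 ν) atTop (𝓝 0) ∧
      Tendsto (fun j => eLpNorm (g j - g') 2 μ) atTop (𝓝 0) := by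
  rw [← Lp.tendsto_Lp_iff_tendsto_eLpNorm'' f hf f' hf',
    ← Lp.tendsto_Lp_iff_tendsto_eLpNorm'' g hg g' hg',
    (WithLp.homeomorphProd 2 (Lp ℝ 2 ν) (Lp (Eu N) 2 μ)).isInducing.tendsto_nhds_iff,
    nhds_prod_eq, tendsto_prod_iff']
  rfl

/-- The span of test functions. -/
def testSpace [IsFiniteMeasure ν] [IsFiniteMeasure μ] (Ω : Set (Eu N)) : Submodule ℝ (EnergySpace ν μ) where
  carrier := {P | ∃ (φ : Eu N → ℝ) (h : TestFn Ω φ), emb (h.memLp 2) (h.memLp_grad 2) = P}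
  zero_mem' := ⟨0, .zero, by
    rw [← norm_eq_zero, ← sq_eq_zero_iff, norm_emb_sq]
    have : ∀ x : Eu N, gradient (0 : Eu N → ℝ) x = 0 := fun x => by
      rw [gradient, fderiv_zero]; simp
    simp [this]⟩
  add_mem' := by
    rintro _ _ ⟨φ, h, rfl⟩ ⟨χ, h', rfl⟩
    refine ⟨φ + χ, h.add h', ?_⟩
    have e : emb ((h.add h').memLp (ν := ν) 2) ((h.add h').memLp_grad (μ := μ) 2) = emb ((h.memLp 2).add (h'.memLp 2)) ((h.memLp_grad 2).add (h'.memLp_grad 2)) := by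
      simp only [emb]
      congr 2
      exact MemLp.toLp_congr _ _ (ae_of_all _ fun x => h.grad_add h' x)
    rw [e, emb, MemLp.toLp_add (h.memLp 2) (h'.memLp 2),
      MemLp.toLp_add (h.memLp_grad 2) (h'.memLp_grad 2)]; rfl
  smul_mem' := by
    rintro c _ ⟨φ, h, rfl⟩
    refine ⟨c • φ, h.smul c, ?_⟩
    have e : emb ((h.smul c).memLp (ν := ν) 2) ((h.smul c).memLp_grad (μ := μ) 2) = emb ((h.memLp 2).const_smul c) ((h.memLp_grad 2).const_smul c) := by
      simp only [emb]
      congr 2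
      exact MemLp.toLp_congr _ _ (ae_of_all _ fun x => h.grad_smul c x)
    rw [e, emb, MemLp.toLp_const_smul c (h.memLp 2), MemLp.toLp_const_smul c (h.memLp_grad 2)]; rfl

/-- `(ψ, g)` is a limit of test functions and their gradients. -/
structure H01 (ν : Measure (Eu N)) (Ω : Set (Eu N)) (ψ : Eu N → ℝ) (g : Eu N → Eu N) : Prop where
  memLp : MemLp ψ 2 ν
  memLp_grad : MemLp g 2 (volume.restrict Ω)
  approx : ∃ φ : ℕ → Eu N → ℝ, (∀ j, TestFn Ω (φ j)) ∧
    Tendsto (fun j => eLpNorm (φ j - ψ) 2 ν) atTop (𝓝 0) ∧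
    Tendsto (fun j => eLpNorm (gradient (φ j) - g) 2 (volume.restrict Ω)) atTop (𝓝 0)

lemma H01.mono_measure {ν' : Measure (Eu N)} {C : ℝ≥0∞} (hC : C ≠ ⊤) (hle : ν' ≤ C • ν)
    {ψ : Eu N → ℝ} {g : Eu N → Eu N} (h : H01 ν Ω ψ g) : H01 ν' Ω ψ g := by
  obtain ⟨φ, h1, h2, h3⟩ := h.approx
  refine ⟨h.memLp.of_measure_le_smul hC hle, h.memLp_grad, φ, h1, ?_, h3⟩
  have h4 : Tendsto (fun j => C ^ (1 / (2 : ℝ≥0∞)).toReal * eLpNorm (φ j - ψ) 2 ν) atTop (𝓝 0) := by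
    have := ENNReal.Tendsto.const_mul (a := C ^ (1 / (2 : ℝ≥0∞)).toReal) h2
      (Or.inr (by finiteness))
    rwa [mul_zero] at this
  refine tendsto_of_tendsto_of_tendsto_of_le_of_le tendsto_const_nhds h4 (fun _ => zero_le) fun j => ?_
  refine (eLpNorm_mono_measure _ hle).trans ?_
  rw [eLpNorm_smul_measure_of_ne_top (by norm_num), smul_eq_mul]

/-- A weak equation extends from test functions to `H01`. -/
lemma H01.weak_eq [IsFiniteMeasure ν] [IsFiniteMeasure (volume.restrict Ω)] {f : Eu N → ℝ}
    {G : Eu N → Eu N} (hf : MemLp f 2 ν) (hG : MemLp G 2 (volume.restrict Ω))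
    (heq : ∀ φ, TestFn Ω φ → ∫ x in Ω, inner ℝ (G x) (gradient φ x) = ∫ x, f x * φ x ∂ν)
    {ψ : Eu N → ℝ} {g : Eu N → Eu N} (h : H01 ν Ω ψ g) :
    ∫ x in Ω, inner ℝ (G x) (g x) = ∫ x, f x * ψ x ∂ν := by
  obtain ⟨φ, h1, h2, h3⟩ := h.approx
  have ht := (tendsto_emb_iff (fun j => (h1 j).memLp 2) (fun j => (h1 j).memLp_grad 2) h.memLp
    h.memLp_grad).2 ⟨h2, h3⟩
  have hz : Tendsto (fun j => inner ℝ (emb hf.neg hG) (emb ((h1 j).memLp (ν := ν) 2)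
      ((h1 j).memLp_grad (μ := volume.restrict Ω) 2))) atTop (𝓝 _) :=
    (Continuous.inner continuous_const continuous_id).tendsto _ |>.comp ht
  have e : ∀ j, inner ℝ (emb hf.neg hG) (emb ((h1 j).memLp (ν := ν) 2)
      ((h1 j).memLp_grad (μ := volume.restrict Ω) 2)) = 0 := fun j => by
    rw [inner_emb, heq _ (h1 j)]
    simp only [Pi.neg_apply, neg_mul, integral_neg]
    ring
  have := tendsto_nhds_unique (hz.congr e) tendsto_const_nhds
  rw [id, inner_emb] at this
  simp only [Pi.neg_apply, neg_mul, integral_neg] at this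
  linarith

lemma tendsto_eLpNorm_two_of_bounded {E : Type*} [NormedAddCommGroup E] [IsFiniteMeasure ν]
    {f : ℕ → Eu N → E} (hf : ∀ n, AEStronglyMeasurable (f n) ν) {C : ℝ}
    (hC : ∀ n, ∀ᵐ x ∂ν, ‖f n x‖ ≤ C) (h0 : ∀ᵐ x ∂ν, Tendsto (fun n => f n x) atTop (𝓝 0)) :
    Tendsto (fun n => eLpNorm (f n) 2 ν) atTop (𝓝 0) := by
  have := tendsto_Lp_finite_of_tendsto_ae (μ := ν) (p := 2) (g := (0 : Eu N → E)) (by norm_num) (by norm_num) hf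
    MemLp.zero (unifIntegrable_of (by norm_num) (by norm_num) hf fun ε _ =>
      ⟨Real.toNNReal (C + 1), fun n => ?_⟩) h0
  · simpa using this
  · rw [eLpNorm_congr_ae (g := 0), eLpNorm_zero]
    · exact zero_le
    filter_upwards [hC n] with x hx
    refine indicator_of_notMem (fun hm => ?_) _
    have h2 : Real.toNNReal (C + 1) ≤ ‖f n x‖₊ := hm
    rw [Real.toNNReal_le_iff_le_coe, coe_nnnorm] at h2
    linarith

lemma memLp_of_continuous (h : SmoothDom D Ω) {E : Type*} [NormedAddCommGroup E]
    {f : Eu N → E} (hf : Continuous f) [IsFiniteMeasure ν] (hν : ∀ᵐ x ∂ν, x ∈ Ω)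
    (hm : AEStronglyMeasurable f ν) : MemLp f 2 ν := by
  obtain ⟨C, -, hC⟩ := h.exists_bound hf
  exact MemLp.of_bound hm C (hν.mono hC)

lemma testFn_cutoff_mul (h : SmoothDom D Ω) {τ : ℝ} (hτ : 0 < τ) {f : Eu N → ℝ} (hf : ContDiff ℝ 1 f) :
    TestFn Ω (cutoff D τ * f) :=
  TestFn.of_contDiff_mul ⟨contDiff_cutoff (h.contDiff 1) τ, hasCompactSupport_cutoff h hτ,
    (tsupport_cutoff_subset h hτ).trans (superlevel_subset h hτ)⟩ hf

lemma Adm.h01 (h : SmoothDom D Ω) [IsFiniteMeasure ν] (hν : ∀ᵐ x ∂ν, x ∈ Ω) {ζ : Eu N → ℝ}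
    (hζ : Adm D Ω ζ) : H01 ν Ω ζ (gradient ζ) := by
  have := h.isFiniteMeasure
  have hμ : ∀ᵐ x ∂(volume.restrict Ω), x ∈ Ω := ae_restrict_mem h.meas
  have hζ1 : ContDiff ℝ 1 ζ := hζ.contDiff.of_le (by norm_num)
  have hg := continuous_gradient hζ1
  have hζc := hζ1.continuous
  have hcc : ∀ τ, Continuous (cutoff D τ) := fun τ => (contDiff_cutoff (h.contDiff 1) τ).continuous
  obtain ⟨S, hS0, hS⟩ := exists_deriv_smoothTransition_le
  obtain ⟨C, hC⟩ := hζ.bound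
  obtain ⟨A, hA0, hA⟩ := h.exists_bound hζc
  obtain ⟨B, hB0, hB⟩ := h.exists_bound hg
  obtain ⟨E, hE0, hE⟩ := h.exists_bound (continuous_gradient (h.contDiff 1))
  have hτ : ∀ n : ℕ, (0 : ℝ) < 1 / ((n : ℝ) + 1) := fun n => by positivity
  have hT := fun n => testFn_cutoff_mul h (hτ n) hζ1
  have hgr : ∀ (n : ℕ) x, gradient (cutoff D (1 / ((n : ℝ) + 1)) * ζ) x - gradient ζ x =
      (cutoff D (1 / ((n : ℝ) + 1)) x - 1) • gradient ζ x +
      (ζ x * (deriv Real.smoothTransition ((D x - 1 / ((n : ℝ) + 1)) / (1 / ((n : ℝ) + 1))) /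
        (1 / ((n : ℝ) + 1)))) • gradient D x := fun n x => by
    have e := gradient_mul (((contDiff_cutoff (h.contDiff 1) (1 / ((n : ℝ) + 1))).differentiable
      (by norm_num)) x) ((hζ1.differentiable (by norm_num)) x)
    rw [gradient_cutoff h, smul_smul] at e
    change gradient (fun y => cutoff D (1 / ((n : ℝ) + 1)) y * ζ y) x - _ = _
    rw [e, sub_smul, one_smul]
    abel
  have hab : ∀ (n : ℕ) x, |cutoff D (1 / ((n : ℝ) + 1)) x - 1| ≤ 1 := fun n x => by
    have := cutoff_nonneg (D := D) (1 / ((n : ℝ) + 1)) x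
    have := cutoff_le_one (D := D) (1 / ((n : ℝ) + 1)) x
    rw [abs_le]; constructor <;> linarith
  have herr : ∀ (n : ℕ) x, x ∈ Ω → ‖(ζ x * (deriv Real.smoothTransition ((D x - 1 / ((n : ℝ) + 1)) / (1 / ((n : ℝ) + 1))) /
        (1 / ((n : ℝ) + 1)))) • gradient D x‖ ≤ |C| * cutoffErr D (1 / ((n : ℝ) + 1)) x * E := by
    intro n x hx
    have h1 := deriv_smoothTransition_nonneg ((D x - 1 / ((n : ℝ) + 1)) / (1 / ((n : ℝ) + 1)))
    have hD := h.mem.1 hx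
    have h2 : 0 ≤ deriv Real.smoothTransition ((D x - 1 / ((n : ℝ) + 1)) / (1 / ((n : ℝ) + 1))) /
        (1 / ((n : ℝ) + 1)) := div_nonneg h1 (hτ n).le
    have h3 : ζ x ≤ |C| * D x := (hC x hx).1.trans (mul_le_mul_of_nonneg_right (le_abs_self C) hD.le)
    rw [norm_smul, Real.norm_of_nonneg (mul_nonneg (hζ.nonneg x hx) h2)]
    refine mul_le_mul ?_ (hE x hx) (norm_nonneg _)
      (mul_nonneg (abs_nonneg _) (cutoffErr_bounds hS0 hS (hτ n) hD).1)
    refine (mul_le_mul_of_nonneg_right h3 h2).trans_eq ?_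
    rw [cutoffErr]; ring
  refine ⟨memLp_of_continuous h hζc hν hζc.aestronglyMeasurable,
    memLp_of_continuous h hg hμ hg.aestronglyMeasurable, fun n => cutoff D (1 / ((n : ℝ) + 1)) * ζ,
    hT, ?_, ?_⟩
  · refine tendsto_eLpNorm_two_of_bounded (C := A) (fun n => ((hT n).continuous.sub hζc).aestronglyMeasurable)
      (fun n => hν.mono fun x hx => ?_) (hν.mono fun x hx => ?_)
    · have e : (cutoff D (1 / ((n : ℝ) + 1)) * ζ - ζ) x = (cutoff D (1 / ((n : ℝ) + 1)) x - 1) * ζ x := by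
        simp only [Pi.sub_apply, Pi.mul_apply]; ring
      rw [e, norm_mul]
      calc _ ≤ 1 * A := mul_le_mul (hab n x) (hA x hx) (norm_nonneg _) zero_le_one
        _ = A := one_mul A
    · refine tendsto_const_nhds.congr' ?_
      filter_upwards [eventually_cutoff (h.mem.1 hx)] with n hn
      rw [Pi.sub_apply, Pi.mul_apply, hn.1, one_mul, sub_self]
  · refine tendsto_eLpNorm_two_of_bounded (C := B + |C| * (2 * S) * E)
      (fun n => ((hT n).continuous_grad.sub hg).aestronglyMeasurable)
      (fun n => hμ.mono fun x hx => ?_) (hμ.mono fun x hx => ?_)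
    · rw [Pi.sub_apply, hgr]
      refine (norm_add_le _ _).trans (add_le_add ?_ ((herr n x hx).trans ?_))
      · rw [norm_smul]
        calc _ ≤ 1 * B := mul_le_mul (hab n x) (hB x hx) (norm_nonneg _) zero_le_one
          _ = B := one_mul B
      · have := (cutoffErr_bounds hS0 hS (hτ n) (h.mem.1 hx)).2
        gcongr
    · refine tendsto_const_nhds.congr' ?_
      filter_upwards [eventually_cutoff (h.mem.1 hx)] with n hn
      have h4 := herr n x hx
      rw [hn.2, mul_zero, zero_mul] at h4
      rw [Pi.sub_apply, hgr, hn.1, norm_le_zero_iff.1 h4]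
      simp

/-- Integration by parts against a smooth function. -/
lemma H01.integral_lap (h : SmoothDom D Ω) {R : Eu N → ℝ} {g : Eu N → Eu N}
    (hR : H01 (volume.restrict Ω) Ω R g) {ζ : Eu N → ℝ} (hζ : ContDiff ℝ 2 ζ) :
    ∫ x in Ω, inner ℝ (gradient ζ x) (g x) = ∫ x in Ω, -lap ζ x * R x := by
  have := h.isFiniteMeasure
  have hμ : ∀ᵐ x ∂(volume.restrict Ω), x ∈ Ω := ae_restrict_mem h.meas
  have hg := continuous_gradient (hζ.of_le (by norm_num))
  have hl := (continuous_lap hζ).neg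
  refine hR.weak_eq (f := fun x => -lap ζ x) (memLp_of_continuous h hl hμ hl.aestronglyMeasurable)
    (memLp_of_continuous h hg hμ hg.aestronglyMeasurable) fun φ hφ => ?_
  have hX : ContDiff ℝ 1 (fun x => φ x • gradient ζ x) :=
    hφ.contDiff.smul (contDiff_gradient hζ (by norm_num))
  have h0 := integral_divg_eq_zero hX hφ.compact.smul_right
  have e : ∀ x, divg (fun x => φ x • gradient ζ x) x =
      inner ℝ (gradient ζ x) (gradient φ x) - -lap ζ x * φ x := fun x => by
    rw [divg_smul (hφ.differentiableAt x) ((((contDiff_gradient hζ (k := 1) (by norm_num))).differentiable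
      (by norm_num)) x), divg_gradient hζ, real_inner_comm]
    ring
  simp only [e] at h0
  have hi1 : Integrable (fun x => inner ℝ (gradient ζ x) (gradient φ x)) :=
    (hg.inner hφ.continuous_grad).integrable_of_hasCompactSupport
      (hφ.compact_grad.mono fun x hx => by
        intro h0; exact hx (by simp [h0]))
  have hi2 : Integrable (fun x => -lap ζ x * φ x) :=
    (hl.mul hφ.continuous).integrable_of_hasCompactSupport hφ.compact.mul_left
  have z : ∀ x, x ∉ Ω → x ∉ tsupport φ := fun x hx hm => hx (hφ.subset hm)
  rw [setIntegral_eq_integral_of_forall_compl_eq_zero, setIntegral_eq_integral_of_forall_compl_eq_zero]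
  · rw [integral_sub hi1 hi2] at h0; linarith
  · intro x hx; rw [image_eq_zero_of_notMem_tsupport (z x hx), mul_zero]
  · intro x hx
    rw [gradient, gradient, fderiv_of_notMem_tsupport ℝ (z x hx), map_zero, inner_zero_right]

/-- Test functions are dense in `L²`. -/
lemma exists_testFn_close (h : SmoothDom D Ω) [IsFiniteMeasure ν] (hν : ∀ᵐ x ∂ν, x ∈ Ω)
    {f : Eu N → ℝ} (hf : MemLp f 2 ν) {ε : ℝ} (hε : 0 < ε) :
    ∃ φ, TestFn Ω φ ∧ ∫ x, (φ x - f x) ^ 2 ∂ν ≤ ε := by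
  have hs : 0 < Real.sqrt ε / 2 := by positivity
  obtain ⟨g, hgc, hg, hgf⟩ := hf.exist_eLpNorm_sub_le (by norm_num) (by norm_num) hs
  have hg1 : ContDiff ℝ 1 g := hg.of_le (by exact_mod_cast le_top)
  have hτ : ∀ n : ℕ, (0 : ℝ) < 1 / ((n : ℝ) + 1) := fun n => by positivity
  have hT := fun n => testFn_cutoff_mul h (hτ n) hg1
  obtain ⟨A, hA0, hA⟩ := h.exists_bound hg1.continuous
  have ht : Tendsto (fun n : ℕ => eLpNorm (cutoff D (1 / ((n : ℝ) + 1)) * g - g) 2 ν) atTop (𝓝 0) := by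
    refine tendsto_eLpNorm_two_of_bounded (C := A) (fun n => ((hT n).continuous.sub hg1.continuous).aestronglyMeasurable)
      (fun n => hν.mono fun x hx => ?_) (hν.mono fun x hx => ?_)
    · have e : (cutoff D (1 / ((n : ℝ) + 1)) * g - g) x = (cutoff D (1 / ((n : ℝ) + 1)) x - 1) * g x := by
        simp only [Pi.sub_apply, Pi.mul_apply]; ring
      have := cutoff_nonneg (D := D) (1 / ((n : ℝ) + 1)) x
      have := cutoff_le_one (D := D) (1 / ((n : ℝ) + 1)) x
      rw [e, norm_mul]
      calc _ ≤ 1 * A := mul_le_mul (by rw [Real.norm_eq_abs, abs_le]; constructor <;> linarith)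
              (hA x hx) (norm_nonneg _) zero_le_one
        _ = A := one_mul A
    · refine tendsto_const_nhds.congr' ?_
      filter_upwards [eventually_cutoff (h.mem.1 hx)] with n hn
      rw [Pi.sub_apply, Pi.mul_apply, hn.1, one_mul, sub_self]
  obtain ⟨n, hn⟩ := ((ENNReal.tendsto_nhds_zero.1 ht) (ENNReal.ofReal (Real.sqrt ε / 2)) (by positivity)).exists
  refine ⟨_, hT n, ?_⟩
  have hle : eLpNorm (cutoff D (1 / ((n : ℝ) + 1)) * g - f) 2 ν ≤ ENNReal.ofReal (Real.sqrt ε) := by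
    have e : cutoff D (1 / ((n : ℝ) + 1)) * g - f = (cutoff D (1 / ((n : ℝ) + 1)) * g - g) + (g - f) := by abel
    have hgm : AEStronglyMeasurable g ν := hg1.continuous.aestronglyMeasurable
    rw [e]
    refine (eLpNorm_add_le ((hT n).continuous.aestronglyMeasurable.sub hgm) (hgm.sub hf.1) (by norm_num)).trans ?_
    rw [eLpNorm_sub_comm g f]
    refine (add_le_add hn hgf).trans_eq ?_
    rw [← ENNReal.ofReal_add hs.le hs.le, add_halves]
  have hm : MemLp (cutoff D (1 / ((n : ℝ) + 1)) * g - f) 2 ν := ((hT n).memLp 2).sub hf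
  rw [hm.eLpNorm_eq_integral_rpow_norm (by norm_num) (by norm_num),
    ENNReal.ofReal_le_ofReal_iff (Real.sqrt_nonneg _)] at hle
  have e2 : ∫ x, ‖(cutoff D (1 / ((n : ℝ) + 1)) * g - f) x‖ ^ (2 : ℝ≥0∞).toReal ∂ν =
      ∫ x, ((cutoff D (1 / ((n : ℝ) + 1)) * g) x - f x) ^ 2 ∂ν := by
    refine integral_congr_ae (ae_of_all _ fun x => ?_)
    simp
  rw [e2] at hle
  have hI : 0 ≤ ∫ x, ((cutoff D (1 / ((n : ℝ) + 1)) * g) x - f x) ^ 2 ∂ν :=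
    integral_nonneg fun x => sq_nonneg _
  have e3 : (2 : ℝ≥0∞).toReal⁻¹ = 1 / 2 := by norm_num
  rw [e3, ← Real.sqrt_eq_rpow] at hle
  exact (Real.sqrt_le_sqrt_iff hε.le).1 hle
end
end

section
variable {N : ℕ}
section

/-- A `C¹` approximation of the positive part. -/
def softPos (δ t : ℝ) : ℝ := (posPow 2 t - posPow 2 (t - δ)) / (2 * δ)

/-- The derivative of `softPos`. -/
def softPos' (δ t : ℝ) : ℝ := (posPow 1 t - posPow 1 (t - δ)) / δ

lemma hasDerivAt_softPos (δ t : ℝ) : HasDerivAt (softPos δ) (softPos' δ t) t := by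
  have h1 := hasDerivAt_posPow 0 t
  have h2 := (hasDerivAt_posPow 0 (t - δ)).comp t ((hasDerivAt_id t).sub_const δ)
  have h3 := (h1.sub h2).div_const (2 * δ)
  refine h3.congr_deriv ?_
  simp only [Nat.cast_zero, zero_add, mul_one, ← mul_sub, softPos']
  rw [mul_div_mul_left _ _ (two_ne_zero' ℝ)]

lemma continuous_softPos' (δ : ℝ) : Continuous (softPos' δ) := by
  have := continuous_posPow 1
  unfold softPos'; fun_prop

lemma softPos_of_nonpos {δ t : ℝ} (hδ : 0 < δ) (ht : t ≤ 0) : softPos δ t = 0 ∧ softPos' δ t = 0 := by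
  simp [softPos, softPos', posPow, max_eq_right ht, max_eq_right (show t - δ ≤ 0 by linarith)]

lemma softPos'_mem {δ : ℝ} (hδ : 0 < δ) (t : ℝ) : 0 ≤ softPos' δ t ∧ softPos' δ t ≤ 1 := by
  have h1 : max (t - δ) 0 ≤ max t 0 := max_le_max_right 0 (by linarith)
  have h2 : max t 0 ≤ max (t - δ) 0 + δ :=
    max_le (by linarith [le_max_left (t - δ) 0]) (by linarith [le_max_right (t - δ) 0])
  rw [softPos', posPow, posPow, pow_one, pow_one]
  exact ⟨div_nonneg (by linarith) hδ.le, (div_le_one hδ).2 (by linarith)⟩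

lemma softPos_mem {δ : ℝ} (hδ : 0 < δ) (t : ℝ) :
    0 ≤ softPos δ t ∧ softPos δ t ≤ max t 0 ∧ t - softPos δ t ≤ δ := by
  rcases le_total t 0 with h | h
  · rw [(softPos_of_nonpos hδ h).1]; exact ⟨le_rfl, le_max_right _ _, by linarith⟩
  rw [max_eq_left h]
  have e : softPos δ t * (2 * δ) = t ^ 2 - posPow 2 (t - δ) := by
    rw [softPos, posPow_of_nonneg 2 h, div_mul_cancel₀ _ (by positivity)]
  have h2 : 0 < 2 * δ := by positivity
  rcases le_total (t - δ) 0 with h' | h'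
  · rw [posPow_of_nonpos (by norm_num) h', sub_zero] at e
    have h3 : t * t ≤ t * δ := mul_le_mul_of_nonneg_left (by linarith) h
    exact ⟨nonneg_of_mul_nonneg_left (e ▸ sq_nonneg t) h2, le_of_mul_le_mul_right
      (by rw [e, sq]; nlinarith) h2, by
        linarith [nonneg_of_mul_nonneg_left (e ▸ sq_nonneg t : 0 ≤ softPos δ t * (2 * δ)) h2]⟩
  · rw [posPow_of_nonneg 2 h'] at e
    have h3 : softPos δ t = t - δ / 2 := by
      refine mul_right_cancel₀ h2.ne' ?_
      rw [e]; ring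
    rw [h3]
    exact ⟨by linarith, by linarith, by linarith⟩

/-- A `C¹` contraction onto a small neighbourhood of `[lo, hi]`, fixing `[lo, hi]`. -/
def softClamp (lo hi δ s : ℝ) : ℝ := s - softPos δ (s - hi) + softPos δ (lo - s)

lemma hasDerivAt_softClamp (lo hi δ s : ℝ) :
    HasDerivAt (softClamp lo hi δ) (1 - softPos' δ (s - hi) - softPos' δ (lo - s)) s := by
  have h1 := (hasDerivAt_softPos δ (s - hi)).comp s ((hasDerivAt_id s).sub_const hi)
  have h2 := (hasDerivAt_softPos δ (lo - s)).comp s ((hasDerivAt_id s).const_sub lo)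
  refine (((hasDerivAt_id s).sub h1).add h2).congr_deriv ?_
  ring

lemma contDiff_softClamp (lo hi δ : ℝ) : ContDiff ℝ 1 (softClamp lo hi δ) := by
  refine contDiff_one_iff_deriv.2 ⟨fun s => (hasDerivAt_softClamp lo hi δ s).differentiableAt, ?_⟩
  rw [funext fun s => (hasDerivAt_softClamp lo hi δ s).deriv]
  have := continuous_softPos' δ
  fun_prop

variable {lo hi δ : ℝ}

lemma softClamp_zero (hδ : 0 < δ) (hlo : lo ≤ 0) (hhi : 0 ≤ hi) : softClamp lo hi δ 0 = 0 := by
  rw [softClamp, (softPos_of_nonpos hδ (by linarith)).1, (softPos_of_nonpos hδ (by linarith)).1]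
  ring

lemma abs_deriv_softClamp (hδ : 0 < δ) (h : lo ≤ hi) (s : ℝ) :
    |1 - softPos' δ (s - hi) - softPos' δ (lo - s)| ≤ 1 := by
  have h1 := softPos'_mem hδ (s - hi)
  have h2 := softPos'_mem hδ (lo - s)
  rcases le_total s hi with hs | hs
  · rw [(softPos_of_nonpos hδ (by linarith)).2, abs_le]; constructor <;> linarith
  · rw [(softPos_of_nonpos (t := lo - s) hδ (by linarith)).2, abs_le]; constructor <;> linarith

lemma softClamp_mem (hδ : 0 < δ) (h : lo ≤ hi) (s : ℝ) :
    lo - δ ≤ softClamp lo hi δ s ∧ softClamp lo hi δ s ≤ hi + δ := by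
  have h1 := softPos_mem hδ (s - hi)
  have h2 := softPos_mem hδ (lo - s)
  unfold softClamp
  rcases le_total s hi with hs | hs
  · rw [(softPos_of_nonpos hδ (show s - hi ≤ 0 by linarith)).1]
    refine ⟨by linarith, ?_⟩
    rcases le_total lo s with hl | hl
    · rw [(softPos_of_nonpos hδ (show lo - s ≤ 0 by linarith)).1]; linarith
    · rw [max_eq_left (show 0 ≤ lo - s by linarith)] at h2; linarith
  · rw [(softPos_of_nonpos hδ (show lo - s ≤ 0 by linarith)).1]
    rw [max_eq_left (show 0 ≤ s - hi by linarith)] at h1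
    exact ⟨by linarith, by linarith⟩

lemma abs_sub_softClamp_le (hδ : 0 < δ) {f : ℝ} (hl : lo ≤ f) (hh : f ≤ hi) (s : ℝ) :
    |softClamp lo hi δ s - f| ≤ |s - f| := by
  have h1 := softPos_mem hδ (s - hi)
  have h2 := softPos_mem hδ (lo - s)
  unfold softClamp
  rcases le_total s hi with hs | hs
  · rw [(softPos_of_nonpos hδ (show s - hi ≤ 0 by linarith)).1]
    rcases le_total lo s with hl' | hl'
    · rw [(softPos_of_nonpos hδ (show lo - s ≤ 0 by linarith)).1, sub_zero, add_zero]
    · rw [max_eq_left (show 0 ≤ lo - s by linarith)] at h2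
      rw [abs_of_nonpos (show s - f ≤ 0 by linarith), abs_of_nonpos (by linarith)]; linarith
  · rw [(softPos_of_nonpos hδ (show lo - s ≤ 0 by linarith)).1]
    rw [max_eq_left (show 0 ≤ s - hi by linarith)] at h1
    rw [abs_of_nonneg (show 0 ≤ s - f by linarith), abs_of_nonneg (by linarith)]; linarith

end
section
variable {Ω : Set (Eu N)} {ν : Measure (Eu N)} {lo hi : ℝ}

/-- Existence, bounds and minimality for the resolvent equation `ν ψ - Δ ψ = ν F`. -/
lemma exists_resolvent [IsFiniteMeasure ν] [IsFiniteMeasure (volume.restrict Ω)] (hlo : lo ≤ 0) (hhi : 0 ≤ hi)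
    {F : Eu N → ℝ} (hF : AEStronglyMeasurable F ν) (hFb : ∀ᵐ x ∂ν, lo ≤ F x ∧ F x ≤ hi) :
    ∃ ψ g, H01 ν Ω ψ g ∧ Measurable ψ ∧ (∀ x, lo ≤ ψ x ∧ ψ x ≤ hi) ∧
      (∀ φ, TestFn Ω φ → ∫ x in Ω, inner ℝ (g x) (gradient φ x) = ∫ x, (F x - ψ x) * φ x ∂ν) ∧
      ∀ φ, TestFn Ω φ → ∫ x, (ψ x - F x) ^ 2 ∂ν ≤
        (∫ x in Ω, ‖gradient φ x‖ ^ 2) + ∫ x, (φ x - F x) ^ 2 ∂ν := by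
  have hlh := hlo.trans hhi
  have hFm : MemLp F 2 ν := MemLp.of_bound hF (max |lo| |hi|)
    (hFb.mono fun x hx => abs_le_max_abs_abs hx.1 hx.2)
  obtain ⟨A, hA⟩ : ∃ A, A = emb hFm (MemLp.zero (ε := Eu N) (p := 2) (μ := volume.restrict Ω)) := ⟨_, rfl⟩
  obtain ⟨K, hK⟩ : ∃ K, K = (testSpace (ν := ν) (μ := volume.restrict Ω) Ω).topologicalClosure := ⟨_, rfl⟩
  have : CompleteSpace K := by
    rw [hK]; exact (Submodule.isClosed_topologicalClosure _).completeSpace_coe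
  obtain ⟨P, hP⟩ : ∃ P, P = K.starProjection A := ⟨_, rfl⟩
  have hPK : P ∈ K := hP ▸ K.starProjection_apply_mem A
  have horth : ∀ w ∈ K, inner ℝ (A - P) w = 0 := fun w hw => hP ▸ K.starProjection_inner_eq_zero A w hw
  have hpyth : ∀ Q ∈ K, ‖Q - A‖ ^ 2 = ‖A - P‖ ^ 2 + ‖Q - P‖ ^ 2 := fun Q hQ => by
    have e : Q - A = (Q - P) - (A - P) := by abel
    rw [e, norm_sub_sq_real, real_inner_comm, horth _ (K.sub_mem hQ hPK)]; ring
  have hTK : ∀ φ (h : TestFn Ω φ), emb (h.memLp 2) (h.memLp_grad 2) ∈ K := fun φ h => by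
    rw [hK]; exact Submodule.le_topologicalClosure _ ⟨φ, h, rfl⟩
  have hdist : ∀ φ (h : TestFn Ω φ), ‖emb (ν := ν) (μ := volume.restrict Ω) (h.memLp 2) (h.memLp_grad 2) - A‖ ^ 2 =
      ∫ x, (φ x - F x) ^ 2 ∂ν + ∫ x in Ω, ‖gradient φ x‖ ^ 2 := fun φ h => by
    rw [hA, emb_sub, norm_emb_sq]; simp
  have hseq : ∃ φ : ℕ → Eu N → ℝ, ∃ h : ∀ j, TestFn Ω (φ j),
      Tendsto (fun j => emb (ν := ν) (μ := volume.restrict Ω) ((h j).memLp 2) ((h j).memLp_grad 2)) atTop (𝓝 P) := by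
    rw [hK, ← SetLike.mem_coe, Submodule.topologicalClosure_coe] at hPK
    obtain ⟨T, hT, hlim⟩ := mem_closure_iff_seq_limit.1 hPK
    choose φ h he using hT
    refine ⟨φ, h, ?_⟩
    simp only [he]; exact hlim
  obtain ⟨φ, hφ, hlim⟩ := hseq
  have hδ : ∀ j : ℕ, (0 : ℝ) < 1 / ((j : ℝ) + 1) := fun j => by positivity
  have hβ : ∀ j : ℕ, TestFn Ω (softClamp lo hi (1 / ((j : ℝ) + 1)) ∘ φ j) := fun j =>
    (hφ j).comp (contDiff_softClamp _ _ _) (softClamp_zero (hδ j) hlo hhi)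
  have hle : ∀ j : ℕ, ‖emb (ν := ν) (μ := volume.restrict Ω) ((hβ j).memLp 2) ((hβ j).memLp_grad 2) - A‖ ^ 2 ≤
      ‖emb (ν := ν) (μ := volume.restrict Ω) ((hφ j).memLp 2) ((hφ j).memLp_grad 2) - A‖ ^ 2 := by
    intro j
    rw [hdist _ (hβ j), hdist _ (hφ j)]
    refine add_le_add (integral_mono_ae (((hβ j).memLp 2).sub hFm).integrable_sq
      (((hφ j).memLp 2).sub hFm).integrable_sq ?_) (integral_mono
      ((hβ j).memLp_grad 2).integrable_norm_pow' ((hφ j).memLp_grad 2).integrable_norm_pow' fun x => ?_)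
    · filter_upwards [hFb] with x hx
      exact sq_le_sq.2 (abs_sub_softClamp_le (hδ j) hx.1 hx.2 _)
    · have e := gradient_comp (hasDerivAt_softClamp lo hi (1 / ((j : ℝ) + 1)) (φ j x)) ((hφ j).differentiableAt x)
      change ‖gradient (fun y => softClamp lo hi (1 / ((j : ℝ) + 1)) (φ j y)) x‖ ^ 2 ≤ _
      rw [e, norm_smul]
      refine pow_le_pow_left₀ (by positivity) ?_ 2
      exact mul_le_of_le_one_left (norm_nonneg _) (abs_deriv_softClamp (hδ j) hlh _)
  have hlim2 : Tendsto (fun j => emb (ν := ν) (μ := volume.restrict Ω) ((hβ j).memLp 2) ((hβ j).memLp_grad 2)) atTop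
      (𝓝 (emb (Lp.memLp P.fst) (Lp.memLp P.snd))) := by
    rw [emb_self, tendsto_iff_norm_sub_tendsto_zero]
    rw [tendsto_iff_norm_sub_tendsto_zero] at hlim
    refine squeeze_zero (fun _ => norm_nonneg _) (fun j => ?_) hlim
    have h1 := hle j
    rw [hpyth _ (hTK _ (hβ j)), hpyth _ (hTK _ (hφ j))] at h1
    exact le_of_sq_le_sq (by linarith) (norm_nonneg _)
  obtain ⟨hl1, hl2⟩ := (tendsto_emb_iff _ _ _ _).1 hlim2
  obtain ⟨ns, hns, hae⟩ := (tendstoInMeasure_of_tendsto_eLpNorm (by norm_num)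
    (fun j => ((hβ j).continuous).aestronglyMeasurable) (Lp.memLp P.fst).1 hl1).exists_seq_tendsto_ae
  have hbd : ∀ᵐ x ∂ν, max lo (min hi (P.fst x)) = P.fst x := by
    filter_upwards [hae] with x hx
    have hz := (tendsto_one_div_add_atTop_nhds_zero_nat (𝕜 := ℝ)).comp hns.tendsto_atTop
    have h1 : P.fst x ≤ hi := by
      have := hz.const_add hi
      rw [add_zero] at this
      exact le_of_tendsto_of_tendsto' hx this fun j => (softClamp_mem (hδ (ns j)) hlh _).2
    have h2 : lo ≤ P.fst x := by
      have := hz.const_sub lo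
      rw [sub_zero] at this
      exact le_of_tendsto_of_tendsto' this hx fun j => (softClamp_mem (hδ (ns j)) hlh _).1
    rw [min_eq_right h1, max_eq_right h2]
  obtain ⟨ψ, hψ⟩ : ∃ ψ : Eu N → ℝ, ψ = fun x => max lo (min hi (P.fst x)) := ⟨_, rfl⟩
  have hψP : P.fst =ᵐ[ν] ψ := by filter_upwards [hbd] with x hx; rw [hψ]; exact hx.symm
  have hψm : MemLp ψ 2 ν := (memLp_congr_ae hψP).1 (Lp.memLp P.fst)
  have hPe : P = emb hψm (Lp.memLp P.snd) := by
    conv_lhs => rw [← emb_self P]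
    simp only [emb]
    congr 2
    exact MemLp.toLp_congr _ _ hψP
  refine ⟨ψ, P.snd, ⟨hψm, Lp.memLp _, _, hβ, ?_, hl2⟩, ?_, fun x => ?_, fun χ hχ => ?_, fun χ hχ => ?_⟩
  · refine hl1.congr fun j => eLpNorm_congr_ae ?_
    filter_upwards [hψP] with x hx
    rw [Pi.sub_apply, Pi.sub_apply, hx]
  · rw [hψ]
    exact measurable_const.max (measurable_const.min (Lp.stronglyMeasurable _).measurable)
  · rw [hψ]; exact ⟨le_max_left _ _, max_le hlh (min_le_left _ _)⟩
  · have h1 := horth _ (hTK χ hχ)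
    rw [hPe, hA, emb_sub, inner_emb] at h1
    simp only [Pi.sub_apply, Pi.zero_apply, zero_sub, inner_neg_left, integral_neg] at h1
    linarith
  · have h1 := hpyth _ (hTK χ hχ)
    have h2 : ∫ x, (ψ x - F x) ^ 2 ∂ν ≤ ‖A - P‖ ^ 2 := by
      rw [← norm_neg (A - P), neg_sub, hPe, hA, emb_sub, norm_emb_sq]
      exact le_add_of_nonneg_right (integral_nonneg fun x => sq_nonneg _)
    rw [hdist χ hχ] at h1
    have h3 := sq_nonneg ‖emb (ν := ν) (μ := volume.restrict Ω) (hχ.memLp 2) (hχ.memLp_grad 2) - P‖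
    linarith only [h1, h2, h3]
end
end

section
variable {N : ℕ}
section
variable {D : Eu N → ℝ} {Ω : Set (Eu N)} {ρ b : Eu N → ℝ}

/-- The measure `ρ dx` on `Ω`. -/
def weighted (ρ : Eu N → ℝ) (Ω : Set (Eu N)) : Measure (Eu N) :=
  (volume.restrict Ω).withDensity fun x => ENNReal.ofReal (ρ x)

lemma weighted_ac : weighted ρ Ω ≪ volume.restrict Ω := withDensity_absolutelyContinuous _ _

lemma Weight.isFiniteMeasure (hρ : Weight ρ Ω) : IsFiniteMeasure (weighted ρ Ω) :=
  isFiniteMeasure_withDensity_ofReal hρ.integrable.2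

lemma SmoothDom.ae_weighted (h : SmoothDom D Ω) : ∀ᵐ x ∂(weighted ρ Ω), x ∈ Ω :=
  weighted_ac (ae_restrict_mem h.meas)

lemma Weight.integral_weighted (hρ : Weight ρ Ω) (f : Eu N → ℝ) :
    ∫ x, f x ∂(weighted ρ Ω) = ∫ x in Ω, ρ x * f x := by
  rw [weighted, integral_withDensity_eq_integral_toReal_smul hρ.meas.ennreal_ofReal
    (ae_of_all _ fun x => ENNReal.ofReal_lt_top)]
  refine integral_congr_ae ?_
  filter_upwards [hρ.nonneg] with x hx
  rw [ENNReal.toReal_ofReal hx, smul_eq_mul]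

lemma Weight.mul (hρ : Weight ρ Ω) (hb : Measurable b) {c₁ c₂ : ℝ} (hc₁ : 0 < c₁)
    (hbc : ∀ x, c₁ ≤ b x ∧ b x ≤ c₂) : Weight (fun x => b x * ρ x) Ω := by
  have hb0 : ∀ x, 0 ≤ b x := fun x => hc₁.le.trans (hbc x).1
  refine ⟨hb.mul hρ.meas, ?_, ?_, fun e he => ?_⟩
  · obtain ⟨c, hc, h⟩ := hρ.lower
    exact ⟨c₁ * c, by positivity, h.mono fun x hx => mul_le_mul (hbc x).1 hx hc.le (hb0 x)⟩
  · exact Integrable.bdd_mul (c := c₂) hρ.integrable hb.aestronglyMeasurable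
      (ae_of_all _ fun x => by rw [Real.norm_of_nonneg (hb0 x)]; exact (hbc x).2)
  · obtain ⟨C, hC, h⟩ := hρ.upper e he
    have hc₂ : 0 ≤ c₂ := (hb0 0).trans (hbc 0).2
    refine ⟨c₂ * C, by positivity, ?_⟩
    filter_upwards [h, hρ.nonneg] with x hx h0 hex
    exact mul_le_mul (hbc x).2 (hx hex) h0 hc₂

lemma weighted_le {V W : Eu N → ℝ} {c : ℝ} (hc : 0 ≤ c)
    (hle : ∀ᵐ x ∂(volume.restrict Ω), V x ≤ c * W x) :
    weighted V Ω ≤ ENNReal.ofReal c • weighted W Ω := by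
  rw [weighted, weighted, ← withDensity_smul' _ _ ENNReal.ofReal_ne_top]
  refine withDensity_mono ?_
  filter_upwards [hle] with x hx
  rw [Pi.smul_apply, smul_eq_mul, ← ENNReal.ofReal_mul hc]
  exact ENNReal.ofReal_le_ofReal hx

lemma Weight.restrict_le (hρ : Weight ρ Ω) : ∃ C : ℝ≥0∞, C ≠ ⊤ ∧ volume.restrict Ω ≤ C • weighted ρ Ω := by
  obtain ⟨c, hc, h⟩ := hρ.lower
  refine ⟨ENNReal.ofReal c⁻¹, ENNReal.ofReal_ne_top, ?_⟩
  have := weighted_le (V := fun _ => (1 : ℝ)) (W := ρ) (inv_nonneg.2 hc.le) (h.mono fun x hx => by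
    rw [inv_mul_eq_div, one_le_div hc]; exact hx)
  refine le_trans (le_of_eq ?_) this
  simp [weighted]

/-- The resolvent of `(bρ)⁻¹Δ` on bounded data. -/
lemma Weight.exists_resolvent (h : SmoothDom D Ω) (hρ : Weight ρ Ω) (hb : Measurable b) {c₁ c₂ : ℝ}
    (hc₁ : 0 < c₁) (hbc : ∀ x, c₁ ≤ b x ∧ b x ≤ c₂) {lo hi : ℝ} (hlo : lo ≤ 0) (hhi : 0 ≤ hi)
    {F : Eu N → ℝ} (hF : AEStronglyMeasurable F (volume.restrict Ω))
    (hFb : ∀ᵐ x ∂(volume.restrict Ω), lo ≤ F x ∧ F x ≤ hi) :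
    ∃ ψ g, H01 (weighted ρ Ω) Ω ψ g ∧ Measurable ψ ∧ (∀ x, lo ≤ ψ x ∧ ψ x ≤ hi) ∧
      (∀ χ gχ, H01 (weighted ρ Ω) Ω χ gχ →
        ∫ x in Ω, inner ℝ (g x) (gχ x) = ∫ x in Ω, b x * ρ x * ((F x - ψ x) * χ x)) ∧
      ∀ φ, TestFn Ω φ → ∫ x in Ω, b x * ρ x * (ψ x - F x) ^ 2 ≤
        (∫ x in Ω, ‖gradient φ x‖ ^ 2) + ∫ x in Ω, b x * ρ x * (φ x - F x) ^ 2 := by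
  have := h.isFiniteMeasure
  have hV := hρ.mul hb hc₁ hbc
  have := hρ.isFiniteMeasure
  have := hV.isFiniteMeasure
  have hc₂ : 0 ≤ c₂ := (hc₁.le.trans (hbc 0).1).trans (hbc 0).2
  obtain ⟨ψ, g, h1, h2, h3, h4, h5⟩ := _root_.exists_resolvent (ν := weighted (fun x => b x * ρ x) Ω) (Ω := Ω) hlo hhi
    (hF.mono_ac weighted_ac) (weighted_ac hFb)
  simp only [hV.integral_weighted] at h5
  refine ⟨ψ, g, h1.mono_measure (C := ENNReal.ofReal c₁⁻¹) ENNReal.ofReal_ne_top (weighted_le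
    (inv_nonneg.2 hc₁.le) (hρ.nonneg.mono fun x hx => ?_)), h2, h3, fun χ gχ hχ => ?_, h5⟩
  · rw [← mul_assoc]
    refine le_mul_of_one_le_left hx ?_
    rw [inv_mul_eq_div, one_le_div hc₁]; exact (hbc x).1
  · rw [← hV.integral_weighted (fun x => (F x - ψ x) * χ x)]
    have hχ' := hχ.mono_measure (C := ENNReal.ofReal c₂) ENNReal.ofReal_ne_top (weighted_le
      (V := fun x => b x * ρ x) hc₂ (hρ.nonneg.mono fun x hx => mul_le_mul_of_nonneg_right (hbc x).2 hx))
    have hFm : MemLp F 2 (weighted (fun x => b x * ρ x) Ω) := MemLp.of_bound (hF.mono_ac weighted_ac) (max |lo| |hi|)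
      (weighted_ac (hFb.mono fun x hx => abs_le_max_abs_abs hx.1 hx.2))
    exact hχ'.weak_eq (f := fun x => F x - ψ x) (hFm.sub h1.memLp) h1.memLp_grad h4

end
section
variable {D : Eu N → ℝ} {Ω : Set (Eu N)} {ρ : Eu N → ℝ}

lemma bddMeas_integrable (hρ : Weight ρ Ω) {f : Eu N → ℝ} (hf : AEStronglyMeasurable f (volume.restrict Ω)) {C : ℝ}
    (hC : ∀ᵐ x ∂(volume.restrict Ω), |f x| ≤ C) : IntegrableOn (fun x => ρ x * f x) Ω :=
  Integrable.mul_bdd (c := C) hρ.integrable hf hC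

lemma resolvent_le (hN : 3 ≤ N) (h : SmoothDom D Ω) (hρ : Weight ρ Ω) {Y ω : Eu N → ℝ} {M : ℝ}
    (hYm : AEStronglyMeasurable Y (volume.restrict Ω)) (hωm : AEStronglyMeasurable ω (volume.restrict Ω))
    (hYb : ∀ᵐ x ∂(volume.restrict Ω), |Y x| ≤ M) (hωb : ∀ᵐ x ∂(volume.restrict Ω), |ω x| ≤ M)
    (hY : ∀ ζ, Adm D Ω ζ → 0 ≤ ∫ x in Ω, (Y x * -lap ζ x + ρ x * (ω x * ζ x)))
    {k : ℝ} (hk : 0 < k) {R : Eu N → ℝ} {gR : Eu N → Eu N} (hR : H01 (weighted ρ Ω) Ω R gR)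
    (hRm : Measurable R) {B : ℝ} (hRb : ∀ x, |R x| ≤ B)
    (hReq : ∀ χ gχ, H01 (weighted ρ Ω) Ω χ gχ →
      ∫ x in Ω, inner ℝ (gR x) (gχ x) = ∫ x in Ω, k * ρ x * ((Y x - ω x / k - R x) * χ x)) :
    ∀ᵐ x ∂(volume.restrict Ω), R x ≤ Y x := by
  have := h.isFiniteMeasure
  have := hρ.isFiniteMeasure
  have hμ : ∀ᵐ x ∂(volume.restrict Ω), x ∈ Ω := ae_restrict_mem h.meas
  have hV : Weight (fun x => k * ρ x) Ω := hρ.mul measurable_const hk fun _ => ⟨le_rfl, le_rfl⟩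
  have hmain := max_principle hN h hV (r := fun x => Y x - R x) (hYm.sub hRm.aestronglyMeasurable)
    (B := M + B) (hYb.mono fun x hx => (abs_sub _ _).trans (add_le_add hx (hRb x))) ?_
  · exact hmain.mono fun x hx => sub_nonneg.1 hx
  intro ζ hζ
  obtain ⟨C, hC0, hC⟩ := h.exists_bound hζ.contDiff.continuous
  obtain ⟨L, hL0, hL⟩ := h.exists_bound (continuous_lap hζ.contDiff)
  have hζm : AEStronglyMeasurable ζ (volume.restrict Ω) := hζ.contDiff.continuous.aestronglyMeasurable
  have hlm : AEStronglyMeasurable (lap ζ) (volume.restrict Ω) := (continuous_lap hζ.contDiff).aestronglyMeasurable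
  have hζb : ∀ᵐ x ∂(volume.restrict Ω), |ζ x| ≤ C := hμ.mono hC
  have hlb : ∀ᵐ x ∂(volume.restrict Ω), |lap ζ x| ≤ L := hμ.mono hL
  have hRl : ∫ x in Ω, -lap ζ x * R x = ∫ x in Ω, k * ρ x * ((Y x - ω x / k - R x) * ζ x) := by
    obtain ⟨c, hc, hle⟩ := hρ.restrict_le
    rw [← (hR.mono_measure hc hle).integral_lap h hζ.contDiff, ← hReq ζ _ (hζ.h01 h h.ae_weighted)]
    simp only [real_inner_comm]
  have hi1 : IntegrableOn (fun x => Y x * -lap ζ x + ρ x * (ω x * ζ x)) Ω := by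
    refine Integrable.add (Integrable.of_bound (C := M * L) (hYm.mul hlm.neg) ?_) (bddMeas_integrable hρ (C := M * C) (hωm.mul hζm) ?_)
    · filter_upwards [hYb, hlb] with x h1 h2
      rw [norm_mul, norm_neg]; exact mul_le_mul h1 h2 (norm_nonneg _) ((abs_nonneg _).trans h1)
    · filter_upwards [hωb, hζb] with x h1 h2
      rw [abs_mul]; exact mul_le_mul h1 h2 (abs_nonneg _) ((abs_nonneg _).trans h1)
  have hi2 : IntegrableOn (fun x => -lap ζ x * R x) Ω := by
    refine Integrable.of_bound (C := L * B) (hlm.neg.mul hRm.aestronglyMeasurable) ?_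
    filter_upwards [hlb] with x h2
    rw [norm_mul, norm_neg]; exact mul_le_mul h2 (hRb x) (norm_nonneg _) hL0
  have hi3 : IntegrableOn (fun x => k * ρ x * ((Y x - ω x / k - R x) * ζ x)) Ω := by
    refine bddMeas_integrable hV (C := (M + M / k + B) * C) (((hYm.sub (hωm.aemeasurable.div_const k).aestronglyMeasurable).sub hRm.aestronglyMeasurable).mul hζm) ?_
    filter_upwards [hYb, hωb, hζb] with x h1 h2 h3
    have h4 : |ω x / k| ≤ M / k := by
      rw [abs_div, abs_of_pos hk]; exact div_le_div_of_nonneg_right h2 hk.le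
    have h5 : |Y x - ω x / k - R x| ≤ M + M / k + B :=
      (abs_sub _ _).trans (add_le_add ((abs_sub _ _).trans (add_le_add h1 h4)) (hRb x))
    rw [abs_mul]; exact mul_le_mul h5 h3 (abs_nonneg _) ((abs_nonneg _).trans h5)
  have e : ∫ x in Ω, (Y x - R x) * (k * ρ x * ζ x - lap ζ x) =
      (∫ x in Ω, (Y x * -lap ζ x + ρ x * (ω x * ζ x))) - (∫ x in Ω, -lap ζ x * R x) +
        ∫ x in Ω, k * ρ x * ((Y x - ω x / k - R x) * ζ x) := by
    have hi12 : IntegrableOn (fun x => (Y x * -lap ζ x + ρ x * (ω x * ζ x)) - -lap ζ x * R x) Ω := hi1.sub hi2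
    rw [← integral_sub hi1 hi2, ← integral_add hi12 hi3]
    refine integral_congr_ae (ae_of_all _ fun x => ?_)
    field_simp
    ring
  rw [e, hRl, sub_add_cancel]
  exact hY ζ hζ
end
end

section
variable {N : ℕ}
section
variable {X : Type*} [MeasurableSpace X] {μ : Measure X} {f g : X → ℝ}

/-- Essentially bounded real functions. -/
def EssBdd (μ : Measure X) (f : X → ℝ) : Prop :=
  AEStronglyMeasurable f μ ∧ ∃ C, 0 ≤ C ∧ ∀ᵐ x ∂μ, |f x| ≤ C

namespace EssBdd

lemma of_bound {C : ℝ} (hf : AEStronglyMeasurable f μ) (h : ∀ᵐ x ∂μ, |f x| ≤ C) : EssBdd μ f :=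
  ⟨hf, |C|, abs_nonneg _, h.mono fun _ hx => hx.trans (le_abs_self _)⟩

lemma const (c : ℝ) : EssBdd μ (fun _ => c) :=
  ⟨aestronglyMeasurable_const, |c|, abs_nonneg _, ae_of_all _ fun _ => le_rfl⟩

lemma add (hf : EssBdd μ f) (hg : EssBdd μ g) : EssBdd μ (fun x => f x + g x) := by
  obtain ⟨h1, C, hC, h2⟩ := hf
  obtain ⟨h3, C', hC', h4⟩ := hg
  refine ⟨h1.add h3, C + C', by positivity, ?_⟩
  filter_upwards [h2, h4] with x a b using (abs_add_le _ _).trans (add_le_add a b)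

lemma mul (hf : EssBdd μ f) (hg : EssBdd μ g) : EssBdd μ (fun x => f x * g x) := by
  obtain ⟨h1, C, hC, h2⟩ := hf
  obtain ⟨h3, C', hC', h4⟩ := hg
  refine ⟨h1.mul h3, C * C', by positivity, ?_⟩
  filter_upwards [h2, h4] with x a b
  rw [abs_mul]; exact mul_le_mul a b (abs_nonneg _) hC

lemma neg (hf : EssBdd μ f) : EssBdd μ (fun x => -f x) := by
  simpa using (const (μ := μ) (-1)).mul hf

lemma sub (hf : EssBdd μ f) (hg : EssBdd μ g) : EssBdd μ (fun x => f x - g x) := by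
  simpa only [sub_eq_add_neg] using hf.add hg.neg

lemma sq (hf : EssBdd μ f) : EssBdd μ (fun x => f x ^ 2) := by
  simpa only [_root_.sq] using hf.mul hf

lemma div_const (hf : EssBdd μ f) (c : ℝ) : EssBdd μ (fun x => f x / c) := by
  simpa only [div_eq_mul_inv] using hf.mul (const c⁻¹)

lemma integrable [IsFiniteMeasure μ] (hf : EssBdd μ f) : Integrable f μ := by
  obtain ⟨h1, C, hC, h2⟩ := hf
  exact Integrable.of_bound h1 C h2

lemma integrable_mul {V : X → ℝ} (hV : Integrable V μ) (hf : EssBdd μ f) :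
    Integrable (fun x => V x * f x) μ := by
  obtain ⟨h1, C, hC, h2⟩ := hf
  exact Integrable.mul_bdd (c := C) hV h1 h2

end EssBdd
end
section
variable {D : Eu N → ℝ} {Ω : Set (Eu N)} {ρ : Eu N → ℝ}

lemma SmoothDom.essBdd (h : SmoothDom D Ω) {f : Eu N → ℝ} (hf : Continuous f) :
    EssBdd (volume.restrict Ω) f := by
  obtain ⟨C, hC0, hC⟩ := h.exists_bound hf
  exact ⟨hf.aestronglyMeasurable, C, hC0, (ae_restrict_mem h.meas).mono hC⟩

lemma weak_comparison_of_testFn (hN : 3 ≤ N) (h : SmoothDom D Ω) (hρ : Weight ρ Ω) {Y ω : Eu N → ℝ} {M : ℝ} (hM : 0 ≤ M)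
    (hYm : AEStronglyMeasurable Y (volume.restrict Ω)) (hωm : AEStronglyMeasurable ω (volume.restrict Ω))
    (hYb : ∀ᵐ x ∂(volume.restrict Ω), |Y x| ≤ M) (hωb : ∀ᵐ x ∂(volume.restrict Ω), |ω x| ≤ M)
    (hY : ∀ ζ, Adm D Ω ζ → 0 ≤ ∫ x in Ω, (Y x * -lap ζ x + ρ x * (ω x * ζ x)))
    {ψ G : Eu N → ℝ} {g : Eu N → Eu N} (hψ : H01 (weighted ρ Ω) Ω ψ g)
    (hψb : EssBdd (volume.restrict Ω) ψ) (hψ0 : ∀ᵐ x ∂(volume.restrict Ω), 0 ≤ ψ x) {B : ℝ} (hB : 0 ≤ B)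
    (hGm : AEStronglyMeasurable G (volume.restrict Ω)) (hGb : ∀ᵐ x ∂(volume.restrict Ω), |G x| ≤ B)
    (hG : ∀ χ gχ, H01 (weighted ρ Ω) Ω χ gχ →
      ∫ x in Ω, inner ℝ (g x) (gχ x) = ∫ x in Ω, ρ x * (G x * χ x))
    {n s : ℝ} (hn : 1 ≤ n) (hs : 0 < s) {φ : Eu N → ℝ} (hφ : TestFn Ω φ) :
    -(∫ x in Ω, ρ x * (G x * Y x + ω x * ψ x)) ≤ B * (s * (∫ x in Ω, ρ x) + 1 / (2 * s) *
      (n⁻¹ * (∫ x in Ω, ‖gradient φ x‖ ^ 2) + 2 * (∫ x in Ω, ρ x * (φ x - Y x) ^ 2) +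
        3 * M ^ 2 * (∫ x in Ω, ρ x) * n⁻¹)) := by
  have hn0 : 0 < n := by linarith
  have hY' : EssBdd (volume.restrict Ω) Y := .of_bound hYm hYb
  have hω' : EssBdd (volume.restrict Ω) ω := .of_bound hωm hωb
  have hG' : EssBdd (volume.restrict Ω) G := .of_bound hGm hGb
  have hFb : ∀ᵐ x ∂(volume.restrict Ω), -(2 * M) ≤ Y x - ω x / n ∧ Y x - ω x / n ≤ 2 * M := by
    filter_upwards [hYb, hωb] with x h1 h2
    have h4 : |ω x / n| ≤ M := by
      rw [abs_div, abs_of_pos hn0]; exact (div_le_self (abs_nonneg _) hn).trans h2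
    rw [abs_le] at h1 h4
    constructor <;> linarith [h1.1, h1.2, h4.1, h4.2]
  have hF' := hY'.sub (hω'.div_const n)
  obtain ⟨R, gR, hR, hRm, hRb, hReq, hRen⟩ := hρ.exists_resolvent h (b := fun _ => n) measurable_const hn0
    (fun _ => ⟨le_rfl, le_rfl⟩) (lo := -(2 * M)) (hi := 2 * M) (by linarith) (by linarith)
    hF'.1 hFb
  have hR' : EssBdd (volume.restrict Ω) R := .of_bound (C := 2 * M) hRm.aestronglyMeasurable
    (ae_of_all _ fun x => abs_le.2 (hRb x))
  have hle := resolvent_le hN h hρ hYm hωm hYb hωb hY hn0 hR hRm (fun x => abs_le.2 (hRb x)) hReq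
  have hφ' := h.essBdd hφ.continuous
  have I : ∀ {f : Eu N → ℝ}, EssBdd (volume.restrict Ω) f → IntegrableOn (fun x => ρ x * f x) Ω :=
    fun hf => EssBdd.integrable_mul hρ.integrable hf
  have e1 : ∫ x in Ω, ρ x * (G x * R x) = ∫ x in Ω, ρ x * ((n * (Y x - R x) - ω x) * ψ x) := by
    rw [← hG R gR hR]
    simp_rw [real_inner_comm (gR _)]
    rw [hReq ψ g hψ]
    refine integral_congr_ae (ae_of_all _ fun x => ?_)
    field_simp
    ring
  have e2 : 0 ≤ ∫ x in Ω, ρ x * (n * (Y x - R x) * ψ x) := by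
    refine integral_nonneg_of_ae ?_
    filter_upwards [hle, hψ0, hρ.nonneg] with x h1 h2 h3
    have := sub_nonneg.2 h1
    simp only [Pi.zero_apply]; positivity
  have e3 : (∫ x in Ω, ρ x * (n * (Y x - R x) * ψ x)) + (∫ x in Ω, ρ x * (G x * (Y x - R x))) =
      ∫ x in Ω, ρ x * (G x * Y x + ω x * ψ x) := by
    have a1 : (∫ x in Ω, ρ x * (n * (Y x - R x) * ψ x)) =
        (∫ x in Ω, ρ x * ((n * (Y x - R x) - ω x) * ψ x)) + ∫ x in Ω, ρ x * (ω x * ψ x) := by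
      rw [← integral_add (I (((EssBdd.const n).mul (hY'.sub hR')).sub hω' |>.mul hψb)) (I (hω'.mul hψb))]
      exact integral_congr_ae (ae_of_all _ fun x => by ring)
    rw [a1, ← e1, ← integral_add (I (hG'.mul hR')) (I (hω'.mul hψb)),
      ← integral_add ((I (hG'.mul hR')).fun_add (I (hω'.mul hψb))) (I (hG'.mul (hY'.sub hR')))]
    exact integral_congr_ae (ae_of_all _ fun x => by ring)
  have e4 : -(∫ x in Ω, ρ x * (G x * (Y x - R x))) ≤ B * ∫ x in Ω, ρ x * (Y x - R x) := by
    rw [← integral_neg, ← integral_const_mul]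
    refine integral_mono_ae (I (hG'.mul (hY'.sub hR'))).neg ((I (hY'.sub hR')).const_mul _) ?_
    filter_upwards [hle, hGb, hρ.nonneg] with x h1 h2 h3
    have h4 := mul_nonneg h3 (sub_nonneg.2 h1)
    have h5 := mul_le_mul_of_nonneg_left (neg_le.1 (neg_le_of_abs_le h2)) h4
    linarith only [h5]
  have hn1 : n⁻¹ ≤ 1 := inv_le_one_of_one_le₀ hn
  have hni : 0 < n⁻¹ := by positivity
  have hωn : ∀ᵐ x ∂(volume.restrict Ω), (ω x / n) ^ 2 ≤ M ^ 2 * n⁻¹ := by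
    filter_upwards [hωb] with x hx
    have h1 : ω x ^ 2 ≤ M ^ 2 := sq_le_sq.2 (by rwa [abs_of_nonneg hM])
    rw [div_pow, div_eq_mul_inv]
    refine mul_le_mul h1 ?_ (by positivity) (by positivity)
    rw [_root_.sq, mul_inv]; exact mul_le_of_le_one_right hni.le hn1
  obtain ⟨T, hT⟩ : ∃ T, T = ∫ x in Ω, ρ x := ⟨_, rfl⟩
  have e5 : ∫ x in Ω, ρ x * (Y x - R x) ≤ s * T + 1 / (2 * s) *
      ((∫ x in Ω, ρ x * (R x - (Y x - ω x / n)) ^ 2) + M ^ 2 * n⁻¹ * T) := by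
    have i1 := I ((hR'.sub hF').sq)
    rw [hT, ← integral_const_mul, ← integral_const_mul (M ^ 2 * n⁻¹), ← integral_add i1 (hρ.integrable.const_mul _),
      ← integral_const_mul, ← integral_add (hρ.integrable.const_mul _) ((i1.fun_add (hρ.integrable.const_mul _)).const_mul _)]
    refine integral_mono_ae (I (hY'.sub hR')) ((hρ.integrable.const_mul _).add ((i1.fun_add (hρ.integrable.const_mul _)).const_mul _)) ?_
    filter_upwards [hωn, hρ.nonneg] with x h1 h3
    have h4 : Y x - R x ≤ s + 1 / (2 * s) * ((R x - (Y x - ω x / n)) ^ 2 + M ^ 2 * n⁻¹) := by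
      obtain ⟨a, ha⟩ : ∃ a, a = ω x / n := ⟨_, rfl⟩
      rw [← ha] at h1 ⊢
      rw [one_div, inv_mul_eq_div, ← sub_le_iff_le_add', le_div_iff₀ (by positivity)]
      have := sq_nonneg (Y x - R x - 2 * s)
      have := sq_nonneg (R x - Y x + 2 * a)
      have := _root_.sq_nonneg s
      linarith
    have h5 := mul_le_mul_of_nonneg_left h4 h3
    linarith only [h5]
  have e6 : ∫ x in Ω, ρ x * (R x - (Y x - ω x / n)) ^ 2 ≤ n⁻¹ * (∫ x in Ω, ‖gradient φ x‖ ^ 2) +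
      (2 * (∫ x in Ω, ρ x * (φ x - Y x) ^ 2) + 2 * (M ^ 2 * n⁻¹ * T)) := by
    have a1 := hRen φ hφ
    simp only [mul_assoc, integral_const_mul] at a1
    have a2 : ∫ x in Ω, ρ x * (φ x - (Y x - ω x / n)) ^ 2 ≤
        2 * (∫ x in Ω, ρ x * (φ x - Y x) ^ 2) + 2 * (M ^ 2 * n⁻¹ * T) := by
      have i1 := I ((hφ'.sub hY').sq)
      rw [hT, ← integral_const_mul, ← integral_const_mul (M ^ 2 * n⁻¹), ← integral_const_mul, ← integral_add (i1.const_mul _) ((hρ.integrable.const_mul _).const_mul _)]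
      refine integral_mono_ae (I ((hφ'.sub hF').sq)) ((i1.const_mul _).add ((hρ.integrable.const_mul _).const_mul _)) ?_
      filter_upwards [hωn, hρ.nonneg] with x h1 h3
      have h4 : (φ x - (Y x - ω x / n)) ^ 2 ≤ 2 * (φ x - Y x) ^ 2 + 2 * (M ^ 2 * n⁻¹) := by
        obtain ⟨a, ha⟩ : ∃ a, a = ω x / n := ⟨_, rfl⟩
        rw [← ha] at h1 ⊢
        have := sq_nonneg (φ x - Y x - a)
        linarith
      have h5 := mul_le_mul_of_nonneg_left h4 h3
      linarith only [h5]
    have a3 := mul_le_mul_of_nonneg_left a1 hni.le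
    rw [mul_add, inv_mul_cancel_left₀ hn0.ne', inv_mul_cancel_left₀ hn0.ne'] at a3
    linarith
  rw [← e3, ← hT]
  have e7 := e5.trans (add_le_add_right (mul_le_mul_of_nonneg_left (add_le_add_left e6 (M ^ 2 * n⁻¹ * T)) (by positivity : 0 ≤ 1 / (2 * s))) _)
  have e8 := mul_le_mul_of_nonneg_left e7 hB
  refine le_trans ?_ (e8.trans (le_of_eq (by ring)))
  linarith

/-- Comparison tested against a weak solution `ψ` of `-Δψ = ρG`. -/
lemma weak_comparison (hN : 3 ≤ N) (h : SmoothDom D Ω) (hρ : Weight ρ Ω) {Y ω : Eu N → ℝ}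
    (hY' : EssBdd (volume.restrict Ω) Y) (hω' : EssBdd (volume.restrict Ω) ω)
    (hY : ∀ ζ, Adm D Ω ζ → 0 ≤ ∫ x in Ω, (Y x * -lap ζ x + ρ x * (ω x * ζ x)))
    {ψ G : Eu N → ℝ} {g : Eu N → Eu N} (hψ : H01 (weighted ρ Ω) Ω ψ g)
    (hψb : EssBdd (volume.restrict Ω) ψ) (hψ0 : ∀ᵐ x ∂(volume.restrict Ω), 0 ≤ ψ x)
    (hG' : EssBdd (volume.restrict Ω) G)
    (hG : ∀ χ gχ, H01 (weighted ρ Ω) Ω χ gχ →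
      ∫ x in Ω, inner ℝ (g x) (gχ x) = ∫ x in Ω, ρ x * (G x * χ x)) :
    0 ≤ ∫ x in Ω, ρ x * (G x * Y x + ω x * ψ x) := by
  have := hρ.isFiniteMeasure
  obtain ⟨hYm, M₁, hM₁, hYb⟩ := hY'
  obtain ⟨hωm, M₂, hM₂, hωb⟩ := hω'
  obtain ⟨hGm, B, hB, hGb⟩ := hG'
  have hM : 0 ≤ max M₁ M₂ := hM₁.trans (le_max_left _ _)
  have key := fun (n s : ℝ) (hn : 1 ≤ n) (hs : 0 < s) (φ : Eu N → ℝ) (hφ : TestFn Ω φ) =>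
    weak_comparison_of_testFn hN h hρ hM hYm hωm
    (hYb.mono fun x hx => hx.trans (le_max_left _ _)) (hωb.mono fun x hx => hx.trans (le_max_right _ _)) hY
    hψ hψb hψ0 hB hGm hGb hG hn hs hφ
  obtain ⟨T, hT⟩ : ∃ T, T = ∫ x in Ω, ρ x := ⟨_, rfl⟩
  obtain ⟨J, hJ⟩ : ∃ J, J = ∫ x in Ω, ρ x * (G x * Y x + ω x * ψ x) := ⟨_, rfl⟩
  rw [← hT, ← hJ] at key
  rw [← hJ]
  have key2 : ∀ s : ℝ, 0 < s → -J ≤ B * (s * (T + 1)) := fun s hs => by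
    obtain ⟨φ, hφ, hφY⟩ := exists_testFn_close h (ν := weighted ρ Ω) h.ae_weighted (f := Y) (ε := s ^ 2)
      (MemLp.of_bound (hYm.mono_ac weighted_ac) M₁ (weighted_ac hYb)) (by positivity)
    rw [hρ.integral_weighted] at hφY
    have lim : Tendsto (fun n : ℝ => B * (s * T + 1 / (2 * s) *
      (n⁻¹ * (∫ x in Ω, ‖gradient φ x‖ ^ 2) + 2 * (∫ x in Ω, ρ x * (φ x - Y x) ^ 2) +
        3 * (max M₁ M₂) ^ 2 * T * n⁻¹))) atTop (𝓝 (B * (s * T + 1 / (2 * s) *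
      (0 * (∫ x in Ω, ‖gradient φ x‖ ^ 2) + 2 * (∫ x in Ω, ρ x * (φ x - Y x) ^ 2) +
        3 * (max M₁ M₂) ^ 2 * T * 0)))) :=
      ((((tendsto_inv_atTop_zero.mul_const _).add_const _).add (tendsto_inv_atTop_zero.const_mul _)).const_mul _
        |>.const_add _).const_mul _
    have h1 := ge_of_tendsto lim ((eventually_ge_atTop 1).mono fun n hn => key n s hn hs φ hφ)
    refine h1.trans (mul_le_mul_of_nonneg_left ?_ hB)
    rw [zero_mul, mul_zero, zero_add, add_zero]
    have h2 : 1 / (2 * s) * (2 * (∫ x in Ω, ρ x * (φ x - Y x) ^ 2)) ≤ 1 / (2 * s) * (2 * s ^ 2) :=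
      mul_le_mul_of_nonneg_left (by linarith) (by positivity)
    have h3 : 1 / (2 * s) * (2 * s ^ 2) = s := by field_simp
    linarith
  have lim : Tendsto (fun s : ℝ => B * (s * (T + 1))) (𝓝[>] 0) (𝓝 (B * (0 * (T + 1)))) :=
    ((tendsto_id.mono_left nhdsWithin_le_nhds).mul_const _).const_mul _
  have := ge_of_tendsto lim (eventually_mem_nhdsWithin.mono fun s hs => key2 s hs)
  linarith
end
end

section
variable {N : ℕ}
section
variable {D : Eu N → ℝ} {Ω : Set (Eu N)} {ρ : Eu N → ℝ}

lemma MemLp.integrable_inner_two {μ : Measure (Eu N)} {f g : Eu N → Eu N} (hf : MemLp f 2 μ) (hg : MemLp g 2 μ) :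
    Integrable (fun x => inner ℝ (f x) (g x)) μ := by
  refine (hf.norm.integrable_mul hg.norm).mono' (hf.1.inner hg.1) (ae_of_all _ fun x => ?_)
  exact norm_inner_le_norm _ _

lemma duality_step (hN : 3 ≤ N) (h : SmoothDom D Ω) (hρ : Weight ρ Ω) {b P P' Z : Eu N → ℝ}
    (hb : Measurable b) {c₁ c₂ : ℝ} (hc₁ : 0 < c₁) (hbc : ∀ x, c₁ ≤ b x ∧ b x ≤ c₂)
    (hP : EssBdd (volume.restrict Ω) P) (hP' : EssBdd (volume.restrict Ω) P')
    (hZ : EssBdd (volume.restrict Ω) Z)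
    (hY : ∀ ζ, Adm D Ω ζ → 0 ≤ ∫ x in Ω, (-Z x * -lap ζ x + ρ x * ((P x - P' x) * ζ x)))
    {C lam : ℝ} (hlam : 0 < lam) {ψ' : Eu N → ℝ} {g' : Eu N → Eu N} (hψ' : H01 (weighted ρ Ω) Ω ψ' g')
    (hψm : AEStronglyMeasurable ψ' (volume.restrict Ω)) (hC : 0 ≤ C)
    (hψb : ∀ᵐ x ∂(volume.restrict Ω), 0 ≤ ψ' x ∧ ψ' x ≤ C) :
    ∃ ψ g, H01 (weighted ρ Ω) Ω ψ g ∧ AEStronglyMeasurable ψ (volume.restrict Ω) ∧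
      (∀ᵐ x ∂(volume.restrict Ω), 0 ≤ ψ x ∧ ψ x ≤ C) ∧
      ∫ x in Ω, ρ x * (P' x * ψ' x) ≤ (∫ x in Ω, ρ x * (P x * ψ x)) +
        lam / 4 * ((∫ x in Ω, ‖g' x‖ ^ 2) - ∫ x in Ω, ‖g x‖ ^ 2) +
        1 / (2 * lam) * ∫ x in Ω, ρ x * (b x * (P' x / b x - Z x) ^ 2) := by
  have := h.isFiniteMeasure
  have hb0 : ∀ x, 0 < b x := fun x => hc₁.trans_le (hbc x).1
  have hc₂ : 0 ≤ c₂ := (hb0 0).le.trans (hbc 0).2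
  obtain ⟨ψ, g, hψ, hm, hbd, heq, -⟩ := hρ.exists_resolvent h hb hc₁ hbc le_rfl hC hψm hψb
  refine ⟨ψ, g, hψ, hm.aestronglyMeasurable, ae_of_all _ hbd, ?_⟩
  have bψ : EssBdd (volume.restrict Ω) ψ := .of_bound (C := C) hm.aestronglyMeasurable
    (ae_of_all _ fun x => by rw [abs_of_nonneg (hbd x).1]; exact (hbd x).2)
  have bψ' : EssBdd (volume.restrict Ω) ψ' := .of_bound (C := C) hψm
    (hψb.mono fun x hx => by rw [abs_of_nonneg hx.1]; exact hx.2)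
  have bb : EssBdd (volume.restrict Ω) b := .of_bound (C := c₂) hb.aestronglyMeasurable
    (ae_of_all _ fun x => by rw [abs_of_pos (hb0 x)]; exact (hbc x).2)
  have bi : EssBdd (volume.restrict Ω) (fun x => (b x)⁻¹) := .of_bound (C := c₁⁻¹) hb.inv.aestronglyMeasurable
    (ae_of_all _ fun x => by
      rw [abs_of_pos (inv_pos.2 (hb0 x))]; exact inv_anti₀ hc₁ (hbc x).1)
  have bG : EssBdd (volume.restrict Ω) (fun x => b x * (ψ' x - ψ x)) := bb.mul (bψ'.sub bψ)
  have I : ∀ {f : Eu N → ℝ}, EssBdd (volume.restrict Ω) f → IntegrableOn (fun x => ρ x * f x) Ω :=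
    fun hf => EssBdd.integrable_mul hρ.integrable hf
  have hG : ∀ χ gχ, H01 (weighted ρ Ω) Ω χ gχ →
      ∫ x in Ω, inner ℝ (g x) (gχ x) = ∫ x in Ω, ρ x * (b x * (ψ' x - ψ x) * χ x) := fun χ gχ hχ => by
    rw [heq χ gχ hχ]
    exact integral_congr_ae (ae_of_all _ fun x => by ring)
  have hcmp := weak_comparison hN h hρ hZ.neg (hP.sub hP') hY hψ bψ (ae_of_all _ fun x => (hbd x).1) bG hG
  have hen : ∫ x in Ω, ρ x * (b x * (ψ' x - ψ x) ^ 2) ≤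
      1 / 2 * ((∫ x in Ω, ‖g' x‖ ^ 2) - ∫ x in Ω, ‖g x‖ ^ 2) := by
    have e1 : ∫ x in Ω, ρ x * (b x * (ψ' x - ψ x) ^ 2) =
        (∫ x in Ω, inner ℝ (g x) (g' x)) - ∫ x in Ω, inner ℝ (g x) (g x) := by
      rw [hG _ _ hψ', hG _ _ hψ, ← integral_sub (I (bG.mul bψ')) (I (bG.mul bψ))]
      exact integral_congr_ae (ae_of_all _ fun x => by ring)
    have i1 : Integrable (fun x => inner ℝ (g x) (g' x)) (volume.restrict Ω) :=
      MemLp.integrable_inner_two hψ.memLp_grad hψ'.memLp_grad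
    have i2 : Integrable (fun x => inner ℝ (g x) (g x)) (volume.restrict Ω) :=
      MemLp.integrable_inner_two hψ.memLp_grad hψ.memLp_grad
    have i3 : Integrable (fun x => ‖g x‖ ^ 2) (volume.restrict Ω) := hψ.memLp_grad.integrable_norm_pow (by norm_num)
    have i4 : Integrable (fun x => ‖g' x‖ ^ 2) (volume.restrict Ω) := hψ'.memLp_grad.integrable_norm_pow (by norm_num)
    rw [e1, ← integral_sub i1 i2, ← integral_sub i4 i3, ← integral_const_mul]
    refine integral_mono (i1.sub i2) ((i4.sub i3).const_mul _) fun x => ?_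
    have := real_inner_le_norm (g x) (g' x)
    have := sq_nonneg (‖g x‖ - ‖g' x‖)
    simp only [real_inner_self_eq_norm_sq]
    linarith
  have e2 : ∫ x in Ω, ρ x * (b x * (ψ' x - ψ x) * -Z x + (P x - P' x) * ψ x) =
      (∫ x in Ω, ρ x * (P x * ψ x)) - (∫ x in Ω, ρ x * (P' x * ψ' x)) +
        ∫ x in Ω, ρ x * ((ψ' x - ψ x) * (P' x - b x * Z x)) := by
    have j1 := I (hP.mul bψ)
    have j2 := I (hP'.mul bψ')
    rw [← integral_sub j1 j2, ← integral_add (j1.fun_sub j2) (I ((bψ'.sub bψ).mul (hP'.sub (bb.mul hZ))))]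
    exact integral_congr_ae (ae_of_all _ fun x => by ring)
  have e3 : ∫ x in Ω, ρ x * ((ψ' x - ψ x) * (P' x - b x * Z x)) ≤
      lam / 2 * (∫ x in Ω, ρ x * (b x * (ψ' x - ψ x) ^ 2)) +
        1 / (2 * lam) * ∫ x in Ω, ρ x * (b x * (P' x / b x - Z x) ^ 2) := by
    have j1 := I (bb.mul (bψ'.sub bψ).sq)
    have j2 : IntegrableOn (fun x => ρ x * (b x * (P' x / b x - Z x) ^ 2)) Ω := by
      simp only [div_eq_mul_inv]
      exact I (bb.mul ((hP'.mul bi).sub hZ).sq)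
    rw [← integral_const_mul, ← integral_const_mul, ← integral_add (j1.const_mul _) (j2.const_mul _)]
    refine integral_mono_ae (I ((bψ'.sub bψ).mul (hP'.sub (bb.mul hZ)))) ((j1.const_mul _).fun_add (j2.const_mul _)) ?_
    filter_upwards [hρ.nonneg] with x hx
    obtain ⟨q, hq⟩ : ∃ q, q = P' x / b x - Z x := ⟨_, rfl⟩
    have hq' : P' x - b x * Z x = b x * q := by
      rw [hq, mul_sub, mul_div_cancel₀ _ (hb0 x).ne']
    rw [hq', ← hq]
    have h1 : (ψ' x - ψ x) * q ≤ lam / 2 * (ψ' x - ψ x) ^ 2 + 1 / (2 * lam) * q ^ 2 := by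
      rw [one_div, inv_mul_eq_div, ← sub_le_iff_le_add', le_div_iff₀ (by positivity)]
      have := sq_nonneg (lam * (ψ' x - ψ x) - q)
      linarith
    have h2 := mul_le_mul_of_nonneg_left h1 (mul_nonneg hx (hb0 x).le)
    linarith only [h2]
  rw [e2] at hcmp
  have h5 := mul_le_mul_of_nonneg_left hen (by positivity : 0 ≤ lam / 2)
  linarith

lemma duality_sum (hN : 3 ≤ N) (h : SmoothDom D Ω) (hρ : Weight ρ Ω) {b P Z : ℕ → Eu N → ℝ}
    (hb : ∀ k, Measurable (b k)) {c₁ c₂ : ℝ} (hc₁ : 0 < c₁) (hbc : ∀ k x, c₁ ≤ b k x ∧ b k x ≤ c₂)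
    (hP0 : ∀ x, P 0 x = 0)
    (hP : ∀ k, EssBdd (volume.restrict Ω) (P k)) (hZ : ∀ k, EssBdd (volume.restrict Ω) (Z k)) {C lam : ℝ} (hlam : 0 < lam) (hC : 0 ≤ C) (K : ℕ)
    (hY : ∀ k < K, ∀ ζ, Adm D Ω ζ →
      0 ≤ ∫ x in Ω, (-Z k x * -lap ζ x + ρ x * ((P k x - P (k + 1) x) * ζ x)))
    {ψ : Eu N → ℝ} {g : Eu N → Eu N} (hψ : H01 (weighted ρ Ω) Ω ψ g)
    (hψm : AEStronglyMeasurable ψ (volume.restrict Ω))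
    (hψb : ∀ᵐ x ∂(volume.restrict Ω), 0 ≤ ψ x ∧ ψ x ≤ C) :
    ∫ x in Ω, ρ x * (P K x * ψ x) ≤ lam / 4 * (∫ x in Ω, ‖g x‖ ^ 2) +
        1 / (2 * lam) * ∑ k ∈ Finset.range K, ∫ x in Ω, ρ x * (b k x * (P (k + 1) x / b k x - Z k x) ^ 2) := by
  induction K generalizing ψ g with
  | zero =>
    simp only [hP0, zero_mul, mul_zero, integral_zero, Finset.range_zero, Finset.sum_empty, add_zero]
    have : 0 ≤ ∫ x in Ω, ‖g x‖ ^ 2 := integral_nonneg fun x => by positivity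
    positivity
  | succ K ih =>
    obtain ⟨ψ₁, g₁, h1, h2, h3, h4⟩ := duality_step hN h hρ (hb K) hc₁ (hbc K) (hP K) (hP (K + 1)) (hZ K)
      (hY K (Nat.lt_succ_self K)) hlam hψ hψm hC hψb
    have h5 := ih (fun k hk => hY k (hk.trans (Nat.lt_succ_self K))) h1 h2 h3
    rw [Finset.sum_range_succ]
    linarith
end
end

section
section

/-- A smooth monotone step rising from `0` to `1` on `[c, c + h]`. -/
def ramp (c h t : ℝ) : ℝ := Real.smoothTransition ((t - c) / h)

variable {c h t : ℝ}

lemma ramp_nonneg : 0 ≤ ramp c h t := Real.smoothTransition.nonneg _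

lemma ramp_le_one : ramp c h t ≤ 1 := Real.smoothTransition.le_one _

lemma ramp_of_le (hh : 0 < h) (ht : t ≤ c) : ramp c h t = 0 :=
  Real.smoothTransition.zero_of_nonpos (div_nonpos_of_nonpos_of_nonneg (by linarith) hh.le)

lemma ramp_of_ge (hh : 0 < h) (ht : c + h ≤ t) : ramp c h t = 1 :=
  Real.smoothTransition.one_of_one_le ((one_le_div hh).2 (by linarith))

lemma contDiff_ramp {n : ℕ∞} : ContDiff ℝ n (ramp c h) :=
  Real.smoothTransition.contDiff.comp ((contDiff_id.sub contDiff_const).div_const h)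

lemma continuous_ramp : Continuous (ramp c h) := (contDiff_ramp (n := 0)).continuous

lemma hasDerivAt_ramp : HasDerivAt (ramp c h) (deriv Real.smoothTransition ((t - c) / h) / h) t := by
  have h1 : HasDerivAt (fun t : ℝ => (t - c) / h) (1 / h) t := ((hasDerivAt_id t).sub_const c).div_const h
  have := (differentiable_smoothTransition ((t - c) / h)).hasDerivAt.comp t h1
  rwa [mul_one_div] at this

lemma deriv_ramp : deriv (ramp c h) t = deriv Real.smoothTransition ((t - c) / h) / h := hasDerivAt_ramp.deriv

lemma continuous_deriv_ramp : Continuous (deriv (ramp c h)) :=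
  (contDiff_ramp (n := 1)).continuous_deriv (by norm_num)

lemma deriv_ramp_nonneg (hh : 0 < h) : 0 ≤ deriv (ramp c h) t := by
  rw [deriv_ramp]; exact div_nonneg (deriv_smoothTransition_nonneg _) hh.le

lemma deriv_ramp_eq_zero (hh : 0 < h) (ht : t ∉ Ioc c (c + h)) : deriv (ramp c h) t = 0 := by
  rw [deriv_ramp]
  rcases le_or_gt t c with h1 | h1
  · rw [deriv_smoothTransition_of_nonpos (div_nonpos_of_nonpos_of_nonneg (by linarith) hh.le), zero_div]
  · have : c + h < t := by by_contra h2; exact ht ⟨h1, not_lt.1 h2⟩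
    rw [deriv_smoothTransition_of_one_le ((one_le_div hh).2 (by linarith)), zero_div]

lemma integrable_deriv_ramp (hh : 0 < h) : Integrable (deriv (ramp c h)) :=
  continuous_deriv_ramp.integrable_of_hasCompactSupport
    (HasCompactSupport.intro isCompact_Icc fun _ hx => deriv_ramp_eq_zero hh fun h' => hx (Ioc_subset_Icc_self h'))

lemma integral_deriv_ramp (hh : 0 < h) : ∫ t, deriv (ramp c h) t = 1 := by
  have := integral_of_hasDerivAt_of_tendsto (f := ramp c h) (f' := deriv (ramp c h)) (m := 0) (n := 1)
    (fun t => hasDerivAt_ramp.differentiableAt.hasDerivAt) (integrable_deriv_ramp hh)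
    (tendsto_const_nhds.congr' ((eventually_le_atBot c).mono fun t ht => (ramp_of_le hh ht).symm))
    (tendsto_const_nhds.congr' ((eventually_ge_atTop (c + h)).mono fun t ht => (ramp_of_ge hh ht).symm))
  rw [this, sub_zero]

lemma ramp_sub_nonneg {c' h' : ℝ} (hh : 0 < h) (hh' : 0 < h') (hc : c + h ≤ c') : 0 ≤ ramp c h t - ramp c' h' t := by
  rcases le_total t c' with h1 | h1
  · rw [ramp_of_le hh' h1, sub_zero]; exact ramp_nonneg
  · rw [ramp_of_ge hh (hc.trans h1), sub_nonneg]; exact ramp_le_one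

lemma ramp_sub_eq_zero {c' h' : ℝ} (hh : 0 < h) (hh' : 0 < h') (hc : c + h ≤ c') (ht : t ∉ Ioc c (c' + h')) :
    ramp c h t - ramp c' h' t = 0 := by
  rcases le_or_gt t c with h1 | h1
  · rw [ramp_of_le hh h1, ramp_of_le hh' (by linarith), sub_zero]
  · have : c' + h' < t := by by_contra h2; exact ht ⟨h1, not_lt.1 h2⟩
    rw [ramp_of_ge hh (by linarith), ramp_of_ge hh' this.le, sub_self]

lemma integral_ramp_sub {c' : ℝ} (hh : 0 < h) (hc : c + h = c') : ∫ t, (ramp c h t - ramp c' h t) = h := by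
  have hi : ∀ c a b : ℝ, IntervalIntegrable (ramp c h) volume a b := fun c a b => continuous_ramp.intervalIntegrable _ _
  rw [← intervalIntegral.integral_eq_integral_of_support_subset (a := c) (b := c' + h)
    fun t ht => by_contra fun h' => ht (ramp_sub_eq_zero hh hh hc.le h'), intervalIntegral.integral_sub (hi _ _ _) (hi _ _ _)]
  have e : ∫ t in c..c' + h, ramp c' h t = ∫ t in c - h..c' + h - h, ramp c h t := by
    rw [← intervalIntegral.integral_comp_sub_right]
    refine intervalIntegral.integral_congr fun t _ => ?_
    simp only [ramp]; congr 2; linarith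
  rw [e, intervalIntegral.integral_interval_sub_interval_comm' (hi _ _ _) (hi _ _ _) (hi _ _ _)]
  have e1 : ∫ t in c' + h - h..c' + h, ramp c h t = ∫ t in c' + h - h..c' + h, (1 : ℝ) :=
    intervalIntegral.integral_congr fun t ht => by
      rw [uIcc_of_le (by linarith)] at ht
      exact ramp_of_ge hh (by linarith [ht.1])
  have e2 : ∫ t in c - h..c, ramp c h t = ∫ t in c - h..c, (0 : ℝ) :=
    intervalIntegral.integral_congr fun t ht => by
      rw [uIcc_of_le (by linarith)] at ht
      exact ramp_of_le hh ht.2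
  rw [e1, e2]
  simp
end
section

/-- Lebesgue points of a function of one real variable. -/
def IsLebesguePt (f : ℝ → ℝ) (t : ℝ) : Prop :=
  ∀ δ : ℕ → ℝ, Tendsto δ atTop (𝓝[>] 0) →
    Tendsto (fun j => ⨍ y in closedBall t (δ j), ‖f y - f t‖) atTop (𝓝 0)

lemma ae_isLebesguePt {f : ℝ → ℝ} (hf : LocallyIntegrable f) : ∀ᵐ t, IsLebesguePt f t := by
  filter_upwards [IsUnifLocDoublingMeasure.ae_tendsto_average_norm_sub volume hf 1] with t ht δ hδ
  refine ht (fun _ => t) δ hδ ?_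
  filter_upwards [hδ.eventually eventually_mem_nhdsWithin] with j hj
  exact mem_closedBall_self (by rw [one_mul]; exact (le_of_lt hj))

/-- Approximate identities of arbitrary shape converge at Lebesgue points. -/
lemma IsLebesguePt.tendsto {f : ℝ → ℝ} {t : ℝ} (h : IsLebesguePt f t) (hf : LocallyIntegrable f)
    {κ : ℕ → ℝ → ℝ} {δ : ℕ → ℝ} {C : ℝ} (hδ : Tendsto δ atTop (𝓝[>] 0))
    (hκc : ∀ n, Continuous (κ n)) (hκ0 : ∀ᶠ n in atTop, ∀ y, 0 ≤ κ n y)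
    (hκC : ∀ᶠ n in atTop, ∀ y, κ n y ≤ C / δ n)
    (hκs : ∀ᶠ n in atTop, ∀ y, y ∉ closedBall t (δ n) → κ n y = 0)
    (hκ1 : ∀ᶠ n in atTop, ∫ y, κ n y = 1) :
    Tendsto (fun n => ∫ y, f y * κ n y) atTop (𝓝 (f t)) := by
  rw [tendsto_iff_norm_sub_tendsto_zero]
  refine squeeze_zero' (Eventually.of_forall fun n => norm_nonneg _) ?_
    (by simpa using (h δ hδ).const_mul (2 * C))
  filter_upwards [hκ0, hκC, hκs, hκ1, hδ.eventually eventually_mem_nhdsWithin] with n h0 hC hs h1 hpos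
  have hpos : 0 < δ n := hpos
  have hcs : HasCompactSupport (κ n) := HasCompactSupport.intro (isCompact_closedBall t (δ n)) hs
  have i1 : Integrable (fun y => f y * κ n y) := by
    simpa only [smul_eq_mul, mul_comm] using hf.integrable_smul_left_of_hasCompactSupport (hκc n) hcs
  have i2 : Integrable (κ n) := (hκc n).integrable_of_hasCompactSupport hcs
  have e1 : (∫ y, f y * κ n y) - f t = ∫ y in closedBall t (δ n), (f y - f t) * κ n y := by
    rw [setIntegral_eq_integral_of_forall_compl_eq_zero fun y hy => by rw [hs y hy, mul_zero]]
    calc _ = (∫ y, f y * κ n y) - ∫ y, f t * κ n y := by rw [integral_const_mul, h1, mul_one]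
      _ = _ := by rw [← integral_sub i1 (i2.const_mul _)]; exact integral_congr_ae (ae_of_all _ fun y => by ring)
  have i3 : IntegrableOn (fun y => ‖f y - f t‖) (closedBall t (δ n)) :=
    ((hf.integrableOn_isCompact (isCompact_closedBall t (δ n))).sub
      (integrableOn_const (isCompact_closedBall t (δ n)).measure_lt_top.ne)).norm
  have e2 : ‖∫ y in closedBall t (δ n), (f y - f t) * κ n y‖ ≤ ∫ y in closedBall t (δ n), ‖f y - f t‖ * (C / δ n) := by
    refine norm_integral_le_of_norm_le (i3.mul_const _) (ae_of_all _ fun y => ?_)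
    rw [norm_mul, Real.norm_of_nonneg (h0 y)]
    exact mul_le_mul_of_nonneg_left (hC y) (norm_nonneg _)
  rw [e1]
  refine e2.trans (le_of_eq ?_)
  rw [integral_mul_const, setAverage_eq, smul_eq_mul, measureReal_def, Real.volume_closedBall,
    ENNReal.toReal_ofReal (by positivity)]
  simp only [Real.norm_eq_abs]
  field_simp

/-- Riemann sums as integrals of step functions. -/
lemma integral_floor {a h : ℝ} (hh : 0 < h) (f : ℕ → ℝ) (K : ℕ) :
    ∫ t in a..a + K * h, f ⌊(t - a) / h⌋₊ = ∑ k ∈ Finset.range K, h * f k := by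
  have e : ∀ k : ℕ, EqOn (fun _ => f k) (fun t => f ⌊(t - a) / h⌋₊) (Ioo (a + k * h) (a + (k + 1 : ℕ) * h)) :=
    fun k t ht => by
      push_cast at ht
      have : ⌊(t - a) / h⌋₊ = k := by
        rw [Nat.floor_eq_iff (div_nonneg (by nlinarith [ht.1, mul_nonneg k.cast_nonneg hh.le]) hh.le), le_div_iff₀ hh, div_lt_iff₀ hh]
        constructor <;> linarith [ht.1, ht.2]
      simp only [this]
  have hle : ∀ k : ℕ, a + k * h ≤ a + (k + 1 : ℕ) * h := fun k => by push_cast; linarith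
  have hae : ∀ k : ℕ, ∀ᵐ t, t ∈ uIoc (a + k * h) (a + (k + 1 : ℕ) * h) → f k = f ⌊(t - a) / h⌋₊ := fun k => by
    filter_upwards [Measure.ae_ne volume (a + (k + 1 : ℕ) * h)] with t ht ht'
    rw [uIoc_of_le (hle k)] at ht'
    exact e k ⟨ht'.1, lt_of_le_of_ne ht'.2 ht⟩
  have e0 : a = a + ((0 : ℕ) : ℝ) * h := by simp
  rw [show (∫ t in a..a + K * h, f ⌊(t - a) / h⌋₊) = ∫ t in a + ((0 : ℕ) : ℝ) * h..a + K * h, f ⌊(t - a) / h⌋₊ by rw [← e0],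
    ← intervalIntegral.sum_integral_adjacent_intervals (a := fun k : ℕ => a + k * h)]
  · refine Finset.sum_congr rfl fun k _ => ?_
    rw [← intervalIntegral.integral_congr_ae (hae k), intervalIntegral.integral_const]
    push_cast
    rw [smul_eq_mul]; ring
  · intro k _
    exact (intervalIntegrable_const (c := f k)).congr_ae ((ae_restrict_iff' measurableSet_uIoc).2 (hae k))
end
end

section
section

lemma abs_integral_le_of_support {f : ℝ → ℝ} {C c d : ℝ} (hcd : c ≤ d) (h1 : ∀ t, |f t| ≤ C)
    (h2 : ∀ t, t ∉ Ioc c d → f t = 0) : |∫ t, f t| ≤ C * (d - c) := by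
  rw [← setIntegral_eq_integral_of_forall_compl_eq_zero h2]
  have := norm_setIntegral_le_of_norm_le_const (μ := volume) (s := Ioc c d) (f := f) (C := C)
    measure_Ioc_lt_top fun t _ => h1 t
  rwa [Real.volume_real_Ioc_of_le hcd] at this

/-- The time steps of the discretization: `1` followed by ramps on consecutive intervals. -/
def rise (τ h : ℝ) : ℕ → ℝ → ℝ
  | 0 => fun _ => 1
  | k + 1 => ramp (τ + k * h) h

variable {τ h : ℝ}

lemma contDiff_rise {n : ℕ∞} (k : ℕ) : ContDiff ℝ n (rise τ h k) := by
  cases k with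
  | zero => exact contDiff_const
  | succ k => exact contDiff_ramp

lemma continuous_rise (k : ℕ) : Continuous (rise τ h k) := (contDiff_rise (n := 0) k).continuous

lemma rise_of_ge (hh : 0 < h) (k : ℕ) {t : ℝ} (ht : τ + k * h ≤ t) : rise τ h k t = 1 := by
  cases k with
  | zero => rfl
  | succ k => exact ramp_of_ge hh (by push_cast at ht; linarith)

lemma rise_nonneg (k : ℕ) (t : ℝ) : 0 ≤ rise τ h k t := by
  cases k with
  | zero => exact zero_le_one
  | succ k => exact ramp_nonneg

lemma rise_le_one (k : ℕ) (t : ℝ) : rise τ h k t ≤ 1 := by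
  cases k with
  | zero => exact le_rfl
  | succ k => exact ramp_le_one

lemma rise_sub_ramp_nonneg (hh : 0 < h) {h' c : ℝ} (hh' : 0 < h') (k : ℕ) (hc : τ + k * h ≤ c) (t : ℝ) :
    0 ≤ rise τ h k t - ramp c h' t := by
  cases k with
  | zero => exact sub_nonneg.2 ramp_le_one
  | succ k => exact ramp_sub_nonneg hh hh' (by push_cast at hc; linarith)

lemma rise_sub_ramp_eq_zero (hh : 0 < h) {h' c : ℝ} (hh' : 0 < h') (k : ℕ) (hc : τ + k * h ≤ c) {t : ℝ} (hτ : τ < t)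
    (ht : t ∉ Ioc (τ + (k - 1) * h) (c + h')) : rise τ h k t - ramp c h' t = 0 := by
  cases k with
  | zero =>
    have : c + h' < t := by
      by_contra h2
      exact ht ⟨by push_cast; linarith, not_lt.1 h2⟩
    rw [ramp_of_ge hh' this.le, rise, sub_self]
  | succ k =>
    push_cast at hc ht
    rw [add_sub_cancel_right] at ht
    exact ramp_sub_eq_zero hh hh' (by linarith) ht

lemma abs_rise_sub_ramp_le {h' c : ℝ} (k : ℕ) (t : ℝ) : |rise τ h k t - ramp c h' t| ≤ 1 :=
  abs_sub_le_iff.2 ⟨by linarith [rise_le_one (τ := τ) (h := h) k t, ramp_nonneg (c := c) (h := h') (t := t)],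
    by linarith [rise_nonneg (τ := τ) (h := h) k t, ramp_le_one (c := c) (h := h') (t := t)]⟩

variable {a w : ℝ → ℝ} {A M S : ℝ}

lemma abs_integral_mul_deriv_ramp_le {c : ℝ} (hh : 0 < h) (hS : ∀ t, deriv Real.smoothTransition t ≤ S)
    (hw : ∀ t, |w t| ≤ M) : |∫ t, w t * deriv (ramp c h) t| ≤ M * S := by
  refine (abs_integral_le_of_support (C := M * (S / h)) (c := c) (d := c + h) (by linarith) (fun t => ?_)
    fun t ht => ?_).trans (le_of_eq (by field_simp; ring))
  · rw [abs_mul, abs_of_nonneg (deriv_ramp_nonneg hh)]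
    refine mul_le_mul (hw t) ?_ (deriv_ramp_nonneg hh) ((abs_nonneg _).trans (hw t))
    rw [deriv_ramp]; exact div_le_div_of_nonneg_right (hS _) hh.le
  · rw [deriv_ramp_eq_zero hh ht, mul_zero]

lemma abs_integral_mul_rise_sub_le (hh : 0 < h) {h' c : ℝ} (hh' : 0 < h') (k : ℕ) (hc : τ + k * h ≤ c)
    {f : ℝ → ℝ} (hf : ∀ t, |f t| ≤ M) (hf0 : ∀ t, t ≤ τ → f t = 0) :
    |∫ t, f t * (rise τ h k t - ramp c h' t)| ≤ M * (c + h' - (τ + (k - 1) * h)) := by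
  refine abs_integral_le_of_support (by linarith) (fun t => ?_) fun t ht => ?_
  · rw [abs_mul]
    exact (mul_le_of_le_one_right (abs_nonneg _) (abs_rise_sub_ramp_le _ _)).trans (hf t)
  · rcases le_or_gt t τ with h1 | h1
    · rw [hf0 t h1, zero_mul]
    · rw [rise_sub_ramp_eq_zero hh hh' k hc h1 ht, mul_zero]

/-- The consistency error of one time step. -/
def stepErr (ε τ h : ℝ) (a w : ℝ → ℝ) (k : ℕ) : ℝ :=
  (ε + ∫ t, a t * deriv (rise τ h (k + 1)) t) * (∫ t, w t * deriv (rise τ h (k + 1)) t) -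
    (∫ t, a t * w t * (rise τ h k t - rise τ h (k + 1) t)) / h

lemma abs_stepErr_le {ε : ℝ} (hε : 0 ≤ ε) (hh : 0 < h) (hS : ∀ t, deriv Real.smoothTransition t ≤ S)
    (hS0 : 0 ≤ S) (ha : ∀ t, |a t| ≤ A) (hw : ∀ t, |w t| ≤ M) (hw0 : ∀ t, t ≤ τ → w t = 0) (k : ℕ) :
    |stepErr ε τ h a w k| ≤ (ε + A * S) * (M * S) + 2 * (A * M) := by
  have hA : 0 ≤ A := (abs_nonneg _).trans (ha 0)
  have hM : 0 ≤ M := (abs_nonneg _).trans (hw 0)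
  refine (abs_sub _ _).trans (add_le_add ?_ ?_)
  · rw [abs_mul]
    refine mul_le_mul ((abs_add_le _ _).trans (add_le_add (abs_of_nonneg hε).le
      (abs_integral_mul_deriv_ramp_le hh hS ha))) (abs_integral_mul_deriv_ramp_le hh hS hw)
      (abs_nonneg _) (by positivity)
  · rw [abs_div, abs_of_pos hh, div_le_iff₀ hh]
    refine (abs_integral_mul_rise_sub_le (M := A * M) (f := fun t => a t * w t) hh hh k le_rfl (fun t => ?_) fun t ht => ?_).trans (le_of_eq (by ring))
    · rw [abs_mul]; exact mul_le_mul (ha t) (hw t) (abs_nonneg _) hA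
    · simp only [hw0 t ht, mul_zero]

lemma locallyIntegrable_of_abs_le {f : ℝ → ℝ} (hf : Measurable f) {C : ℝ} (hC : ∀ t, |f t| ≤ C) : LocallyIntegrable f :=
  (memLp_top_of_bound hf.aestronglyMeasurable C (ae_of_all _ hC)).locallyIntegrable le_top

lemma tendsto_stepErr {ε T t : ℝ} (hT : τ < T) (ht : t ∈ Ioc τ T)
    (ham : Measurable a) (hwm : Measurable w) (ha : ∀ t, |a t| ≤ A) (hw : ∀ t, |w t| ≤ M)
    (h1 : IsLebesguePt a t) (h2 : IsLebesguePt w t) (h3 : IsLebesguePt (fun t => a t * w t) t) :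
    Tendsto (fun K : ℕ => stepErr ε τ ((T - τ) / K) a w ⌊(t - τ) / ((T - τ) / K)⌋₊) atTop (𝓝 (ε * w t)) := by
  obtain ⟨S, hS0, hS⟩ := exists_deriv_smoothTransition_le
  have hA : 0 ≤ A := (abs_nonneg _).trans (ha 0)
  have hTτ : 0 < T - τ := sub_pos.2 hT
  obtain ⟨H, hH⟩ : ∃ H : ℕ → ℝ, H = fun K : ℕ => (T - τ) / K := ⟨_, rfl⟩
  obtain ⟨k, hk⟩ : ∃ k : ℕ → ℕ, k = fun K => ⌊(t - τ) / H K⌋₊ := ⟨_, rfl⟩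
  have goal_eq : (fun K : ℕ => stepErr ε τ ((T - τ) / K) a w ⌊(t - τ) / ((T - τ) / K)⌋₊) =
      fun K => stepErr ε τ (H K) a w (k K) := by rw [hk, hH]
  rw [goal_eq]
  have hH0 : Tendsto H atTop (𝓝 0) := by rw [hH]; exact tendsto_const_div_atTop_nhds_zero_nat _
  have hHpos : ∀ᶠ K in atTop, 0 < H K := (eventually_gt_atTop 0).mono fun K hK => by
    rw [hH]; exact div_pos hTτ (Nat.cast_pos.2 hK)
  have hδ : Tendsto (fun K => 2 * H K) atTop (𝓝[>] 0) := by
    refine tendsto_nhdsWithin_iff.2 ⟨by simpa using hH0.const_mul 2, hHpos.mono fun K hK => ?_⟩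
    simp only [mem_Ioi]; linarith
  have hkK : ∀ᶠ K in atTop, (k K) * H K ≤ t - τ ∧ t - τ < (k K + 1) * H K := hHpos.mono fun K hK => by
    have h0 : 0 ≤ (t - τ) / H K := div_nonneg (by linarith [ht.1]) hK.le
    rw [hk]
    exact ⟨(le_div_iff₀ hK).1 (Nat.floor_le h0), (div_lt_iff₀ hK).1 (Nat.lt_floor_add_one _)⟩
  have hsupp : ∀ᶠ K in atTop, ∀ y, y ∉ closedBall t (2 * H K) → y ∉ Ioc (τ + (k K - 1) * H K) (τ + k K * H K + H K) := by
    filter_upwards [hHpos, hkK] with K hK h4 y hy hy'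
    refine hy ?_
    rw [Real.closedBall_eq_Icc]
    constructor <;> linarith [hy'.1, hy'.2, h4.1, h4.2]
  have conv1 : ∀ f : ℝ → ℝ, LocallyIntegrable f → IsLebesguePt f t →
      Tendsto (fun K => ∫ y, f y * deriv (rise τ (H K) (k K + 1)) y) atTop (𝓝 (f t)) := fun f hf hft => by
    refine hft.tendsto hf (C := 2 * S) hδ (fun K => continuous_deriv_ramp) (hHpos.mono fun K hK y => deriv_ramp_nonneg hK)
      (hHpos.mono fun K hK y => ?_) ?_ (hHpos.mono fun K hK => integral_deriv_ramp hK)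
    · rw [rise, deriv_ramp, mul_div_mul_left _ _ two_ne_zero]
      exact div_le_div_of_nonneg_right (hS _) hK.le
    · filter_upwards [hHpos, hsupp] with K hK h5 y hy
      refine deriv_ramp_eq_zero hK fun hy' => h5 y hy ⟨?_, hy'.2⟩
      linarith [hy'.1]
  have hk1 : ∀ᶠ K in atTop, 1 ≤ k K := by
    filter_upwards [hHpos, hH0.eventually (gt_mem_nhds (sub_pos.2 ht.1))] with K hK h6
    rw [hk]
    exact Nat.le_floor (by rw [Nat.cast_one]; exact (one_le_div hK).2 h6.le)
  have hawl : LocallyIntegrable (fun t => a t * w t) := locallyIntegrable_of_abs_le (ham.mul hwm) (C := A * M) fun t => by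
    rw [abs_mul]; exact mul_le_mul (ha t) (hw t) (abs_nonneg _) hA
  have conv2 : Tendsto (fun K => ∫ y, a y * w y * ((rise τ (H K) (k K) y - rise τ (H K) (k K + 1) y) / H K)) atTop
      (𝓝 (a t * w t)) := by
    refine h3.tendsto hawl (C := 2) hδ (fun K => ((continuous_rise _).sub (continuous_rise _)).div_const _)
      (hHpos.mono fun K hK y => div_nonneg (rise_sub_ramp_nonneg hK hK _ le_rfl y) hK.le) (hHpos.mono fun K hK y => ?_) ?_ ?_
    · rw [div_mul_cancel_left₀ two_ne_zero, ← one_div]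
      exact div_le_div_of_nonneg_right ((le_abs_self _).trans (abs_rise_sub_ramp_le _ _)) hK.le
    · filter_upwards [hHpos, hsupp, hk1] with K hK h5 h6 y hy
      rcases le_or_gt y τ with h7 | h7
      · obtain ⟨j, hj⟩ := Nat.exists_eq_add_of_le' h6
        have := h5 y hy
        rw [hj] at this ⊢
        rw [rise, rise, ramp_sub_eq_zero hK hK (by push_cast; linarith) ?_, zero_div]
        push_cast at this ⊢
        rwa [add_sub_cancel_right] at this
      · rw [rise, rise_sub_ramp_eq_zero hK hK _ le_rfl h7 (h5 y hy), zero_div]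
    · filter_upwards [hHpos, hk1] with K hK h6
      obtain ⟨j, hj⟩ := Nat.exists_eq_add_of_le' h6
      rw [integral_div, hj]
      rw [rise, rise, integral_ramp_sub hK (by push_cast; ring), div_self hK.ne']
  have := (((conv1 a (locallyIntegrable_of_abs_le ham ha) h1).const_add ε).mul
    (conv1 w (locallyIntegrable_of_abs_le hwm hw) h2)).sub conv2
  rw [show (ε + a t) * w t - a t * w t = ε * w t by ring] at this
  refine this.congr fun K => ?_
  simp only [stepErr, ← mul_div_assoc, integral_div]

lemma tendsto_sum_stepErr {ε T : ℝ} (hε : 0 ≤ ε) (hT : τ < T)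
    (ham : Measurable a) (hwm : Measurable w) (ha : ∀ t, |a t| ≤ A) (hw : ∀ t, |w t| ≤ M)
    (hw0 : ∀ t, t ≤ τ → w t = 0) :
    Tendsto (fun K : ℕ => ∑ k ∈ Finset.range K, (T - τ) / K * stepErr ε τ ((T - τ) / K) a w k ^ 2) atTop
      (𝓝 (∫ t in τ..T, (ε * w t) ^ 2)) := by
  obtain ⟨S, hS0, hS⟩ := exists_deriv_smoothTransition_le
  have hA : 0 ≤ A := (abs_nonneg _).trans (ha 0)
  have hTτ : 0 < T - τ := sub_pos.2 hT
  have hawl : LocallyIntegrable (fun t => a t * w t) := locallyIntegrable_of_abs_le (ham.mul hwm) (C := A * M) fun t => by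
    rw [abs_mul]; exact mul_le_mul (ha t) (hw t) (abs_nonneg _) hA
  have hpos : ∀ᶠ K : ℕ in atTop, (0 : ℝ) < (T - τ) / K := (eventually_gt_atTop 0).mono fun K hK =>
    div_pos hTτ (Nat.cast_pos.2 hK)
  have key : Tendsto (fun K : ℕ => ∫ t in τ..T, stepErr ε τ ((T - τ) / K) a w ⌊(t - τ) / ((T - τ) / K)⌋₊ ^ 2) atTop
      (𝓝 (∫ t in τ..T, (ε * w t) ^ 2)) := by
    refine intervalIntegral.tendsto_integral_filter_of_dominated_convergence
      (fun _ => ((ε + A * S) * (M * S) + 2 * (A * M)) ^ 2) ?_ ?_ intervalIntegrable_const ?_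
    · refine Eventually.of_forall fun K => Measurable.aestronglyMeasurable ?_
      exact (measurable_from_nat (f := fun k => stepErr ε τ ((T - τ) / K) a w k ^ 2)).comp
        (Nat.measurable_floor.comp ((measurable_id.sub_const _).div_const _))
    · filter_upwards [hpos] with K hK
      refine ae_of_all _ fun t _ => ?_
      rw [norm_pow]
      exact pow_le_pow_left₀ (norm_nonneg _) (abs_stepErr_le hε hK hS hS0 ha hw hw0 _) 2
    · filter_upwards [ae_isLebesguePt (locallyIntegrable_of_abs_le ham ha), ae_isLebesguePt (locallyIntegrable_of_abs_le hwm hw),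
        ae_isLebesguePt hawl] with t h1 h2 h3 ht
      rw [uIoc_of_le hT.le] at ht
      exact (tendsto_stepErr hT ht ham hwm ha hw h1 h2 h3).pow 2
  refine key.congr' ?_
  filter_upwards [hpos, eventually_gt_atTop 0] with K hK hK'
  rw [← integral_floor hK (fun k => stepErr ε τ ((T - τ) / K) a w k ^ 2)]
  have : τ + K * ((T - τ) / K) = T := by
    rw [mul_div_cancel₀ _ (Nat.cast_ne_zero.2 hK'.ne')]; ring
  rw [this]
end
end

section
variable {N : ℕ}

/-- A bounded pair `(w, a)` for which `∂ₜ(ρ w) ≤ Δ(a w)` holds in the very weak sense, with vanishing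
initial and lateral data, tested against products `ζ(x) θ(t)`. -/
structure DiffIneq (D : Eu N → ℝ) (Ω : Set (Eu N)) (ρ : Eu N → ℝ) (τ₁ τ₂ A M : ℝ)
    (a w : Eu N → ℝ → ℝ) : Prop where
  meas_w : Measurable (Function.uncurry w)
  meas_a : Measurable (Function.uncurry a)
  w_le : ∀ x t, |w x t| ≤ M
  a_nonneg : ∀ x t, 0 ≤ a x t
  a_le : ∀ x t, a x t ≤ A
  w_zero : ∀ x t, t ∉ Ioo τ₁ τ₂ → w x t = 0
  ineq : ∀ θ : ℝ → ℝ, ContDiff ℝ 2 θ → (∀ t, 0 ≤ θ t) → θ τ₂ = 0 → ∀ ζ, Adm D Ω ζ →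
    0 ≤ ∫ x in Ω, (-(∫ t, a x t * w x t * θ t) * -lap ζ x + ρ x * ((∫ t, w x t * deriv θ t) * ζ x))

section
variable {D : Eu N → ℝ} {Ω : Set (Eu N)} {ρ : Eu N → ℝ} {τ₁ τ₂ A M : ℝ} {a w : Eu N → ℝ → ℝ}

lemma measurable_integral_mul {f : Eu N → ℝ → ℝ} (hf : Measurable (Function.uncurry f)) {g : ℝ → ℝ}
    (hg : Measurable g) : Measurable fun x => ∫ t, f x t * g t := by
  have h1 : Measurable (Function.uncurry fun (x : Eu N) t => f x t * g t) := hf.mul (hg.comp measurable_snd)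
  exact (StronglyMeasurable.integral_prod_right (ν := volume) h1.stronglyMeasurable).measurable

lemma integrable_mul_deriv_ramp {f : ℝ → ℝ} (hf : Measurable f) (hM : ∀ t, |f t| ≤ M) {c h : ℝ} (hh : 0 < h) :
    Integrable fun t => f t * deriv (ramp c h) t :=
  Integrable.bdd_mul (c := M) (integrable_deriv_ramp hh) hf.aestronglyMeasurable (ae_of_all _ hM)

lemma integral_mul_deriv_rise_sub_ramp {f : ℝ → ℝ} (hf : Measurable f) (hM : ∀ t, |f t| ≤ M) {τ h c h' : ℝ}
    (hh : 0 < h) (hh' : 0 < h') (k : ℕ) :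
    ∫ t, f t * deriv (fun t => rise τ h k t - ramp c h' t) t =
      (∫ t, f t * deriv (rise τ h k) t) - ∫ t, f t * deriv (ramp c h') t := by
  have i1 : Integrable fun t => f t * deriv (rise τ h k) t := by
    cases k with
    | zero => simp [rise]
    | succ k => exact integrable_mul_deriv_ramp hf hM hh
  rw [← integral_sub i1 (integrable_mul_deriv_ramp hf hM hh')]
  refine integral_congr_ae (ae_of_all _ fun t => ?_)
  simp only
  rw [deriv_fun_sub ((contDiff_rise (n := 1) k).differentiable (by norm_num) t) (hasDerivAt_ramp.differentiableAt), mul_sub]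

namespace DiffIneq

lemma abs_a_le (hw : DiffIneq D Ω ρ τ₁ τ₂ A M a w) (x : Eu N) (t : ℝ) : |a x t| ≤ A := by
  rw [abs_of_nonneg (hw.a_nonneg x t)]; exact hw.a_le x t

lemma M_nonneg (hw : DiffIneq D Ω ρ τ₁ τ₂ A M a w) : 0 ≤ M := (abs_nonneg _).trans (hw.w_le 0 0)

lemma A_nonneg (hw : DiffIneq D Ω ρ τ₁ τ₂ A M a w) : 0 ≤ A := (abs_nonneg _).trans (hw.abs_a_le 0 0)

lemma w_zero_left (hw : DiffIneq D Ω ρ τ₁ τ₂ A M a w) (x : Eu N) (t : ℝ) (ht : t ≤ τ₁) : w x t = 0 :=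
  hw.w_zero x t fun h => h.1.not_ge ht

lemma meas_w' (hw : DiffIneq D Ω ρ τ₁ τ₂ A M a w) (x : Eu N) : Measurable (w x) :=
  hw.meas_w.comp measurable_prodMk_left

lemma meas_a' (hw : DiffIneq D Ω ρ τ₁ τ₂ A M a w) (x : Eu N) : Measurable (a x) :=
  hw.meas_a.comp measurable_prodMk_left

lemma abs_aw_le (hw : DiffIneq D Ω ρ τ₁ τ₂ A M a w) (x : Eu N) (t : ℝ) : |a x t * w x t| ≤ A * M := by
  rw [abs_mul]; exact mul_le_mul (hw.abs_a_le x t) (hw.w_le x t) (abs_nonneg _) hw.A_nonneg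

lemma measurable_stepErr (hw : DiffIneq D Ω ρ τ₁ τ₂ A M a w) (ε τ h : ℝ) (k : ℕ) :
    Measurable fun x => stepErr ε τ h (a x) (w x) k := by
  have hr : Measurable (deriv (rise τ h (k + 1))) := continuous_deriv_ramp.measurable
  exact ((measurable_const.add (measurable_integral_mul hw.meas_a hr)).mul (measurable_integral_mul hw.meas_w hr)).sub
    ((measurable_integral_mul (f := fun x t => a x t * w x t) (hw.meas_a.mul hw.meas_w)
      ((continuous_rise k).sub (continuous_rise (k + 1))).measurable).div_const h)

lemma ineq_rise (hw : DiffIneq D Ω ρ τ₁ τ₂ A M a w) {h c h' : ℝ} (hh : 0 < h) (hh' : 0 < h') (k : ℕ)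
    (hc : τ₁ + k * h ≤ c) (hc' : c + h' ≤ τ₂) {ζ : Eu N → ℝ} (hζ : Adm D Ω ζ) :
    0 ≤ ∫ x in Ω, (-(∫ t, a x t * w x t * (rise τ₁ h k t - ramp c h' t)) * -lap ζ x +
      ρ x * (((∫ t, w x t * deriv (rise τ₁ h k) t) - ∫ t, w x t * deriv (ramp c h') t) * ζ x)) := by
  have := hw.ineq (fun t => rise τ₁ h k t - ramp c h' t)
    ((contDiff_rise (n := 2) k).sub (contDiff_ramp (n := 2)))
    (rise_sub_ramp_nonneg hh hh' k hc)
    (by rw [rise_of_ge hh k (by linarith), ramp_of_ge hh' hc', sub_self]) ζ hζ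
  simpa only [integral_mul_deriv_rise_sub_ramp (hw.meas_w' _) (hw.w_le _) hh hh' k] using this

lemma discrete_energy (hw : DiffIneq D Ω ρ τ₁ τ₂ A M a w) (hN : 3 ≤ N) (h : SmoothDom D Ω) (hρ : Weight ρ Ω)
    {ζ : Eu N → ℝ} (hζ : Adm D Ω ζ) {T η ε lam : ℝ} (hT : τ₁ < T) (hη : 0 < η) (hTη : T + η ≤ τ₂)
    (hε : 0 < ε) (hlam : 0 < lam) {K : ℕ} (hK : 0 < K) :
    ∫ x in Ω, ρ x * ((∫ t, w x t * deriv (ramp T η) t) * ζ x) ≤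
      lam / 4 * (∫ x in Ω, ‖gradient ζ x‖ ^ 2) +
      1 / (2 * lam * ε) * (∫ x in Ω, ρ x * ∑ k ∈ Finset.range K, (T - τ₁) / K * stepErr ε τ₁ ((T - τ₁) / K) (a x) (w x) k ^ 2) +
      A * M * ((T - τ₁) / K + η) * ∫ x in Ω, |lap ζ x| := by
  have hfin := h.isFiniteMeasure
  have hνfin := hρ.isFiniteMeasure
  obtain ⟨S, hS0, hS⟩ := exists_deriv_smoothTransition_le
  obtain ⟨δ, hδ⟩ : ∃ δ, δ = (T - τ₁) / K := ⟨_, rfl⟩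
  have hK0 : (0 : ℝ) < K := by exact_mod_cast hK
  have hδ0 : 0 < δ := by rw [hδ]; exact div_pos (sub_pos.2 hT) hK0
  have hKδ : τ₁ + K * δ = T := by rw [hδ]; field_simp; ring
  rw [← hδ]
  have hA := hw.A_nonneg
  have hM := hw.M_nonneg
  have hr : ∀ k, Measurable (deriv (rise τ₁ δ k)) := fun k => (contDiff_rise (n := 1) k).continuous_deriv (by norm_num) |>.measurable
  obtain ⟨P, hP⟩ : ∃ P : ℕ → Eu N → ℝ, P = fun k x => ∫ t, w x t * deriv (rise τ₁ δ k) t := ⟨_, rfl⟩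
  obtain ⟨Z, hZ⟩ : ∃ Z : ℕ → Eu N → ℝ, Z = fun k x => ∫ t, a x t * w x t * (rise τ₁ δ k t - rise τ₁ δ (k + 1) t) := ⟨_, rfl⟩
  obtain ⟨α, hα⟩ : ∃ α : ℕ → Eu N → ℝ, α = fun k x => ε + ∫ t, a x t * deriv (rise τ₁ δ (k + 1)) t := ⟨_, rfl⟩
  have hαm : ∀ k, Measurable (α k) := fun k => by
    rw [hα]; exact measurable_const.add (measurable_integral_mul hw.meas_a (hr _))
  have hα1 : ∀ k x, ε ≤ α k x := fun k x => by
    rw [hα]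
    have : 0 ≤ ∫ t, a x t * deriv (rise τ₁ δ (k + 1)) t :=
      integral_nonneg fun t => mul_nonneg (hw.a_nonneg x t) (deriv_ramp_nonneg hδ0)
    simp only; linarith
  have hα2 : ∀ k x, α k x ≤ ε + A * S := fun k x => by
    rw [hα]
    have := (le_abs_self _).trans (abs_integral_mul_deriv_ramp_le (c := τ₁ + k * δ) hδ0 hS (hw.abs_a_le x))
    simp only [rise]; linarith
  have hα0 : ∀ k x, 0 < α k x := fun k x => hε.trans_le (hα1 k x)
  have bP : ∀ k, EssBdd (volume.restrict Ω) (P k) := fun k => by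
    rw [hP]
    refine .of_bound (C := M * S) (measurable_integral_mul hw.meas_w (hr k)).aestronglyMeasurable (ae_of_all _ fun x => ?_)
    cases k with
    | zero => simpa [rise] using mul_nonneg hM hS0
    | succ k => exact abs_integral_mul_deriv_ramp_le hδ0 hS (hw.w_le x)
  have awm : Measurable (Function.uncurry fun x t => a x t * w x t) := hw.meas_a.mul hw.meas_w
  have bZ : ∀ k, EssBdd (volume.restrict Ω) (Z k) := fun k => by
    rw [hZ]
    refine .of_bound (C := A * M * (τ₁ + k * δ + δ - (τ₁ + (k - 1) * δ))) (measurable_integral_mul awm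
      ((continuous_rise k).sub (continuous_rise (k + 1))).measurable).aestronglyMeasurable (ae_of_all _ fun x => ?_)
    exact abs_integral_mul_rise_sub_le hδ0 hδ0 k le_rfl (hw.abs_aw_le x) fun t ht => by
      rw [hw.w_zero_left x t ht, mul_zero]
  have bζ := h.essBdd hζ.contDiff.continuous
  have bl : EssBdd (volume.restrict Ω) (lap ζ) := h.essBdd (continuous_lap hζ.contDiff)
  obtain ⟨C, hC, hCb⟩ := bζ.2
  have hmul : ∀ k < K, τ₁ + k * δ + δ ≤ τ₂ := fun k hk => by
    have h1 : ((k : ℝ) + 1) * δ ≤ K * δ := mul_le_mul_of_nonneg_right (by exact_mod_cast hk) hδ0.le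
    linarith
  have key := duality_sum hN h hρ (b := fun k x => (δ * α k x)⁻¹) (P := P) (Z := Z)
    (fun k => ((hαm k).const_mul δ).inv) (c₁ := (δ * (ε + A * S))⁻¹) (c₂ := (δ * ε)⁻¹) (by positivity)
    (fun k x => ⟨inv_anti₀ (mul_pos hδ0 (hα0 k x)) (mul_le_mul_of_nonneg_left (hα2 k x) hδ0.le),
      inv_anti₀ (by positivity) (mul_le_mul_of_nonneg_left (hα1 k x) hδ0.le)⟩)
    (fun x => by simp [hP, rise]) bP bZ hlam hC K
    (fun k hk ζ hζ => by
      have := hw.ineq_rise hδ0 hδ0 k le_rfl (hmul k hk) hζ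
      rw [hP, hZ]; exact this)
    (hζ.h01 h h.ae_weighted) hζ.contDiff.continuous.aestronglyMeasurable
    (by
      filter_upwards [hCb, ae_restrict_mem h.meas] with x h1 h2
      exact ⟨hζ.nonneg x h2, (le_abs_self _).trans h1⟩)
  have I : ∀ {f : Eu N → ℝ}, EssBdd (volume.restrict Ω) f → IntegrableOn (fun x => ρ x * f x) Ω :=
    fun hf => EssBdd.integrable_mul hρ.integrable hf
  have bs : ∀ k, EssBdd (volume.restrict Ω) fun x => stepErr ε τ₁ δ (a x) (w x) k := fun k =>
    .of_bound (hw.measurable_stepErr ε τ₁ δ k).aestronglyMeasurable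
      (ae_of_all _ fun x => abs_stepErr_le hε.le hδ0 hS hS0 (hw.abs_a_le x) (hw.w_le x) (hw.w_zero_left x) k)
  have hs : ∀ k x, (δ * α k x)⁻¹ * (P (k + 1) x / (δ * α k x)⁻¹ - Z k x) ^ 2 =
      (δ * stepErr ε τ₁ δ (a x) (w x) k ^ 2) * (α k x)⁻¹ := fun k x => by
    have e : stepErr ε τ₁ δ (a x) (w x) k = α k x * P (k + 1) x - Z k x / δ := by
      rw [hα, hP, hZ, stepErr]
    have := hα0 k x
    rw [e]; field_simp
  have hsum : ∑ k ∈ Finset.range K, ∫ x in Ω, ρ x * ((δ * α k x)⁻¹ * (P (k + 1) x / (δ * α k x)⁻¹ - Z k x) ^ 2) ≤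
      1 / ε * ∫ x in Ω, ρ x * ∑ k ∈ Finset.range K, δ * stepErr ε τ₁ δ (a x) (w x) k ^ 2 := by
    simp only [hs, Finset.mul_sum]
    rw [integral_finsetSum _ fun k _ => I ((EssBdd.const δ).mul (bs k).sq), Finset.mul_sum]
    refine Finset.sum_le_sum fun k _ => ?_
    rw [← integral_const_mul]
    have bi : EssBdd (volume.restrict Ω) fun x => (α k x)⁻¹ := .of_bound (C := ε⁻¹) (hαm k).inv.aestronglyMeasurable
      (ae_of_all _ fun x => by rw [abs_of_pos (inv_pos.2 (hα0 k x))]; exact inv_anti₀ hε (hα1 k x))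
    have bd := (EssBdd.const (μ := volume.restrict Ω) δ).mul (bs k).sq
    refine integral_mono_ae (I (bd.mul bi)) ((I bd).const_mul _) ?_
    filter_upwards [hρ.nonneg] with x hx
    have h1 : (α k x)⁻¹ ≤ 1 / ε := by rw [one_div]; exact inv_anti₀ hε (hα1 k x)
    have h2 := mul_le_mul_of_nonneg_left h1 (mul_nonneg hx (mul_nonneg hδ0.le (sq_nonneg (stepErr ε τ₁ δ (a x) (w x) k))))
    linarith only [h2]
  have last := hw.ineq_rise hδ0 hη K hKδ.le hTη hζ
  obtain ⟨Zf, hZf⟩ : ∃ Zf : Eu N → ℝ, Zf = fun x => ∫ t, a x t * w x t * (rise τ₁ δ K t - ramp T η t) := ⟨_, rfl⟩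
  obtain ⟨Pf, hPf⟩ : ∃ Pf : Eu N → ℝ, Pf = fun x => ∫ t, w x t * deriv (ramp T η) t := ⟨_, rfl⟩
  have zb : ∀ x, |Zf x| ≤ A * M * (δ + η) := fun x => by
    rw [hZf]
    refine (abs_integral_mul_rise_sub_le hδ0 hη K hKδ.le (hw.abs_aw_le x) fun t ht => by
      rw [hw.w_zero_left x t ht, mul_zero]).trans (le_of_eq ?_)
    rw [← hKδ]; ring
  have bZf : EssBdd (volume.restrict Ω) Zf := .of_bound (by
      rw [hZf]; exact (measurable_integral_mul awm ((continuous_rise K).sub continuous_ramp).measurable).aestronglyMeasurable)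
    (ae_of_all _ zb)
  have bPf : EssBdd (volume.restrict Ω) Pf := .of_bound (by
      rw [hPf]; exact (measurable_integral_mul hw.meas_w continuous_deriv_ramp.measurable).aestronglyMeasurable)
    (ae_of_all _ fun x => by
      rw [hPf]; exact abs_integral_mul_deriv_ramp_le hη hS (hw.w_le x))
  have e1 : ∫ x in Ω, (-(∫ t, a x t * w x t * (rise τ₁ δ K t - ramp T η t)) * -lap ζ x +
      ρ x * (((∫ t, w x t * deriv (rise τ₁ δ K) t) - ∫ t, w x t * deriv (ramp T η) t) * ζ x)) =
      (∫ x in Ω, Zf x * lap ζ x) + ((∫ x in Ω, ρ x * (P K x * ζ x)) - ∫ x in Ω, ρ x * (Pf x * ζ x)) := by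
    rw [← integral_sub (I ((bP K).mul bζ)) (I (bPf.mul bζ)),
      ← integral_add (bZf.mul bl).integrable ((I ((bP K).mul bζ)).fun_sub (I (bPf.mul bζ)))]
    refine integral_congr_ae (ae_of_all _ fun x => ?_)
    rw [hP, hZf, hPf]
    ring
  rw [e1] at last
  have e2 : ∫ x in Ω, Zf x * lap ζ x ≤ A * M * (δ + η) * ∫ x in Ω, |lap ζ x| := by
    rw [← integral_const_mul]
    refine integral_mono (bZf.mul bl).integrable (bl.integrable.abs.const_mul _) fun x => ?_
    refine (le_abs_self _).trans ?_
    rw [abs_mul]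
    exact mul_le_mul_of_nonneg_right (zb x) (abs_nonneg _)
  have e3 : ∫ x in Ω, ρ x * ((∫ t, w x t * deriv (ramp T η) t) * ζ x) = ∫ x in Ω, ρ x * (Pf x * ζ x) := by rw [hPf]
  rw [e3]
  have e4 := mul_le_mul_of_nonneg_left hsum (by positivity : 0 ≤ 1 / (2 * lam))
  have e5 : ∀ x : ℝ, 1 / (2 * lam) * (1 / ε * x) = 1 / (2 * lam * ε) * x := fun x => by field_simp
  rw [e5] at e4
  linarith

lemma energy_limit (hw : DiffIneq D Ω ρ τ₁ τ₂ A M a w) (hN : 3 ≤ N) (h : SmoothDom D Ω) (hρ : Weight ρ Ω)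
    {ζ : Eu N → ℝ} (hζ : Adm D Ω ζ) {T η : ℝ} (hT : τ₁ < T) (hη : 0 < η) (hTη : T + η ≤ τ₂) :
    ∫ x in Ω, ρ x * ((∫ t, w x t * deriv (ramp T η) t) * ζ x) ≤ A * M * η * ∫ x in Ω, |lap ζ x| := by
  obtain ⟨S, hS0, hS⟩ := exists_deriv_smoothTransition_le
  have hA := hw.A_nonneg
  have hM := hw.M_nonneg
  have hT0 : 0 < T - τ₁ := sub_pos.2 hT
  obtain ⟨X, hX⟩ : ∃ X, X = ∫ x in Ω, ρ x * ((∫ t, w x t * deriv (ramp T η) t) * ζ x) := ⟨_, rfl⟩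
  obtain ⟨E, hE⟩ : ∃ E, E = ∫ x in Ω, ‖gradient ζ x‖ ^ 2 := ⟨_, rfl⟩
  obtain ⟨L, hL⟩ : ∃ L, L = ∫ x in Ω, |lap ζ x| := ⟨_, rfl⟩
  obtain ⟨R, hR⟩ : ∃ R, R = ∫ x in Ω, ρ x := ⟨_, rfl⟩
  rw [← hX, ← hL]
  have sq_le : ∀ ε x t, (ε * w x t) ^ 2 ≤ ε ^ 2 * M ^ 2 := fun ε x t => by
    rw [mul_pow]
    exact mul_le_mul_of_nonneg_left (sq_le_sq' (abs_le.1 (hw.w_le x t)).1 (abs_le.1 (hw.w_le x t)).2) (sq_nonneg _)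
  have step : ∀ ε lam, 0 < ε → 0 < lam → X ≤ lam / 4 * E +
      1 / (2 * lam * ε) * (∫ x in Ω, ρ x * ∫ t in τ₁..T, (ε * w x t) ^ 2) + A * M * (0 + η) * L := by
    intro ε lam hε hlam
    have lim : Tendsto (fun K : ℕ => ∫ x in Ω, ρ x * ∑ k ∈ Finset.range K,
        (T - τ₁) / K * stepErr ε τ₁ ((T - τ₁) / K) (a x) (w x) k ^ 2) atTop
        (𝓝 (∫ x in Ω, ρ x * ∫ t in τ₁..T, (ε * w x t) ^ 2)) := by
      obtain ⟨C, hC⟩ : ∃ C, C = (ε + A * S) * (M * S) + 2 * (A * M) := ⟨_, rfl⟩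
      have hC0 : 0 ≤ C := by rw [hC]; positivity
      refine tendsto_integral_filter_of_dominated_convergence (fun x => |ρ x| * ((T - τ₁) * C ^ 2))
        (Eventually.of_forall fun K => ?_) (Filter.eventually_atTop.2 ⟨1, fun K hK => ae_of_all _ fun x => ?_⟩)
        (hρ.integrable.abs.mul_const _) (ae_of_all _ fun x => ?_)
      · exact (hρ.meas.mul (Finset.measurable_sum _ fun k _ =>
          ((hw.measurable_stepErr _ _ _ k).pow_const 2).const_mul _)).aestronglyMeasurable
      · have hK0 : (0 : ℝ) < K := by exact_mod_cast hK
        have hd : 0 < (T - τ₁) / K := div_pos hT0 hK0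
        rw [norm_mul, Real.norm_eq_abs, Real.norm_eq_abs]
        refine mul_le_mul_of_nonneg_left ?_ (abs_nonneg _)
        rw [abs_of_nonneg (Finset.sum_nonneg fun k _ => by positivity)]
        have : ∑ k ∈ Finset.range K, (T - τ₁) / K * stepErr ε τ₁ ((T - τ₁) / K) (a x) (w x) k ^ 2 ≤
            ∑ k ∈ Finset.range K, (T - τ₁) / K * C ^ 2 := Finset.sum_le_sum fun k _ => by
          refine mul_le_mul_of_nonneg_left ?_ hd.le
          have := abs_le.1 (abs_stepErr_le hε.le hd hS hS0 (hw.abs_a_le x) (hw.w_le x) (hw.w_zero_left x) k)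
          rw [← hC] at this
          exact sq_le_sq' this.1 this.2
        refine this.trans (le_of_eq ?_)
        rw [Finset.sum_const, Finset.card_range, nsmul_eq_mul]
        field_simp
      · exact (tendsto_sum_stepErr hε.le hT (hw.meas_a' x) (hw.meas_w' x) (hw.abs_a_le x) (hw.w_le x)
          (hw.w_zero_left x)).const_mul _
    have lim2 : Tendsto (fun K : ℕ => (T - τ₁) / (K : ℝ)) atTop (𝓝 0) := tendsto_const_div_atTop_nhds_zero_nat _
    refine ge_of_tendsto (((lim.const_mul (1 / (2 * lam * ε))).const_add (lam / 4 * E)).add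
      (((lim2.add_const η).const_mul (A * M)).mul_const L)) (Filter.eventually_atTop.2 ⟨1, fun K hK => ?_⟩)
    rw [hX, hE, hL]
    exact hw.discrete_energy hN h hρ hζ hT hη hTη hε hlam hK
  have step2 : ∀ ε, 0 < ε → ∫ x in Ω, ρ x * ∫ t in τ₁..T, (ε * w x t) ^ 2 ≤ ε ^ 2 * M ^ 2 * (T - τ₁) * R := by
    intro ε hε
    rw [hR, ← integral_const_mul]
    have hb : ∀ x, ∫ t in τ₁..T, (ε * w x t) ^ 2 ≤ ε ^ 2 * M ^ 2 * (T - τ₁) := fun x => by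
      refine (le_abs_self _).trans ?_
      have := intervalIntegral.norm_integral_le_of_norm_le_const (a := τ₁) (b := T) (f := fun t => (ε * w x t) ^ 2)
        (C := ε ^ 2 * M ^ 2) fun t _ => by
          rw [Real.norm_eq_abs, abs_of_nonneg (sq_nonneg _)]; exact sq_le ε x t
      rwa [abs_of_pos hT0] at this
    refine integral_mono_of_nonneg ?_ (hρ.integrable.const_mul _) ?_
    · filter_upwards [hρ.nonneg] with x hx
      exact mul_nonneg hx (intervalIntegral.integral_nonneg hT.le fun t _ => sq_nonneg _)
    · filter_upwards [hρ.nonneg] with x hx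
      rw [mul_comm (ε ^ 2 * M ^ 2 * (T - τ₁))]
      exact mul_le_mul_of_nonneg_left (hb x) hx
  have step3 : ∀ lam, 0 < lam → X ≤ lam * (E / 4 + M ^ 2 * (T - τ₁) * R / 2) + A * M * η * L := by
    intro lam hlam
    have h1 := step (lam ^ 2) lam (by positivity) hlam
    have h2 := mul_le_mul_of_nonneg_left (step2 (lam ^ 2) (by positivity)) (by positivity : 0 ≤ 1 / (2 * lam * lam ^ 2))
    have h3 : 1 / (2 * lam * lam ^ 2) * ((lam ^ 2) ^ 2 * M ^ 2 * (T - τ₁) * R) = lam * (M ^ 2 * (T - τ₁) * R / 2) := by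
      field_simp
    rw [h3] at h2
    rw [zero_add] at h1
    linarith
  have lim : Tendsto (fun lam : ℝ => lam * (E / 4 + M ^ 2 * (T - τ₁) * R / 2) + A * M * η * L) (𝓝[>] 0)
      (𝓝 (0 * (E / 4 + M ^ 2 * (T - τ₁) * R / 2) + A * M * η * L)) :=
    ((tendsto_id.mono_left nhdsWithin_le_nhds).mul_const _).add_const _
  rw [zero_mul, zero_add] at lim
  exact ge_of_tendsto lim (eventually_mem_nhdsWithin.mono step3)

end DiffIneq
end
end

section
variable {N : ℕ}
section
variable {D : Eu N → ℝ} {Ω : Set (Eu N)} {ρ : Eu N → ℝ} {τ₁ τ₂ A M : ℝ} {a w : Eu N → ℝ → ℝ}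

namespace DiffIneq

lemma ae_moment_nonpos (hw : DiffIneq D Ω ρ τ₁ τ₂ A M a w) (hN : 3 ≤ N) (h : SmoothDom D Ω) (hρ : Weight ρ Ω)
    {ζ : Eu N → ℝ} (hζ : Adm D Ω ζ) : ∀ᵐ t : ℝ, ∫ x in Ω, ρ x * (w x t * ζ x) ≤ 0 := by
  obtain ⟨S, hS0, hS⟩ := exists_deriv_smoothTransition_le
  have hfin := h.isFiniteMeasure
  have bζ := h.essBdd hζ.contDiff.continuous
  have iρζ : Integrable (fun x => ρ x * ζ x) (volume.restrict Ω) := EssBdd.integrable_mul hρ.integrable bζ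
  obtain ⟨W, hW⟩ : ∃ W : ℝ → ℝ, W = fun t => ∫ x in Ω, ρ x * (w x t * ζ x) := ⟨_, rfl⟩
  have hWm : Measurable W := by
    have h1 : Measurable (Function.uncurry fun (t : ℝ) (x : Eu N) => ρ x * (w x t * ζ x)) :=
      (hρ.meas.comp measurable_snd).mul ((hw.meas_w.comp measurable_swap).mul
        (hζ.contDiff.continuous.measurable.comp measurable_snd))
    rw [hW]
    exact (StronglyMeasurable.integral_prod_right (ν := volume.restrict Ω) h1.stronglyMeasurable).measurable
  have hWb : ∀ t, |W t| ≤ M * ∫ x in Ω, |ρ x * ζ x| := fun t => by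
    rw [hW]
    have h1 : ‖∫ x in Ω, ρ x * (w x t * ζ x)‖ ≤ ∫ x in Ω, M * |ρ x * ζ x| :=
      norm_integral_le_of_norm_le (iρζ.abs.const_mul M) (ae_of_all _ fun x => by
        rw [Real.norm_eq_abs, mul_left_comm, abs_mul]
        exact mul_le_mul_of_nonneg_right (hw.w_le x t) (abs_nonneg _))
    rwa [integral_const_mul] at h1
  have hWl : LocallyIntegrable W := locallyIntegrable_of_abs_le hWm hWb
  have fub : ∀ κ : ℝ → ℝ, Integrable κ →
      ∫ x in Ω, ρ x * ((∫ t, w x t * κ t) * ζ x) = ∫ t, W t * κ t := by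
    intro κ hκ
    have i1 : Integrable (fun p : Eu N × ℝ => w p.1 p.2 * (ρ p.1 * ζ p.1 * κ p.2))
        ((volume.restrict Ω).prod volume) :=
      Integrable.bdd_mul (c := M) (iρζ.mul_prod hκ) hw.meas_w.aestronglyMeasurable
        (ae_of_all _ fun p => hw.w_le p.1 p.2)
    have := integral_integral_swap (f := fun x t => w x t * (ρ x * ζ x * κ t)) i1
    calc ∫ x in Ω, ρ x * ((∫ t, w x t * κ t) * ζ x) = ∫ x in Ω, ∫ t, w x t * (ρ x * ζ x * κ t) := by
          refine integral_congr_ae (ae_of_all _ fun x => ?_)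
          simp only
          rw [← integral_mul_const, ← integral_const_mul]
          exact integral_congr_ae (ae_of_all _ fun t => by ring)
      _ = ∫ t, ∫ x in Ω, w x t * (ρ x * ζ x * κ t) := this
      _ = ∫ t, W t * κ t := by
          refine integral_congr_ae (ae_of_all _ fun t => ?_)
          simp only [hW]
          rw [← integral_mul_const]
          exact integral_congr_ae (ae_of_all _ fun x => by ring)
  filter_upwards [ae_isLebesguePt hWl] with T hT
  rw [show (∫ x in Ω, ρ x * (w x T * ζ x)) = W T by rw [hW]]
  by_cases hTI : T ∈ Ioo τ₁ τ₂
  swap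
  · rw [hW]; simp [hw.w_zero _ T hTI]
  have hδ : Tendsto (fun n : ℕ => 1 / ((n : ℝ) + 1)) atTop (𝓝[>] 0) :=
    tendsto_nhdsWithin_iff.2 ⟨tendsto_one_div_add_atTop_nhds_zero_nat, Eventually.of_forall fun n => by
      simp only [mem_Ioi]; positivity⟩
  have hδ0 : ∀ n : ℕ, 0 < 1 / ((n : ℝ) + 1) := fun n => by positivity
  have lim := hT.tendsto hWl (κ := fun n => deriv (ramp T (1 / ((n : ℝ) + 1)))) (C := S) hδ
    (fun n => continuous_deriv_ramp) (Eventually.of_forall fun n y => deriv_ramp_nonneg (hδ0 n))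
    (Eventually.of_forall fun n y => by
      rw [deriv_ramp]; exact div_le_div_of_nonneg_right (hS _) (hδ0 n).le)
    (Eventually.of_forall fun n y hy => deriv_ramp_eq_zero (hδ0 n) fun hy' => hy (by
      rw [mem_closedBall, Real.dist_eq, abs_of_pos (sub_pos.2 hy'.1)]; linarith [hy'.2]))
    (Eventually.of_forall fun n => integral_deriv_ramp (hδ0 n))
  have lim2 : Tendsto (fun n : ℕ => A * M * (1 / ((n : ℝ) + 1)) * ∫ x in Ω, |lap ζ x|) atTop (𝓝 (A * M * 0 * ∫ x in Ω, |lap ζ x|)) :=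
    (tendsto_one_div_add_atTop_nhds_zero_nat.const_mul _).mul_const _
  rw [mul_zero, zero_mul] at lim2
  refine le_of_tendsto_of_tendsto lim lim2 ?_
  filter_upwards [tendsto_one_div_add_atTop_nhds_zero_nat.eventually_le_const (sub_pos.2 hTI.2)] with n hn
  rw [← fub _ (integrable_deriv_ramp (hδ0 n))]
  exact hw.energy_limit hN h hρ hζ hTI.1 (hδ0 n) (by linarith)

end DiffIneq

lemma ae_nonpos_of_bump {f : Eu N × ℝ → ℝ} (hf : Integrable f)
    (hb : ∀ c : Eu N, ∀ G : ContDiffBump c, ∀ᵐ t : ℝ, ∫ x, f (x, t) * G x ≤ 0) : ∀ᵐ p, f p ≤ 0 := by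
  have ball : ∀ (p : Eu N × ℝ) (r : ℝ), 0 < r → ∫ q in closedBall p r, f q ≤ 0 := by
    intro p r hr
    let G : ℕ → ContDiffBump p.1 := fun n => ⟨r, r + 1 / ((n : ℝ) + 1), hr, by
      have : 0 < 1 / ((n : ℝ) + 1) := by positivity
      linarith⟩
    obtain ⟨J, hJ⟩ : ∃ J : ℝ → ℝ, J = (closedBall p.2 r).indicator fun _ => 1 := ⟨_, rfl⟩
    have hJm : Measurable J := by rw [hJ]; exact measurable_const.indicator measurableSet_closedBall
    have hJ0 : ∀ t, 0 ≤ J t := fun t => by rw [hJ]; exact indicator_nonneg (fun _ _ => zero_le_one) t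
    have hJ1 : ∀ t, J t ≤ 1 := fun t => by
      rw [hJ]; exact indicator_le' (fun _ _ => le_rfl) (fun _ _ => zero_le_one) t
    have bd : ∀ n (q : Eu N × ℝ), ‖f q * (G n q.1 * J q.2)‖ ≤ ‖f q‖ := fun n q => by
      rw [norm_mul]
      refine mul_le_of_le_one_right (norm_nonneg _) ?_
      rw [Real.norm_eq_abs, abs_of_nonneg (mul_nonneg (G n).nonneg (hJ0 _))]
      exact mul_le_one₀ (G n).le_one (hJ0 _) (hJ1 _)
    have ms : ∀ n, AEStronglyMeasurable (fun q : Eu N × ℝ => f q * (G n q.1 * J q.2)) volume := fun n =>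
      hf.1.mul (((G n).continuous.comp continuous_fst).measurable.mul (hJm.comp measurable_snd)).aestronglyMeasurable
    have lim : Tendsto (fun n => ∫ q : Eu N × ℝ, f q * (G n q.1 * J q.2)) atTop (𝓝 (∫ q in closedBall p r, f q)) := by
      rw [← integral_indicator measurableSet_closedBall]
      refine tendsto_integral_of_dominated_convergence (fun q => ‖f q‖) ms hf.norm
        (fun n => ae_of_all _ (bd n)) (ae_of_all _ fun q => ?_)
      by_cases hq1 : q.1 ∈ closedBall p.1 r
      · have e : ∀ n, G n q.1 = 1 := fun n => (G n).one_of_mem_closedBall hq1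
        by_cases hq2 : q.2 ∈ closedBall p.2 r
        · have hq : q ∈ closedBall p r := by
            rw [← closedBall_prod_same p.1 p.2]; exact ⟨hq1, hq2⟩
          simp [e, hJ, indicator_of_mem hq2, indicator_of_mem hq]
        · have hq : q ∉ closedBall p r := by
            rw [← closedBall_prod_same p.1 p.2]; exact fun h => hq2 h.2
          simp [hJ, indicator_of_notMem hq2, indicator_of_notMem hq]
      · have hq : q ∉ closedBall p r := by
          rw [← closedBall_prod_same p.1 p.2]; exact fun h => hq1 h.1
        rw [indicator_of_notMem hq]
        rw [mem_closedBall, not_le] at hq1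
        refine tendsto_const_nhds.congr' ?_
        filter_upwards [tendsto_one_div_add_atTop_nhds_zero_nat.eventually_le_const (sub_pos.2 hq1)] with n hn
        rw [(G n).zero_of_le_dist (by change r + 1 / ((n : ℝ) + 1) ≤ _; linarith), zero_mul, mul_zero]
    refine le_of_tendsto' lim fun n => ?_
    have i1 : Integrable (fun q : Eu N × ℝ => f q * (G n q.1 * J q.2)) := hf.mono (ms n) (ae_of_all _ (bd n))
    rw [Measure.volume_eq_prod] at i1 ⊢
    rw [integral_prod_symm _ i1]
    refine integral_nonpos_of_ae ?_
    filter_upwards [hb p.1 (G n)] with t ht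
    have : ∫ x, f (x, t) * (G n x * J t) = (∫ x, f (x, t) * G n x) * J t := by
      rw [← integral_mul_const]; simp only [mul_assoc]
    simp only [this]
    exact mul_nonpos_of_nonpos_of_nonneg ht (hJ0 t)
  filter_upwards [IsUnifLocDoublingMeasure.ae_tendsto_average (μ := (volume : Measure (Eu N × ℝ))) hf.locallyIntegrable 1] with p hp
  have hδ : Tendsto (fun n : ℕ => 1 / ((n : ℝ) + 1)) atTop (𝓝[>] 0) :=
    tendsto_nhdsWithin_iff.2 ⟨tendsto_one_div_add_atTop_nhds_zero_nat, Eventually.of_forall fun n => by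
      simp only [mem_Ioi]; positivity⟩
  have lim := hp (fun _ : ℕ => p) (fun n : ℕ => 1 / ((n : ℝ) + 1)) hδ (Eventually.of_forall fun n => by
    apply mem_closedBall_self; positivity)
  refine le_of_tendsto' lim fun n => ?_
  rw [setAverage_eq]
  exact smul_nonpos_of_nonneg_of_nonpos (inv_nonneg.2 measureReal_nonneg) (ball p _ (by positivity))

lemma DiffIneq.ae_nonpos (hw : DiffIneq D Ω ρ τ₁ τ₂ A M a w) (hN : 3 ≤ N) (h : SmoothDom D Ω) (hρ : Weight ρ Ω) :
    ∀ᵐ p ∂(volume.restrict (Ω ×ˢ Ioo τ₁ τ₂) : Measure (Eu N × ℝ)), w p.1 p.2 ≤ 0 := by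
  have iρD : IntegrableOn (fun x => ρ x * D x) Ω := EssBdd.integrable_mul hρ.integrable (h.essBdd h.cont)
  have i1 : Integrable (Ω.indicator fun x => ρ x * D x) := (integrable_indicator_iff h.meas).2 iρD
  have i2 : Integrable ((Ioo τ₁ τ₂).indicator fun _ => (1 : ℝ)) :=
    (integrable_indicator_iff measurableSet_Ioo).2 (integrableOn_const (by simp))
  have hf : Integrable fun p : Eu N × ℝ => w p.1 p.2 * (Ω.indicator (fun x => ρ x * D x) p.1 *
      (Ioo τ₁ τ₂).indicator (fun _ => (1 : ℝ)) p.2) := by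
    rw [Measure.volume_eq_prod]
    exact Integrable.bdd_mul (c := M) (i1.mul_prod i2) hw.meas_w.aestronglyMeasurable
        (ae_of_all _ fun p => hw.w_le p.1 p.2)
  have key := ae_nonpos_of_bump hf fun c G => by
    filter_upwards [hw.ae_moment_nonpos hN h hρ (adm_mul h (G := G) G.contDiff fun x => G.nonneg)] with t ht
    by_cases htI : t ∈ Ioo τ₁ τ₂
    · refine le_of_eq_of_le ?_ ht
      rw [← integral_indicator h.meas]
      refine integral_congr_ae (ae_of_all _ fun x => ?_)
      by_cases hx : x ∈ Ω
      · simp only [indicator_of_mem hx, indicator_of_mem htI]; ring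
      · simp [indicator_of_notMem hx]
    · simp [hw.w_zero _ t htI]
  have hρpos : ∀ᵐ p ∂(volume.restrict (Ω ×ˢ Ioo τ₁ τ₂) : Measure (Eu N × ℝ)), 0 < ρ p.1 := by
    obtain ⟨c, hc, hcρ⟩ := hρ.lower
    rw [Measure.volume_eq_prod, ← Measure.prod_restrict]
    exact Measure.quasiMeasurePreserving_fst.ae (hcρ.mono fun x hx => hc.trans_le hx)
  filter_upwards [ae_restrict_of_ae key, hρpos, ae_restrict_mem (h.meas.prod measurableSet_Ioo)] with p h1 h2 h3
  rw [indicator_of_mem h3.1, indicator_of_mem h3.2, mul_one] at h1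
  exact nonpos_of_mul_nonpos_left h1 (mul_pos h2 (h.mem.1 h3.1))
end
end

section
variable {N : ℕ}
section
variable {Ω : Set (Eu N)} {ρ : Eu N → ℝ} {γ Cl Cu m M : ℝ}

lemma integrableOn_norm_rpow (hN : 3 ≤ N) (hγ : γ < 2) {r : ℝ} (hr : 0 < r) :
    IntegrableOn (fun x : Eu N => ‖x‖ ^ (-γ)) (ball 0 r) := by
  have : Nontrivial (Eu N) := Module.nontrivial_of_finrank_pos (R := ℝ) (by
    rw [finrank_euclideanSpace_fin]; omega)
  rw [integrableOn_fun_norm_addHaar volume (f := fun y => y ^ (-γ)), finrank_euclideanSpace_fin]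
  have h3 : (3 : ℝ) ≤ N := by exact_mod_cast hN
  refine ((intervalIntegral.integrableOn_Ioo_rpow_iff (s := N - 1 - γ) hr).2 (by linarith)).congr_fun
    (fun y hy => ?_) measurableSet_Ioo
  rw [smul_eq_mul, ← Real.rpow_natCast, ← Real.rpow_add hy.1, Nat.cast_sub (by omega), Nat.cast_one]
  ring_nf

lemma WeightCond.weight (hρ : WeightCond N γ Cl Cu ρ) (hN : 3 ≤ N) (hb : Bornology.IsBounded Ω)
    : Weight ρ Ω := by
  obtain ⟨hm, hγ0, hγ2, hCl, hClu, hae⟩ := hρ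
  obtain ⟨r, hr0, hr⟩ := hb.subset_ball_lt 0 0
  have hCu : 0 < Cu := hCl.trans hClu
  refine ⟨hm, ⟨Cl * (1 + r) ^ (-γ), by positivity, ?_⟩, ?_, fun e he => ⟨Cu * e ^ (-γ), by positivity, ?_⟩⟩
  · have hball : ∀ᵐ x ∂(volume.restrict Ω), x ∈ ball (0 : Eu N) r :=
      ae_mono (Measure.restrict_mono hr le_rfl) (ae_restrict_mem measurableSet_ball)
    filter_upwards [ae_restrict_of_ae hae, hball] with x hx hxr
    refine le_trans (mul_le_mul_of_nonneg_left ?_ hCl.le) hx.1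
    rw [mem_ball_zero_iff] at hxr
    exact Real.rpow_le_rpow_of_nonpos (by positivity) (by linarith) (by linarith)
  · refine (((integrableOn_norm_rpow hN hγ2 hr0).mono_set hr).const_mul Cu).mono' hm.aestronglyMeasurable ?_
    filter_upwards [ae_restrict_of_ae hae] with x hx
    have : 0 ≤ ρ x := le_trans (by positivity) hx.1
    rw [Real.norm_eq_abs, abs_of_nonneg this]
    exact hx.2
  · filter_upwards [ae_restrict_of_ae hae] with x hx hxe
    exact hx.2.trans (mul_le_mul_of_nonneg_left (Real.rpow_le_rpow_of_nonpos he hxe (by linarith)) hCu.le)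

lemma spow_neg (x : ℝ) : spow (-x) m = -spow x m := by simp [spow]

lemma spow_zero : spow 0 m = 0 := by simp [spow]

lemma spow_of_nonneg {x : ℝ} (hm : 1 < m) (hx : 0 ≤ x) : spow x m = x ^ m := by
  rcases hx.eq_or_lt with rfl | hx
  · rw [spow_zero, Real.zero_rpow (by linarith)]
  · rw [spow, abs_of_pos hx, Real.rpow_sub_one hx.ne', div_mul_cancel₀ _ hx.ne']

lemma measurable_spow : Measurable fun x => spow x m := by
  unfold spow
  exact (measurable_id.abs.pow_const _).mul measurable_id

lemma spow_sub_bounds_of_nonneg (hm : 1 < m) {x y : ℝ} (hy : 0 ≤ y) (hyx : y ≤ x) (hx : x ≤ M) :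
    0 ≤ spow x m - spow y m ∧ spow x m - spow y m ≤ m * M ^ (m - 1) * (x - y) := by
  rw [spow_of_nonneg hm hy, spow_of_nonneg hm (hy.trans hyx)]
  refine ⟨sub_nonneg.2 (Real.rpow_le_rpow hy hyx (by linarith)), ?_⟩
  have hd : ∀ t : ℝ, HasDerivAt (fun t : ℝ => t ^ m) (m * t ^ (m - 1)) t := fun t =>
    Real.hasDerivAt_rpow_const (Or.inr hm.le)
  refine Convex.image_sub_le_mul_sub_of_deriv_le (convex_Icc 0 M) (f := fun t : ℝ => t ^ m)
    (fun t _ => (hd t).continuousAt.continuousWithinAt) (fun t _ => (hd t).differentiableAt.differentiableWithinAt)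
    (fun t ht => ?_) y ⟨hy, hyx.trans hx⟩ x ⟨hy.trans hyx, hx⟩ hyx
  rw [interior_Icc] at ht
  rw [(hd t).deriv]
  exact mul_le_mul_of_nonneg_left (Real.rpow_le_rpow ht.1.le ht.2.le (by linarith)) (by linarith)

lemma spow_sub_bounds (hm : 1 < m) {x y : ℝ} (hyx : y ≤ x) (hx : |x| ≤ M) (hy : |y| ≤ M) :
    0 ≤ spow x m - spow y m ∧ spow x m - spow y m ≤ m * M ^ (m - 1) * (x - y) := by
  rw [abs_le] at hx hy
  rcases le_total 0 y with h1 | h1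
  · exact spow_sub_bounds_of_nonneg hm h1 hyx hx.2
  rcases le_total 0 x with h2 | h2
  · have e1 := spow_sub_bounds_of_nonneg hm le_rfl h2 hx.2
    have e2 := spow_sub_bounds_of_nonneg (M := M) hm le_rfl (neg_nonneg.2 h1) (by linarith)
    rw [spow_zero] at e1 e2
    rw [spow_neg] at e2
    constructor <;> linarith [e1.1, e1.2, e2.1, e2.2]
  · have e := spow_sub_bounds_of_nonneg (M := M) hm (neg_nonneg.2 h2) (neg_le_neg hyx) (by linarith)
    rw [spow_neg, spow_neg] at e
    constructor <;> linarith [e.1, e.2]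

lemma spow_quotient (hm : 1 < m) {x y : ℝ} (hx : |x| ≤ M) (hy : |y| ≤ M) :
    0 ≤ (spow x m - spow y m) / (x - y) ∧ (spow x m - spow y m) / (x - y) ≤ m * M ^ (m - 1) ∧
      (spow x m - spow y m) / (x - y) * (x - y) = spow x m - spow y m := by
  have hM : 0 ≤ M := (abs_nonneg _).trans hx
  rcases lt_trichotomy x y with h | rfl | h
  · have e := spow_sub_bounds hm h.le hy hx
    have h' : 0 < y - x := sub_pos.2 h
    have e2 : (spow x m - spow y m) / (x - y) = (spow y m - spow x m) / (y - x) := by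
      rw [← neg_sub y x, ← neg_sub (spow y m), neg_div_neg_eq]
    exact ⟨by rw [e2]; exact div_nonneg e.1 h'.le, by rw [e2, div_le_iff₀ h']; exact e.2,
      div_mul_cancel₀ _ (by linarith)⟩
  · simp only [sub_self, div_zero, mul_zero, le_refl, true_and, and_true]
    positivity
  · have e := spow_sub_bounds hm h.le hx hy
    have h' : 0 < x - y := sub_pos.2 h
    exact ⟨div_nonneg e.1 h'.le, by rw [div_le_iff₀ h']; exact e.2, div_mul_cancel₀ _ h'.ne'⟩

lemma exists_bounded_representative {X : Type*} [MeasurableSpace X] {μ : Measure X} {s : Set X} (hs : MeasurableSet s)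
    {f : X → ℝ} (hf : AEMeasurable f (μ.restrict s)) {M : ℝ} (hM : ∀ᵐ x ∂(μ.restrict s), |f x| ≤ M) (hM0 : 0 ≤ M) :
    ∃ g : X → ℝ, Measurable g ∧ (∀ x, |g x| ≤ M) ∧ (∀ x, x ∉ s → g x = 0) ∧ ∀ᵐ x ∂(μ.restrict s), f x = g x := by
  refine ⟨s.indicator fun x => max (-M) (min M (hf.mk f x)),
    (measurable_const.max (measurable_const.min hf.measurable_mk)).indicator hs, fun x => ?_,
    fun x hx => indicator_of_notMem hx _, ?_⟩
  · by_cases hx : x ∈ s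
    · rw [indicator_of_mem hx, abs_le]
      exact ⟨le_max_left _ _, max_le (by linarith) (min_le_left _ _)⟩
    · rw [indicator_of_notMem hx, abs_zero]; exact hM0
  · filter_upwards [hM, hf.ae_eq_mk, ae_restrict_mem hs] with x h1 h2 h3
    rw [indicator_of_mem h3, ← h2]
    rw [abs_le] at h1
    rw [min_eq_right h1.2, max_eq_right h1.1]

end
section
variable {ζ : Eu N → ℝ} {θ : ℝ → ℝ}

lemma ptder_mul (hζ : ContDiff ℝ 2 ζ) (hθ : ContDiff ℝ 2 θ) (p : Eu N × ℝ) :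
    ptder (fun q => ζ q.1 * θ q.2) p = ζ p.1 * deriv θ p.2 := by
  have h1 : HasFDerivAt (fun q : Eu N × ℝ => ζ q.1) ((fderiv ℝ ζ p.1).comp (ContinuousLinearMap.fst ℝ (Eu N) ℝ)) p :=
    (hζ.differentiable (by norm_num) p.1).hasFDerivAt.comp p hasFDerivAt_fst
  have h2 : HasFDerivAt (fun q : Eu N × ℝ => θ q.2) ((fderiv ℝ θ p.2).comp (ContinuousLinearMap.snd ℝ (Eu N) ℝ)) p :=
    (hθ.differentiable (by norm_num) p.2).hasFDerivAt.comp p hasFDerivAt_snd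
  rw [ptder, (h1.fun_mul h2).fderiv]
  simp

lemma fderiv_mul_fst {f : Eu N → ℝ} (hf : ContDiff ℝ 1 f) (hθ : ContDiff ℝ 2 θ) (p : Eu N × ℝ) (v : Eu N) :
    fderiv ℝ (fun q : Eu N × ℝ => f q.1 * θ q.2) p (v, 0) = fderiv ℝ f p.1 v * θ p.2 := by
  have h1 : HasFDerivAt (fun q : Eu N × ℝ => f q.1) ((fderiv ℝ f p.1).comp (ContinuousLinearMap.fst ℝ (Eu N) ℝ)) p :=
    (hf.differentiable (by norm_num) p.1).hasFDerivAt.comp p hasFDerivAt_fst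
  have h2 : HasFDerivAt (fun q : Eu N × ℝ => θ q.2) ((fderiv ℝ θ p.2).comp (ContinuousLinearMap.snd ℝ (Eu N) ℝ)) p :=
    (hθ.differentiable (by norm_num) p.2).hasFDerivAt.comp p hasFDerivAt_snd
  rw [(h1.fun_mul h2).fderiv]
  simp [mul_comm]

lemma lapX_mul (hζ : ContDiff ℝ 2 ζ) (hθ : ContDiff ℝ 2 θ) (p : Eu N × ℝ) :
    lapX (fun q => ζ q.1 * θ q.2) p = lap ζ p.1 * θ p.2 := by
  rw [lapX, lap, Finset.sum_mul]
  refine Finset.sum_congr rfl fun i _ => ?_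
  simp only [fderiv_mul_fst (hζ.of_le (by norm_num)) hθ]
  exact fderiv_mul_fst (f := fun y => fderiv ℝ ζ y (unitVec i))
    ((hζ.fderiv_right (m := 1) (by norm_num)).clm_apply contDiff_const) hθ p _

end
end

section
variable {N : ℕ}
section
variable {D : Eu N → ℝ} {Ω : Set (Eu N)} {ρ : Eu N → ℝ} {τ₁ τ₂ M m : ℝ}

lemma Adm.nonneg_closure {ζ : Eu N → ℝ} (hζ : Adm D Ω ζ) {x : Eu N} (hx : x ∈ closure Ω) : 0 ≤ ζ x :=
  closure_minimal (fun y hy => hζ.nonneg y hy) (isClosed_le continuous_const hζ.contDiff.continuous) hx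

lemma Adm.zero_frontier (h : SmoothDom D Ω) {ζ : Eu N → ℝ} (hζ : Adm D Ω ζ) {x : Eu N} (hx : x ∈ frontier Ω) : ζ x = 0 := by
  have hxc := frontier_subset_closure hx
  refine le_antisymm ?_ (hζ.nonneg_closure hxc)
  obtain ⟨C, hC⟩ := hζ.bound
  have h1 : ζ x ≤ C * D x := closure_minimal (fun y hy => (hC y hy).1)
    (isClosed_le hζ.contDiff.continuous (continuous_const.mul h.cont)) hxc
  rw [h.frontier_eq] at hx
  rwa [show D x = 0 from hx, mul_zero] at h1

lemma essBdd_of_continuous_cylinder (h : SmoothDom D Ω) {f : Eu N × ℝ → ℝ} (hf : Continuous f) :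
    EssBdd (volume.restrict (Ω ×ˢ Ioo τ₁ τ₂)) f := by
  obtain ⟨C, hC⟩ := (h.isCompact_closure.prod (isCompact_Icc (a := τ₁) (b := τ₂))).exists_bound_of_continuousOn hf.continuousOn
  exact .of_bound hf.aestronglyMeasurable ((ae_restrict_mem (h.meas.prod measurableSet_Ioo)).mono fun p hp =>
    hC p ⟨subset_closure hp.1, Ioo_subset_Icc_self hp.2⟩)

lemma isFiniteMeasure_cylinder (h : SmoothDom D Ω) : IsFiniteMeasure (volume.restrict (Ω ×ˢ Ioo τ₁ τ₂)) := by
  have := h.isFiniteMeasure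
  rw [Measure.volume_eq_prod, ← Measure.prod_restrict]
  infer_instance

lemma Weight.integrable_cylinder (hρ : Weight ρ Ω) : IntegrableOn (fun p : Eu N × ℝ => ρ p.1) (Ω ×ˢ Ioo τ₁ τ₂) := by
  rw [IntegrableOn, Measure.volume_eq_prod, ← Measure.prod_restrict]
  exact hρ.integrable.comp_fst _

lemma abs_spow_le (hm : 1 < m) {x : ℝ} (hx : |x| ≤ M) : |spow x m| ≤ M ^ (m - 1) * M := by
  rw [spow, abs_mul, abs_of_nonneg (Real.rpow_nonneg (abs_nonneg _) _)]
  exact mul_le_mul (Real.rpow_le_rpow (abs_nonneg _) hx (by linarith)) hx (abs_nonneg _)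
    (Real.rpow_nonneg ((abs_nonneg _).trans hx) _)

lemma integrableOn_bdd_mul_Ioo {F : Eu N × ℝ → ℝ} (hF : Measurable F) {C : ℝ} (hC : ∀ p, |F p| ≤ C) {g : ℝ → ℝ}
    (hg : Continuous g) (x : Eu N) : IntegrableOn (fun t => F (x, t) * g t) (Ioo τ₁ τ₂) :=
  Integrable.bdd_mul (c := C) (hg.integrableOn_Icc.mono_set Ioo_subset_Icc_self)
    (hF.comp measurable_prodMk_left).aestronglyMeasurable (ae_of_all _ fun t => hC (x, t))

lemma diffIneq_of_sub (h : SmoothDom D Ω) (hρ : Weight ρ Ω) (hm : 1 < m) {U V : Eu N × ℝ → ℝ}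
    (hU : Measurable U) (hV : Measurable V) (hUM : ∀ p, |U p| ≤ M) (hVM : ∀ p, |V p| ≤ M)
    (hU0 : ∀ p, p ∉ Ω ×ˢ Ioo τ₁ τ₂ → U p = 0) (hV0 : ∀ p, p ∉ Ω ×ˢ Ioo τ₁ τ₂ → V p = 0)
    (hUV : ∀ ψ : Eu N × ℝ → ℝ, ContDiff ℝ 2 ψ →
      (∀ y ∈ frontier Ω, ∀ t ∈ Ioo τ₁ τ₂, ψ (y, t) = 0) →
      (∀ x ∈ closure Ω, ψ (x, τ₂) = 0) →
      (∀ x ∈ closure Ω, ∀ t ∈ Icc τ₁ τ₂, 0 ≤ ψ (x, t)) →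
      ∫ p in Ω ×ˢ Ioo τ₁ τ₂, (V p * ptder ψ p * ρ p.1 + spow (V p) m * lapX ψ p) ≤
        ∫ p in Ω ×ˢ Ioo τ₁ τ₂, (U p * ptder ψ p * ρ p.1 + spow (U p) m * lapX ψ p)) :
    DiffIneq D Ω ρ τ₁ τ₂ (m * M ^ (m - 1)) (2 * M)
      (fun x t => (spow (U (x, t)) m - spow (V (x, t)) m) / (U (x, t) - V (x, t)))
      (fun x t => U (x, t) - V (x, t)) := by
  have hq := fun p => spow_quotient hm (hUM p) (hVM p)
  have hw0 : ∀ x t, t ∉ Ioo τ₁ τ₂ → U (x, t) - V (x, t) = 0 := fun x t ht => by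
    rw [hU0 _ fun hp => ht hp.2, hV0 _ fun hp => ht hp.2, sub_self]
  refine ⟨hU.sub hV, ((measurable_spow.comp hU).sub (measurable_spow.comp hV)).div (hU.sub hV), fun x t => ?_,
    fun x t => (hq (x, t)).1, fun x t => (hq (x, t)).2.1, hw0, fun θ hθ hθ0 hθτ ζ hζ => ?_⟩
  · exact (abs_sub _ _).trans (by linarith [hUM (x, t), hVM (x, t)])
  have hz : ∀ p, (spow (U p) m - spow (V p) m) / (U p - V p) * (U p - V p) = spow (U p) m - spow (V p) m :=
    fun p => (hq p).2.2
  simp only [hz]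
  have key := hUV (fun q => ζ q.1 * θ q.2) ((hζ.contDiff.comp contDiff_fst).mul (hθ.comp contDiff_snd))
    (fun y hy t _ => by simp only [hζ.zero_frontier h hy, zero_mul])
    (fun x _ => by simp only [hθτ, mul_zero])
    (fun x hx t _ => mul_nonneg (hζ.nonneg_closure hx) (hθ0 t))
  simp only [ptder_mul hζ.contDiff hθ, lapX_mul hζ.contDiff hθ] at key
  have hfin := isFiniteMeasure_cylinder (τ₁ := τ₁) (τ₂ := τ₂) h
  have b1 : EssBdd (volume.restrict (Ω ×ˢ Ioo τ₁ τ₂)) fun p : Eu N × ℝ => ζ p.1 * deriv θ p.2 :=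
    essBdd_of_continuous_cylinder h ((hζ.contDiff.continuous.comp continuous_fst).mul
      ((hθ.continuous_deriv (by norm_num)).comp continuous_snd))
  have b2 : EssBdd (volume.restrict (Ω ×ˢ Ioo τ₁ τ₂)) fun p : Eu N × ℝ => lap ζ p.1 * θ p.2 :=
    essBdd_of_continuous_cylinder h (((continuous_lap hζ.contDiff).comp continuous_fst).mul
      (hθ.continuous.comp continuous_snd))
  have int : ∀ W : Eu N × ℝ → ℝ, Measurable W → (∀ p, |W p| ≤ M) →
      IntegrableOn (fun p : Eu N × ℝ => W p * (ζ p.1 * deriv θ p.2) * ρ p.1 + spow (W p) m * (lap ζ p.1 * θ p.2))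
        (Ω ×ˢ Ioo τ₁ τ₂) := fun W hW hWM => by
    have b3 : EssBdd (volume.restrict (Ω ×ˢ Ioo τ₁ τ₂)) W := .of_bound hW.aestronglyMeasurable (ae_of_all _ hWM)
    have b4 : EssBdd (volume.restrict (Ω ×ˢ Ioo τ₁ τ₂)) fun p => spow (W p) m := by
      exact .of_bound (measurable_spow.comp hW).aestronglyMeasurable (ae_of_all _ fun p => abs_spow_le hm (hWM p))
    refine Integrable.fun_add ?_ (b4.mul b2).integrable
    simpa only [mul_comm] using EssBdd.integrable_mul hρ.integrable_cylinder (b3.mul b1)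
  have iU := int U hU hUM
  have iV := int V hV hVM
  rw [← sub_nonneg, ← integral_sub iU iV] at key
  refine key.trans_eq ?_
  have iS := iU.fun_sub iV
  rw [IntegrableOn, Measure.volume_eq_prod] at iS
  rw [Measure.volume_eq_prod, setIntegral_prod _ iS]
  refine integral_congr_ae (ae_of_all _ fun x => ?_)
  have c1 : IntegrableOn (fun t => (U (x, t) - V (x, t)) * deriv θ t) (Ioo τ₁ τ₂) :=
    integrableOn_bdd_mul_Ioo (hU.sub hV) (fun p => (abs_sub _ _).trans (add_le_add (hUM p) (hVM p)))
      (hθ.continuous_deriv (by norm_num)) x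
  have c2 : IntegrableOn (fun t => (spow (U (x, t)) m - spow (V (x, t)) m) * θ t) (Ioo τ₁ τ₂) :=
    integrableOn_bdd_mul_Ioo ((measurable_spow.comp hU).sub (measurable_spow.comp hV))
      (fun p => (abs_sub _ _).trans (add_le_add (abs_spow_le hm (hUM p)) (abs_spow_le hm (hVM p))))
      hθ.continuous x
  have d1 : ∫ t, (U (x, t) - V (x, t)) * deriv θ t = ∫ t in Ioo τ₁ τ₂, (U (x, t) - V (x, t)) * deriv θ t :=
    (setIntegral_eq_integral_of_forall_compl_eq_zero fun t ht => by rw [hw0 x t ht, zero_mul]).symm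
  have d2 : ∫ t, (spow (U (x, t)) m - spow (V (x, t)) m) * θ t =
      ∫ t in Ioo τ₁ τ₂, (spow (U (x, t)) m - spow (V (x, t)) m) * θ t :=
    (setIntegral_eq_integral_of_forall_compl_eq_zero fun t ht => by
      rw [sub_eq_zero.1 (hw0 x t ht), sub_self, zero_mul]).symm
  have d3 := integral_add (c1.mul_const (ζ x * ρ x)) (c2.mul_const (lap ζ x))
  rw [integral_mul_const, integral_mul_const] at d3
  dsimp only
  rw [d1, d2]
  have d4 : ∀ P Q : ℝ, -Q * -lap ζ x + ρ x * (P * ζ x) = P * (ζ x * ρ x) + Q * lap ζ x := fun P Q => by ring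
  rw [d4, ← d3]
  exact integral_congr_ae (ae_of_all _ fun t => by dsimp only; ring)

end
end

/-- **Proposition 3.5 (local comparison for very weak sub/supersolutions of the
Cauchy–Dirichlet problem)** on a bounded smooth domain `Ω = {Φ < 0}`. A bounded very weak
subsolution lies below a bounded very weak supersolution with the same initial datum `u₀` and
boundary datum `g`. -/
theorem stmt_11 {N : ℕ} (hN : 3 ≤ N) (m γ Cl Cu : ℝ) (hm : 1 < m)
    (ρ : Eu N → ℝ) (hρ : WeightCond N γ Cl Cu ρ)
    -- a bounded smooth domain described by a smooth defining function Φ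
    (Φ : Eu N → ℝ) (hΦ : ContDiff ℝ (⊤ : ℕ∞) Φ)
    (Ω : Set (Eu N)) (hΩdef : Ω = {x | Φ x < 0}) (hΩbdd : Bornology.IsBounded Ω)
    (hΩne : Ω.Nonempty)
    (hfr : frontier Ω = {x | Φ x = 0})
    (hreg : ∀ x ∈ frontier Ω, gradient Φ x ≠ 0)
    (τ₁ τ₂ : ℝ) (hτ₁ : 0 ≤ τ₁) (hτ : τ₁ < τ₂)
    -- bounded initial and boundary data
    (u₀ : Eu N → ℝ) (hu₀meas : AEMeasurable u₀ (volume.restrict Ω))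
    (hu₀bdd : ∃ M : ℝ, ∀ᵐ x ∂(volume.restrict Ω : Measure (Eu N)), |u₀ x| ≤ M)
    (g : Eu N → ℝ → ℝ) (hgbdd : ∃ M : ℝ, ∀ y ∈ frontier Ω, ∀ t ∈ Ioo τ₁ τ₂, |g y t| ≤ M)
    -- the bounded sub/supersolutions
    (u v : Eu N → ℝ → ℝ)
    (humeas : AEMeasurable (fun p : Eu N × ℝ => u p.1 p.2) (volume.restrict (Ω ×ˢ Ioo τ₁ τ₂)))
    (hvmeas : AEMeasurable (fun p : Eu N × ℝ => v p.1 p.2) (volume.restrict (Ω ×ˢ Ioo τ₁ τ₂)))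
    (hubdd : ∃ M : ℝ,
      ∀ᵐ p ∂(volume.restrict (Ω ×ˢ Ioo τ₁ τ₂) : Measure (Eu N × ℝ)), |u p.1 p.2| ≤ M)
    (hvbdd : ∃ M : ℝ,
      ∀ᵐ p ∂(volume.restrict (Ω ×ˢ Ioo τ₁ τ₂) : Measure (Eu N × ℝ)), |v p.1 p.2| ≤ M)
    -- u is a very weak subsolution: the Cauchy–Dirichlet identity holds with `≥`
    (hsub : ∀ ψ : Eu N × ℝ → ℝ, ContDiff ℝ 2 ψ →
      (∀ y ∈ frontier Ω, ∀ t ∈ Ioo τ₁ τ₂, ψ (y, t) = 0) →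
      (∀ x ∈ closure Ω, ψ (x, τ₂) = 0) →
      (∀ x ∈ closure Ω, ∀ t ∈ Icc τ₁ τ₂, 0 ≤ ψ (x, t)) →
      (∫ p in Ω ×ˢ Ioo τ₁ τ₂,
          (u p.1 p.2 * ptder ψ p * ρ p.1 + spow (u p.1 p.2) m * lapX ψ p))
        + ∫ x in Ω, u₀ x * ψ (x, τ₁) * ρ x ≥
        ∫ t in Ioo τ₁ τ₂, ∫ y in frontier Ω,
          g y t * fderiv ℝ (fun x => ψ (x, t)) y
            (‖gradient Φ y‖⁻¹ • gradient Φ y) ∂(μH[(N:ℝ) - 1]))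
    -- v is a very weak supersolution: the Cauchy–Dirichlet identity holds with `≤`
    (hsup : ∀ ψ : Eu N × ℝ → ℝ, ContDiff ℝ 2 ψ →
      (∀ y ∈ frontier Ω, ∀ t ∈ Ioo τ₁ τ₂, ψ (y, t) = 0) →
      (∀ x ∈ closure Ω, ψ (x, τ₂) = 0) →
      (∀ x ∈ closure Ω, ∀ t ∈ Icc τ₁ τ₂, 0 ≤ ψ (x, t)) →
      (∫ p in Ω ×ˢ Ioo τ₁ τ₂,
          (v p.1 p.2 * ptder ψ p * ρ p.1 + spow (v p.1 p.2) m * lapX ψ p))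
        + ∫ x in Ω, u₀ x * ψ (x, τ₁) * ρ x ≤
        ∫ t in Ioo τ₁ τ₂, ∫ y in frontier Ω,
          g y t * fderiv ℝ (fun x => ψ (x, t)) y
            (‖gradient Φ y‖⁻¹ • gradient Φ y) ∂(μH[(N:ℝ) - 1])) :
    ∀ᵐ p ∂(volume.restrict (Ω ×ˢ Ioo τ₁ τ₂) : Measure (Eu N × ℝ)),
      u p.1 p.2 ≤ v p.1 p.2 := by
  have h : SmoothDom (fun x => -Φ x) Ω := by
    refine ⟨hΦ.neg, ?_, hΩbdd, ?_, fun x hx => ?_⟩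
    · simpa only [neg_pos] using hΩdef
    · simpa only [neg_eq_zero] using hfr
    · rw [gradient, fderiv_fun_neg, map_neg, neg_ne_zero]
      exact hreg x (by rw [hfr]; exact neg_eq_zero.1 hx)
  have hw := hρ.weight hN hΩbdd
  obtain ⟨Mu, hMu⟩ := hubdd
  obtain ⟨Mv, hMv⟩ := hvbdd
  have hM0 : 0 ≤ max |Mu| |Mv| := (abs_nonneg _).trans (le_max_left _ _)
  have hs := h.meas.prod (measurableSet_Ioo (a := τ₁) (b := τ₂))
  obtain ⟨U, hU, hUM, hU0, hUu⟩ := exists_bounded_representative hs humeas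
    (hMu.mono fun p hp => hp.trans ((le_abs_self _).trans (le_max_left _ |Mv|))) hM0
  obtain ⟨V, hV, hVM, hV0, hVv⟩ := exists_bounded_representative hs hvmeas
    (hMv.mono fun p hp => hp.trans ((le_abs_self _).trans (le_max_right |Mu| _))) hM0
  have key := (diffIneq_of_sub h hw hm hU hV hUM hVM hU0 hV0 fun ψ h1 h2 h3 h4 => by
    have eu := hsub ψ h1 h2 h3 h4
    have ev := hsup ψ h1 h2 h3 h4
    rw [integral_congr_ae (g := fun p => U p * ptder ψ p * ρ p.1 + spow (U p) m * lapX ψ p)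
      (hUu.mono fun p hp => by simp only [hp])] at eu
    rw [integral_congr_ae (g := fun p => V p * ptder ψ p * ρ p.1 + spow (V p) m * lapX ψ p)
      (hVv.mono fun p hp => by simp only [hp])] at ev
    linarith).ae_nonpos hN h hw
  filter_upwards [key, hUu, hVv] with p hp hpu hpv
  rw [hpu, hpv]
  exact sub_nonpos.1 hp
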